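/- arXiv:1806.06022 — 3 statements merged into one kernel-verified Lean document; each statement's English description precedes it below -/
import Mathlib

section
/- For all positive integers k, m, and r there is a constant C = C(k, m, r) such that the following holds. If G is a group and A ⊆ G is a nonempty finite set with |A³| ≤ k|A| and the subgroup ⟨A⟩ has exponent r, then there is a subgroup H of ⟨A⟩ such that Āᵐ is covered by at most C left cosets of H, where Ā = A ∪ A⁻¹ ∪ {1}, and H ⊆ (AA⁻¹)² ∩ A²A⁻² ∩ (A⁻¹A)² ∩ A⁻²A². -/
open Pointwise

namespace STBE

open Finset

structure AG {G : Type} [Group G] [DecidableEq G] (K : ℝ) (D : Finset G) : Prop where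
  one_mem : (1 : G) ∈ D
  symm : D⁻¹ = D
  card : ∀ j : ℕ, ((D ^ j).card : ℝ) ≤ K ^ j * D.card

structure Nb {G : Type} [Group G] [DecidableEq G] (D : Finset G) (c : ℝ) (S : Finset G) :
    Prop where
  one_mem : (1 : G) ∈ S
  symm : S⁻¹ = S
  sub : S ^ 4 ⊆ D ^ 4
  card : c * D.card ≤ (S.card : ℝ)

lemma pow_sub {G : Type} [Group G] [DecidableEq G] {S : Finset G} (h : (1 : G) ∈ S) {i j : ℕ}
    (hij : i ≤ j) : S ^ i ⊆ S ^ j := Finset.pow_subset_pow_right h hij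

lemma inv_pow_symm {G : Type} [Group G] [DecidableEq G] {S : Finset G} (h : S⁻¹ = S) (i : ℕ) :
    (S ^ i)⁻¹ = S ^ i := by
  rw [← inv_pow, h]

lemma growth {G : Type} [Group G] [DecidableEq G] (k : ℕ) (hk : 0 < k) (A : Finset G)
    (hA : A.Nonempty) (h3 : (A ^ 3).card ≤ k * A.card) :
    AG (27 * (k : ℝ) ^ 3) (A ∪ A⁻¹ ∪ 1) := by
  set D := A ∪ A⁻¹ ∪ 1 with hD
  have hk1 : (1 : ℝ) ≤ k := by exact_mod_cast hk
  have hA3 : (((A ^ 3).card : ℕ) : ℝ) ≤ (k : ℝ) * (A.card : ℝ) := by exact_mod_cast h3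
  have h1 : (1 : G) ∈ D := by simp [hD]
  have hs : D⁻¹ = D := by
    ext x; simp only [hD, Finset.mem_inv', Finset.mem_union, Finset.mem_one, inv_inv, inv_eq_one]
    tauto
  have key : ∀ e : Fin 3 → ℤ, (∀ i, |e i| = 1) →
      ((A ^ e 0 * A ^ e 1 * A ^ e 2).card : ℝ) ≤ (k : ℝ) ^ 3 * A.card := by
    intro e he
    have := Finset.small_alternating_pow_of_small_tripling (m := 3) le_rfl hA3 e he
    simpa [List.finRange_succ, mul_assoc] using this
  let T : Finset (Finset G) := {A, A⁻¹}
  have key' : ∀ X ∈ T, ∀ Y ∈ T, ∀ Z ∈ T, ((X * Y * Z).card : ℝ) ≤ (k : ℝ) ^ 3 * A.card := by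
    have hT : ∀ X ∈ T, ∃ e : ℤ, |e| = 1 ∧ A ^ e = X := by
      intro X hX
      simp only [T, Finset.mem_insert, Finset.mem_singleton] at hX
      rcases hX with rfl | rfl
      · exact ⟨1, by simp, by simp⟩
      · exact ⟨-1, by simp, by simp⟩
    intro X hX Y hY Z hZ
    obtain ⟨a, ha, rfl⟩ := hT X hX
    obtain ⟨b, hb, rfl⟩ := hT Y hY
    obtain ⟨c, hc, rfl⟩ := hT Z hZ
    have := key ![a, b, c] (by intro i; fin_cases i <;> simpa)
    simpa using this
  have hAT : A ∈ T := by simp [T]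
  have key2 : ∀ X ∈ T, ∀ Y ∈ T, ((X * Y).card : ℝ) ≤ (k : ℝ) ^ 3 * A.card := by
    intro X hX Y hY
    refine le_trans ?_ (key' A hAT X hX Y hY)
    rw [mul_assoc]
    exact_mod_cast Finset.card_le_card_mul_left hA
  have key1 : ∀ X ∈ T, ((X).card : ℝ) ≤ (k : ℝ) ^ 3 * A.card := by
    intro X hX
    refine le_trans ?_ (key2 A hAT X hX)
    exact_mod_cast Finset.card_le_card_mul_left hA
  have key0 : (((1 : Finset G)).card : ℝ) ≤ (k : ℝ) ^ 3 * A.card := by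
    refine le_trans ?_ (key1 A hAT)
    simpa using hA.card_pos
  let T' : Finset (Finset G) := {A, A⁻¹, 1}
  have hT' : ∀ X ∈ T', X ∈ T ∨ X = 1 := by
    intro X hX; simp [T, T'] at *; tauto
  have key'' : ∀ X ∈ T', ∀ Y ∈ T', ∀ Z ∈ T', ((X * Y * Z).card : ℝ) ≤ (k : ℝ) ^ 3 * A.card := by
    intro X hX Y hY Z hZ
    rcases hT' X hX with hX | rfl <;> rcases hT' Y hY with hY | rfl <;>
      rcases hT' Z hZ with hZ | rfl <;> (try simp only [one_mul, mul_one])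
    · exact key' X hX Y hY Z hZ
    · exact key2 X hX Y hY
    · exact key2 X hX Z hZ
    · exact key1 X hX
    · exact key2 Y hY Z hZ
    · exact key1 Y hY
    · exact key1 Z hZ
    · exact key0
  have hAD : (A.card : ℝ) ≤ D.card := by
    exact_mod_cast Finset.card_le_card (by rw [hD, Finset.union_assoc]; exact subset_union_left)
  have hDT : ∀ x ∈ D, ∃ X ∈ T', x ∈ X := by
    intro x hx
    simp only [hD, Finset.mem_union] at hx
    rcases hx with (h | h) | h
    · exact ⟨A, by simp [T'], h⟩
    · exact ⟨A⁻¹, by simp [T'], h⟩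
    · exact ⟨1, by simp [T'], h⟩
  have hT'c : T'.card ≤ 3 := Finset.card_le_three
  have hcov : D ^ 3 ⊆ (T' ×ˢ T' ×ˢ T').biUnion (fun p => p.1 * p.2.1 * p.2.2) := by
    intro x hx
    rw [pow_succ, pow_two] at hx
    obtain ⟨y, hy, z, hz, rfl⟩ := Finset.mem_mul.1 hx
    obtain ⟨a, ha, b, hb, rfl⟩ := Finset.mem_mul.1 hy
    obtain ⟨X, hX, hxX⟩ := hDT _ ha
    obtain ⟨Y, hY, hxY⟩ := hDT _ hb
    obtain ⟨Z, hZ, hxZ⟩ := hDT _ hz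
    rw [Finset.mem_biUnion]
    exact ⟨(X, Y, Z), by simp [hX, hY, hZ], Finset.mul_mem_mul (Finset.mul_mem_mul hxX hxY) hxZ⟩
  have hD3 : ((D ^ 3).card : ℝ) ≤ (27 * (k : ℝ) ^ 3) * D.card := by
    calc ((D ^ 3).card : ℝ) ≤ ((T' ×ˢ T' ×ˢ T').biUnion (fun p => p.1 * p.2.1 * p.2.2)).card := by
          exact_mod_cast Finset.card_le_card hcov
      _ ≤ ∑ p ∈ T' ×ˢ T' ×ˢ T', ((p.1 * p.2.1 * p.2.2).card : ℝ) := by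
          exact_mod_cast Finset.card_biUnion_le
      _ ≤ ∑ p ∈ T' ×ˢ T' ×ˢ T', (k : ℝ) ^ 3 * A.card := by
          apply Finset.sum_le_sum
          intro p hp
          simp only [Finset.mem_product] at hp
          exact key'' _ hp.1 _ hp.2.1 _ hp.2.2
      _ = ((T'.card * (T'.card * T'.card) : ℕ) : ℝ) * ((k : ℝ) ^ 3 * A.card) := by
          rw [Finset.sum_const, Finset.card_product, Finset.card_product, nsmul_eq_mul]
      _ ≤ ((3 * (3 * 3) : ℕ) : ℝ) * ((k : ℝ) ^ 3 * D.card) := by gcongr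
      _ = _ := by push_cast; ring
  have hK1 : (1 : ℝ) ≤ 27 * (k : ℝ) ^ 3 := by nlinarith [one_le_pow₀ hk1 (n := 3)]
  refine ⟨h1, hs, ?_⟩
  intro j
  rcases lt_or_ge j 3 with hj | hj
  · interval_cases j
    · simpa using Finset.card_pos.2 ⟨1, h1⟩
    · simpa using by nlinarith [(Nat.cast_nonneg D.card : (0:ℝ) ≤ D.card)]
    · calc ((D ^ 2).card : ℝ) ≤ (D ^ 3).card := by
            exact_mod_cast Finset.card_le_card (pow_sub h1 (by norm_num))
        _ ≤ _ := hD3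
        _ ≤ _ := by gcongr; exact le_self_pow₀ hK1 (by norm_num)
  · refine (Finset.small_pow_of_small_tripling hj hD3 hs).trans ?_
    gcongr
    omega

lemma sanders (κ κ' : ℝ) (n : ℕ) (hκ' : 1 ≤ κ') :
    ∃ c : ℝ, 0 < c ∧ ∀ (G : Type) [Group G] [DecidableEq G] (P R : Finset G), P.Nonempty →
      R.Nonempty → ((P * R).card : ℝ) ≤ κ * R.card → ((P * P⁻¹).card : ℝ) ≤ κ' * P.card →
      ∃ X : Finset G, (1 : G) ∈ X ∧ X⁻¹ = X ∧ c * P.card ≤ X.card ∧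
        X ^ n ⊆ P * R * (P * R)⁻¹ := by
  classical
  let t : ℕ → ℝ := fun i => Nat.rec 1 (fun _ x => x ^ 2 / (2 * κ')) i
  have t0 : t 0 = 1 := rfl
  have ts : ∀ i, t (i + 1) = t i ^ 2 / (2 * κ') := fun i => rfl
  have htb : ∀ i, 0 < t i ∧ t i ≤ 1 := by
    intro i
    induction i with
    | zero => simp [t0]
    | succ i ih =>
      rw [ts]
      refine ⟨by have := ih.1; positivity, ?_⟩
      rw [div_le_one (by linarith)]
      nlinarith [ih.1, ih.2]
  have hts : ∀ i, t (i + 1) ≤ t i := by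
    intro i
    rw [ts, div_le_iff₀ (by linarith)]
    nlinarith [(htb i).1, (htb i).2]
  have hanti : Antitone t := antitone_nat_of_succ_le hts
  set ε : ℝ := 1 / (n + 1) with hε
  have hεpos : 0 < ε := by positivity
  have hε1 : ε ≤ 1 := by
    rw [hε, div_le_one (by positivity)]; linarith [(Nat.cast_nonneg n : (0:ℝ) ≤ n)]
  have hnε : n * ε < 1 := by
    rw [hε, mul_one_div, div_lt_one (by positivity)]; linarith
  obtain ⟨I, hI⟩ : ∃ I : ℕ, (1 - ε) ^ I * κ < 1 := by
    have := (tendsto_pow_atTop_nhds_zero_of_lt_one (r := 1 - ε) (by linarith)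
      (by linarith)).mul_const κ
    rw [zero_mul] at this
    exact ((this.eventually (gt_mem_nhds one_pos))).exists
  refine ⟨t I ^ 2 / 2, by have := (htb I).1; positivity, ?_⟩
  intro G _ _ P R hP hR hPR hPP
  have hRpos : (0 : ℝ) < R.card := by exact_mod_cast hR.card_pos
  have hPpos : (0 : ℝ) < P.card := by exact_mod_cast hP.card_pos
  have hmin : ∀ i, ∃ B ∈ P.powerset.filter (fun B => t i * P.card ≤ (B.card : ℝ)),
      ∀ B' ∈ P.powerset.filter (fun B => t i * P.card ≤ (B.card : ℝ)),
        (B * R).card ≤ (B' * R).card := by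
    intro i
    apply Finset.exists_min_image
    refine ⟨P, ?_⟩
    simp only [Finset.mem_filter, Finset.mem_powerset, Finset.Subset.refl, true_and]
    nlinarith [(htb i).2]
  choose B hB hBmin using hmin
  simp only [Finset.mem_filter, Finset.mem_powerset] at hB hBmin
  have hBne : ∀ i, (B i).Nonempty := by
    intro i
    rw [← Finset.card_pos]
    have : (0 : ℝ) < (B i).card := lt_of_lt_of_le (mul_pos (htb i).1 hPpos) (hB i).2
    exact_mod_cast this
  obtain ⟨i, hiI, hi⟩ : ∃ i < I, (1 - ε) * ((B i * R).card : ℝ) ≤ (B (i + 1) * R).card := by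
    by_contra! hcon
    have : ∀ i ≤ I, ((B i * R).card : ℝ) ≤ (1 - ε) ^ i * (κ * R.card) := by
      intro i
      induction i with
      | zero =>
        intro _
        rw [pow_zero, one_mul]
        refine le_trans ?_ hPR
        exact_mod_cast Finset.card_le_card (Finset.mul_subset_mul_right (hB 0).1)
      | succ i ih =>
        intro hi
        have h1 := hcon i (by omega)
        have h2 := ih (by omega)
        rw [pow_succ]
        nlinarith
    have h2 := this I le_rfl
    have h3 : (R.card : ℝ) ≤ (B I * R).card := by
      exact_mod_cast Finset.card_le_card_mul_left (hBne I)
    nlinarith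
  set C := B i with hC
  set Y := C * R with hY
  set X := (P * P⁻¹).filter (fun x => t (i + 1) * P.card ≤ ((C ∩ x • C).card : ℝ)) with hX
  have hCP : C ⊆ P := (hB i).1
  have hYne : Y.Nonempty := (hBne i).mul hR
  have hYpos : (0 : ℝ) < Y.card := by exact_mod_cast hYne.card_pos
  have hXY : ∀ x ∈ X, ((x • Y \ Y).card : ℝ) ≤ ε * Y.card := by
    intro x hx
    rw [hX, Finset.mem_filter] at hx
    have h1 := hBmin (i + 1) (C ∩ x • C) ⟨Finset.inter_subset_left.trans hCP, hx.2⟩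
    have h2 : (C ∩ x • C) * R ⊆ x • Y ∩ Y := by
      intro z hz
      obtain ⟨u, hu, v, hv, rfl⟩ := Finset.mem_mul.1 hz
      rw [Finset.mem_inter] at hu ⊢
      refine ⟨?_, Finset.mul_mem_mul hu.1 hv⟩
      obtain ⟨w, hw, rfl⟩ := Finset.mem_smul_finset.1 hu.2
      rw [Finset.mem_smul_finset]
      exact ⟨w * v, Finset.mul_mem_mul hw hv, by simp [mul_assoc]⟩
    have h3 := Finset.card_le_card h2
    have h4 : (x • Y \ Y).card + (x • Y ∩ Y).card = Y.card := by
      rw [Finset.card_sdiff_add_card_inter, Finset.card_smul_finset]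
    have h5 : ((x • Y \ Y).card : ℝ) + (x • Y ∩ Y).card = Y.card := by exact_mod_cast h4
    have h6 : ((B (i + 1) * R).card : ℝ) ≤ (x • Y ∩ Y).card := by exact_mod_cast h1.trans h3
    linarith
  have hXn : ∀ j : ℕ, ∀ g ∈ X ^ j, ((g • Y \ Y).card : ℝ) ≤ j * ε * Y.card := by
    intro j
    induction j with
    | zero =>
      intro g hg
      rw [pow_zero, Finset.mem_one] at hg
      simp [hg]
    | succ j ih =>
      intro g hg
      rw [pow_succ] at hg
      obtain ⟨u, hu, x, hx, rfl⟩ := Finset.mem_mul.1 hg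
      have h1 : (u * x) • Y \ Y ⊆ (u • (x • Y \ Y)) ∪ (u • Y \ Y) := by
        intro z hz
        rw [Finset.mem_sdiff, mul_smul] at hz
        rw [Finset.mem_union, Finset.smul_finset_sdiff, Finset.mem_sdiff, Finset.mem_sdiff]
        tauto
      have h2 := (Finset.card_le_card h1).trans (Finset.card_union_le _ _)
      rw [Finset.card_smul_finset] at h2
      have h3 : (((u * x) • Y \ Y).card : ℝ) ≤ (x • Y \ Y).card + (u • Y \ Y).card := by
        exact_mod_cast h2
      have := ih u hu
      have := hXY x hx
      push_cast
      linarith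
  refine ⟨X, ?_, ?_, ?_, ?_⟩
  · rw [hX, Finset.mem_filter]
    constructor
    · obtain ⟨p, hp⟩ := hP
      exact Finset.mem_mul.2 ⟨p, hp, p⁻¹, Finset.inv_mem_inv hp, by simp⟩
    · rw [one_smul, Finset.inter_self]
      exact le_trans (mul_le_mul_of_nonneg_right (hts i) hPpos.le) (hB i).2
  · have : ∀ x ∈ X, x⁻¹ ∈ X := by
      intro x hx
      rw [hX, Finset.mem_filter] at hx ⊢
      constructor
      · obtain ⟨u, hu, v, hv, rfl⟩ := Finset.mem_mul.1 hx.1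
        rw [Finset.mem_inv'] at hv
        exact Finset.mem_mul.2 ⟨v⁻¹, hv, u⁻¹, Finset.inv_mem_inv hu, by simp⟩
      · have : (C ∩ x⁻¹ • C).card = (C ∩ x • C).card := by
          rw [← Finset.card_smul_finset x (C ∩ x⁻¹ • C), Finset.smul_finset_inter, smul_inv_smul,
            Finset.inter_comm]
        rw [this]
        exact hx.2
    ext x
    rw [Finset.mem_inv']
    exact ⟨fun h => by simpa using this _ h, fun h => this _ h⟩
  · -- counting
    have h1 : C.card * C.card = ∑ x ∈ P * P⁻¹, ((C ×ˢ C).filter (fun p => p.1 * p.2⁻¹ = x)).card := by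
      rw [← Finset.card_product]
      apply Finset.card_eq_sum_card_fiberwise
      intro p hp
      simp only [Finset.coe_product, Set.mem_prod, Finset.mem_coe] at hp
      exact Finset.mem_coe.2 (Finset.mul_mem_mul (hCP hp.1) (Finset.inv_mem_inv (hCP hp.2)))
    have h2 : ∀ x, ((C ×ˢ C).filter (fun p => p.1 * p.2⁻¹ = x)).card ≤ (C ∩ x • C).card := by
      intro x
      apply Finset.card_le_card_of_injOn Prod.fst
      · intro p hp
        simp only [Finset.coe_filter, Finset.mem_product, Set.mem_ofPred_eq] at hp
        rw [Finset.mem_coe, Finset.mem_inter, Finset.mem_smul_finset]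
        exact ⟨hp.1.1, p.2, hp.1.2, by rw [← hp.2]; simp⟩
      · intro p hp q hq hpq
        simp only [Finset.coe_filter, Finset.mem_product, Set.mem_ofPred_eq] at hp hq
        have : p.2 = q.2 := by
          have := hp.2.trans hq.2.symm
          rw [hpq] at this
          simpa using this
        exact Prod.ext hpq this
    have h3 : ((C.card : ℝ)) * C.card ≤ ∑ x ∈ P * P⁻¹, ((C ∩ x • C).card : ℝ) := by
      have := h1.le.trans (Finset.sum_le_sum (fun x _ => h2 x))
      exact_mod_cast this
    have h4 : ∑ x ∈ P * P⁻¹, ((C ∩ x • C).card : ℝ) ≤ X.card * C.card +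
        (κ' * P.card) * (t (i + 1) * P.card) := by
      rw [← Finset.sum_filter_add_sum_filter_not (P * P⁻¹)
        (fun x => t (i + 1) * P.card ≤ ((C ∩ x • C).card : ℝ))]
      apply add_le_add
      · rw [← hX, ← nsmul_eq_mul]
        apply Finset.sum_le_card_nsmul
        intro x _
        exact_mod_cast Finset.card_le_card Finset.inter_subset_left
      · calc _ ≤ ((P * P⁻¹).filter (fun x => ¬ t (i + 1) * P.card ≤
              ((C ∩ x • C).card : ℝ))).card • (t (i + 1) * P.card : ℝ) := by
              apply Finset.sum_le_card_nsmul
              intro x hx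
              rw [Finset.mem_filter] at hx
              linarith [hx.2]
          _ ≤ _ := by
              rw [nsmul_eq_mul]
              apply mul_le_mul_of_nonneg_right _ (mul_pos (htb (i + 1)).1 hPpos).le
              refine le_trans ?_ hPP
              exact_mod_cast Finset.card_le_card (Finset.filter_subset _ _)
    have h5 : (κ' * P.card) * (t (i + 1) * P.card) = t i ^ 2 / 2 * (P.card : ℝ) ^ 2 := by
      rw [ts]; field_simp
    have h6 : t i * P.card ≤ (C.card : ℝ) := (hB i).2
    have h7 : (C.card : ℝ) ≤ P.card := by exact_mod_cast Finset.card_le_card hCP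
    have h8 : t I ≤ t i := hanti hiI.le
    have hCpos : (0 : ℝ) < C.card := by exact_mod_cast (hBne i).card_pos
    have hti := (htb i).1
    have htI := (htb I).1
    have h9 : t I ^ 2 ≤ t i ^ 2 := by gcongr
    have h10 : (t i * P.card) ^ 2 ≤ (C.card : ℝ) ^ 2 := by gcongr
    have h11 : t i ^ 2 / 2 * (P.card : ℝ) ^ 2 ≤ X.card * P.card := by
      have : (X.card : ℝ) * C.card ≤ X.card * P.card := by gcongr
      nlinarith
    have h12 : t i ^ 2 / 2 * (P.card : ℝ) ≤ X.card := by
      have : (t i ^ 2 / 2 * (P.card : ℝ)) * P.card ≤ X.card * P.card := by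
        calc _ = t i ^ 2 / 2 * (P.card : ℝ) ^ 2 := by ring
          _ ≤ _ := h11
      exact le_of_mul_le_mul_right this hPpos
    refine le_trans ?_ h12
    gcongr
  · intro g hg
    have h1 := hXn n g hg
    have h2 : ((g • Y \ Y).card : ℝ) < Y.card := by nlinarith
    have h3 : ¬ Disjoint (g • Y) Y := by
      intro hd
      rw [Finset.sdiff_eq_self_of_disjoint hd, Finset.card_smul_finset] at h2
      exact lt_irrefl _ h2
    obtain ⟨z, hz1, hz2⟩ := Finset.not_disjoint_iff.1 h3
    obtain ⟨y, hy, rfl⟩ := Finset.mem_smul_finset.1 hz1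
    have hYs : Y ⊆ P * R := Finset.mul_subset_mul_right hCP
    exact Finset.mem_mul.2 ⟨_, hYs hz2, y⁻¹, Finset.inv_mem_inv (hYs hy), by simp⟩

lemma AG.K1 {G : Type} [Group G] [DecidableEq G] {K : ℝ} {D : Finset G} (h : AG K D) : 1 ≤ K := by
  have h1 := h.card 1
  have : (0 : ℝ) < D.card := by exact_mod_cast Finset.card_pos.2 ⟨1, h.one_mem⟩
  rw [pow_one, pow_one] at h1
  by_contra! hc
  nlinarith

lemma AG.pos {G : Type} [Group G] [DecidableEq G] {K : ℝ} {D : Finset G} (h : AG K D) :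
    (0 : ℝ) < D.card := by exact_mod_cast Finset.card_pos.2 ⟨1, h.one_mem⟩

lemma AG.card_sub {G : Type} [Group G] [DecidableEq G] {K : ℝ} {D : Finset G} (h : AG K D)
    {X : Finset G} {j : ℕ} (hX : X ⊆ D ^ j) : (X.card : ℝ) ≤ K ^ j * D.card :=
  le_trans (by exact_mod_cast Finset.card_le_card hX) (h.card j)

lemma mul_sub_pow {G : Type} [Group G] [DecidableEq G] {D X Y : Finset G} {i j l : ℕ}
    (hX : X ⊆ D ^ i) (hY : Y ⊆ D ^ j) (hl : i + j = l) : X * Y ⊆ D ^ l := by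
  rw [← hl, pow_add]; exact Finset.mul_subset_mul hX hY

lemma inter1 {G : Type} [Group G] [DecidableEq G] (T Y : Finset G) :
    ∃ T' ⊆ T, T'⁻¹ * T' ⊆ Y⁻¹ * Y ∧ T.card * Y.card ≤ (T * Y⁻¹).card * T'.card := by
  rcases (T * Y⁻¹).eq_empty_or_nonempty with h0 | hne
  · refine ⟨∅, by simp, by simp, ?_⟩
    rw [Finset.mul_eq_empty, Finset.inv_eq_empty] at h0
    rcases h0 with h | h <;> simp [h]
  obtain ⟨c, hc, hmax⟩ := Finset.exists_max_image (T * Y⁻¹)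
    (fun c => (T.filter (fun t => c⁻¹ * t ∈ Y)).card) hne
  refine ⟨T.filter (fun t => c⁻¹ * t ∈ Y), Finset.filter_subset _ _, ?_, ?_⟩
  · intro x hx
    obtain ⟨u, hu, v, hv, rfl⟩ := Finset.mem_mul.1 hx
    rw [Finset.mem_inv', Finset.mem_filter] at hu
    rw [Finset.mem_filter] at hv
    exact Finset.mem_mul.2 ⟨(c⁻¹ * u⁻¹)⁻¹, Finset.inv_mem_inv hu.2, _, hv.2, by group⟩
  · have h1 : T.card * Y.card = ∑ x ∈ T * Y⁻¹, ((T ×ˢ Y).filter (fun p => p.1 * p.2⁻¹ = x)).card := by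
      rw [← Finset.card_product]
      apply Finset.card_eq_sum_card_fiberwise
      intro p hp
      simp only [Finset.coe_product, Set.mem_prod, Finset.mem_coe] at hp
      exact Finset.mem_coe.2 (Finset.mul_mem_mul hp.1 (Finset.inv_mem_inv hp.2))
    have h2 : ∀ x, ((T ×ˢ Y).filter (fun p => p.1 * p.2⁻¹ = x)).card ≤
        (T.filter (fun t => x⁻¹ * t ∈ Y)).card := by
      intro x
      apply Finset.card_le_card_of_injOn Prod.fst
      · intro p hp
        simp only [Finset.coe_filter, Finset.mem_product, Set.mem_ofPred_eq] at hp
        rw [Finset.mem_coe, Finset.mem_filter]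
        refine ⟨hp.1.1, ?_⟩
        rw [← hp.2]; simpa using hp.1.2
      · intro p hp q hq hpq
        simp only [Finset.coe_filter, Finset.mem_product, Set.mem_ofPred_eq] at hp hq
        have : p.2 = q.2 := by
          have := hp.2.trans hq.2.symm
          rw [hpq] at this
          simpa using this
        exact Prod.ext hpq this
    rw [h1, ← smul_eq_mul]
    apply Finset.sum_le_card_nsmul
    intro x hx
    exact (h2 x).trans (hmax x hx)

lemma interF {G : Type} [Group G] [DecidableEq G] {K : ℝ} {D : Finset G} (hD : AG K D)
    {ι : Type} [DecidableEq ι] (I : Finset ι) (Y : ι → Finset G) (J : ℕ) (hJ : 1 ≤ J) (c : ℝ)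
    (hc : 0 < c)
    (hY : ∀ i ∈ I, Y i ⊆ D ^ J ∧ c * D.card ≤ ((Y i).card : ℝ)) :
    ∃ T ⊆ D ^ J, (c / K ^ (J + J)) ^ I.card * D.card ≤ (T.card : ℝ) ∧
      ∀ i ∈ I, T⁻¹ * T ⊆ (Y i)⁻¹ * Y i := by
  have hK := hD.K1
  induction I using Finset.induction_on with
  | empty =>
    refine ⟨D ^ J, Finset.Subset.refl _, ?_, by simp⟩
    simp only [Finset.card_empty, pow_zero, one_mul]
    have := Finset.card_le_card (pow_sub hD.one_mem hJ)
    rw [pow_one] at this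
    exact_mod_cast this
  | insert a I ha ih =>
    obtain ⟨T, hT, hTc, hTI⟩ := ih (fun i hi => hY i (Finset.mem_insert_of_mem hi))
    obtain ⟨T', hT', hT'Y, hcard⟩ := inter1 T (Y a)
    have hYa := hY a (Finset.mem_insert_self _ _)
    refine ⟨T', hT'.trans hT, ?_, ?_⟩
    · rw [Finset.card_insert_of_notMem ha, pow_succ]
      have hYinv : (Y a)⁻¹ ⊆ D ^ J := by
        rw [← inv_pow_symm hD.symm J]; exact Finset.inv_subset_inv hYa.1
      have h1 : ((T * (Y a)⁻¹).card : ℝ) ≤ K ^ (J + J) * D.card :=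
        hD.card_sub (mul_sub_pow hT hYinv rfl)
      have h2 : (T.card : ℝ) * (Y a).card ≤ (T * (Y a)⁻¹).card * T'.card := by exact_mod_cast hcard
      have h3 : (T.card : ℝ) * (c * D.card) ≤ K ^ (J + J) * D.card * T'.card := by
        calc _ ≤ (T.card : ℝ) * (Y a).card := by gcongr; exact hYa.2
          _ ≤ _ := h2
          _ ≤ _ := by gcongr
      have h4 : (T.card : ℝ) * c ≤ K ^ (J + J) * T'.card := by
        have := hD.pos
        have h5 : ((T.card : ℝ) * c) * D.card ≤ (K ^ (J + J) * T'.card) * D.card := by linarith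
        exact le_of_mul_le_mul_right h5 this
      have hKp : 0 < K ^ (J + J) := by positivity
      calc (c / K ^ (J + J)) ^ I.card * (c / K ^ (J + J)) * D.card
          = ((c / K ^ (J + J)) ^ I.card * D.card) * c / K ^ (J + J) := by ring
        _ ≤ T.card * c / K ^ (J + J) := by gcongr
        _ ≤ _ := by rw [div_le_iff₀ hKp]; linarith
    · intro i hi
      rcases Finset.mem_insert.1 hi with rfl | hi
      · exact hT'Y
      · exact (Finset.mul_subset_mul (Finset.inv_subset_inv hT') hT').trans (hTI i hi)

lemma symm_inv_mul {G : Type} [Group G] [DecidableEq G] (T : Finset G) :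
    (T⁻¹ * T)⁻¹ = T⁻¹ * T := by
  rw [mul_inv_rev, inv_inv]

lemma conjL (K c : ℝ) (hK : 1 ≤ K) (hc : 0 < c) :
    ∃ c' : ℝ, 0 < c' ∧ ∀ (G : Type) [Group G] [DecidableEq G] (D S : Finset G), AG K D →
      (1 : G) ∈ S → S⁻¹ = S → S ⊆ D ^ 4 → c * D.card ≤ (S.card : ℝ) →
      ∃ S' : Finset G, (1 : G) ∈ S' ∧ S'⁻¹ = S' ∧ c' * D.card ≤ (S'.card : ℝ) ∧
        ∀ y ∈ D ^ 16, ∀ s ∈ S', y⁻¹ * s * y ∈ S ^ 6 := by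
  set b : ℝ := min (c / K ^ (20 + 20)) 1 with hb
  have hbpos : 0 < b := by rw [hb]; positivity
  refine ⟨b ^ ⌈K ^ 20 / c⌉₊, by positivity, ?_⟩
  intro G _ _ D S hD h1 hs hS hcard
  have hSne : S.Nonempty := ⟨1, h1⟩
  have hSpos : (0 : ℝ) < S.card := by exact_mod_cast hSne.card_pos
  obtain ⟨F, hF, hFc, hFcov⟩ := Finset.ruzsa_covering_mul (A := D ^ 16) (K := K ^ 20 / c) hSne (by
    calc _ ≤ K ^ 20 * D.card := hD.card_sub (mul_sub_pow (Finset.Subset.refl _) hS rfl)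
      _ = K ^ 20 / c * (c * D.card) := by field_simp
      _ ≤ _ := by gcongr)
  obtain ⟨T, hT, hTc, hTF⟩ := interF hD F (fun f => S * {f⁻¹}) 20 (by norm_num) c hc (by
    intro f hf
    constructor
    · have : ({f⁻¹} : Finset G) ⊆ D ^ 16 := by
        rw [Finset.singleton_subset_iff, ← inv_pow_symm hD.symm 16]
        exact Finset.inv_mem_inv (hF hf)
      exact mul_sub_pow hS this rfl
    · rw [Finset.mul_singleton, Finset.card_smul_finset]
      exact hcard)
  have hTne : T.Nonempty := by
    rw [← Finset.card_pos]
    have h0 : 0 < (c / K ^ (20 + 20)) ^ F.card * (D.card : ℝ) := by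
      have := hD.pos
      positivity
    exact_mod_cast h0.trans_le hTc
  refine ⟨T⁻¹ * T, ?_, symm_inv_mul T, ?_, ?_⟩
  · obtain ⟨t, ht⟩ := hTne
    exact Finset.mem_mul.2 ⟨t⁻¹, Finset.inv_mem_inv ht, t, ht, by simp⟩
  · have h2 : (T.card : ℝ) ≤ (T⁻¹ * T).card := by
      exact_mod_cast Finset.card_le_card_mul_left hTne.inv
    refine le_trans (le_trans ?_ hTc) h2
    gcongr
    calc b ^ ⌈K ^ 20 / c⌉₊ ≤ b ^ F.card := by
          apply pow_le_pow_of_le_one hbpos.le (min_le_right _ _)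
          exact_mod_cast hFc.trans (Nat.le_ceil _)
      _ ≤ _ := by gcongr; exact min_le_left _ _
  · intro y hy s hsT
    obtain ⟨f, hf, p, hp, rfl⟩ := Finset.mem_mul.1 (hFcov hy)
    have h3 := hTF f hf hsT
    obtain ⟨u, hu, v, hv, rfl⟩ := Finset.mem_mul.1 h3
    rw [Finset.mem_inv'] at hu
    obtain ⟨u', hu', z, hz, hu⟩ := Finset.mem_mul.1 hu
    obtain ⟨v', hv', z', hz', rfl⟩ := Finset.mem_mul.1 hv
    rw [Finset.mem_singleton] at hz hz'
    subst hz hz'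
    have hu2 : u = f * u'⁻¹ := by rw [← inv_inv u, ← hu]; group
    obtain ⟨a, ha, b', hb', rfl⟩ := Finset.mem_div.1 hp
    have hinv : ∀ x ∈ S, x⁻¹ ∈ S := fun x hx => by rw [← hs]; exact Finset.inv_mem_inv hx
    have : (f * (a / b'))⁻¹ * (u * (v' * f⁻¹)) * (f * (a / b')) =
        b' * a⁻¹ * u'⁻¹ * v' * a * b'⁻¹ := by rw [hu2, div_eq_mul_inv]; group
    rw [this]
    have e6 : S ^ 6 = S * S * S * S * S * S := by simp [pow_succ]
    rw [e6]
    exact Finset.mul_mem_mul (Finset.mul_mem_mul (Finset.mul_mem_mul (Finset.mul_mem_mul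
      (Finset.mul_mem_mul hb' (hinv _ ha)) (hinv _ hu')) hv') ha) (hinv _ hb')

/-- conjugation closure -/
def cl {G : Type} [Group G] [DecidableEq G] (D S : Finset G) : Finset G :=
  ((D ^ 16) ×ˢ S).image (fun p => p.1⁻¹ * p.2 * p.1)

lemma mem_cl {G : Type} [Group G] [DecidableEq G] {D S : Finset G} {y s : G} (hy : y ∈ D ^ 16)
    (hs : s ∈ S) : y⁻¹ * s * y ∈ cl D S := by
  rw [cl, Finset.mem_image]
  exact ⟨(y, s), by simp [hy, hs], rfl⟩

lemma sub_cl {G : Type} [Group G] [DecidableEq G] {D S : Finset G} (h : (1 : G) ∈ D) :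
    S ⊆ cl D S := by
  intro s hs
  have := mem_cl (D := D) (y := 1) (Finset.one_mem_pow h) hs
  simpa using this

lemma cl_symm {G : Type} [Group G] [DecidableEq G] {D S : Finset G} (h : S⁻¹ = S) :
    (cl D S)⁻¹ = cl D S := by
  have : ∀ x ∈ cl D S, x⁻¹ ∈ cl D S := by
    intro x hx
    rw [cl, Finset.mem_image] at hx
    obtain ⟨p, hp, rfl⟩ := hx
    rw [Finset.mem_product] at hp
    have : (p.1⁻¹ * p.2 * p.1)⁻¹ = p.1⁻¹ * p.2⁻¹ * p.1 := by group
    rw [this]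
    apply mem_cl hp.1
    rw [← h]; exact Finset.inv_mem_inv hp.2
  ext x
  rw [Finset.mem_inv']
  exact ⟨fun h => by simpa using this _ h, fun h => this _ h⟩

lemma NB (K c : ℝ) (n : ℕ) (hK : 1 ≤ K) (hc : 0 < c) (hn : 4 ≤ n) :
    ∃ c' : ℝ, 0 < c' ∧ ∀ (G : Type) [Group G] [DecidableEq G] (D S : Finset G), AG K D →
      Nb D c S → ∃ S' : Finset G, Nb D c' S' ∧ (cl D S') ^ n ⊆ S ^ 4 := by
  obtain ⟨c1, hc1, H1⟩ := sanders (K ^ 4 / c) (max (K ^ 4 / c) 1) (6 * n) (le_max_right _ _)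
  obtain ⟨c2, hc2, H2⟩ := conjL K (c1 * c) hK (by positivity)
  refine ⟨c2, hc2, ?_⟩
  intro G _ _ D S hD hS
  have hSne : S.Nonempty := ⟨1, hS.one_mem⟩
  have hSS : ((S * S).card : ℝ) ≤ K ^ 4 / c * S.card := by
    calc _ ≤ K ^ 4 * D.card := hD.card_sub (by
            rw [← pow_two]; exact (pow_sub hS.one_mem (by norm_num)).trans hS.sub)
      _ = K ^ 4 / c * (c * D.card) := by field_simp
      _ ≤ _ := by gcongr; exact hS.card
  obtain ⟨X, hX1, hXs, hXc, hXn⟩ := H1 G S S hSne hSne hSS (by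
    rw [hS.symm]
    refine hSS.trans ?_
    gcongr
    exact le_max_left _ _)
  have e4 : S * S * (S * S)⁻¹ = S ^ 4 := by
    rw [mul_inv_rev, hS.symm]; simp [pow_succ, mul_assoc]
  rw [e4] at hXn
  have hXD : X ⊆ D ^ 4 := by
    refine Finset.Subset.trans ?_ (hXn.trans hS.sub)
    conv_lhs => rw [← pow_one X]
    exact pow_sub hX1 (by omega)
  obtain ⟨S', h1, hs, hcd, hcj⟩ := H2 G D X hD hX1 hXs hXD (by
    refine le_trans ?_ hXc
    rw [mul_assoc]; gcongr; exact hS.card)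
  have hclX : cl D S' ⊆ X ^ 6 := by
    intro x hx
    rw [cl, Finset.mem_image] at hx
    obtain ⟨p, hp, rfl⟩ := hx
    rw [Finset.mem_product] at hp
    exact hcj _ hp.1 _ hp.2
  have hmain : (cl D S') ^ n ⊆ S ^ 4 := by
    refine Finset.Subset.trans ?_ hXn
    rw [pow_mul]
    exact Finset.pow_subset_pow_left hclX
  refine ⟨S', ⟨h1, hs, ?_, hcd⟩, hmain⟩
  refine Finset.Subset.trans ?_ (hmain.trans hS.sub)
  exact (Finset.pow_subset_pow_left (sub_cl hD.one_mem)).trans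
    (pow_sub (sub_cl hD.one_mem h1) hn)

lemma initial (k : ℕ) (hk : 0 < k) :
    ∃ c : ℝ, 0 < c ∧ ∀ (G : Type) [Group G] [DecidableEq G] (A : Finset G), A.Nonempty →
      (A ^ 3).card ≤ k * A.card →
      ∃ S : Finset G, Nb (A ∪ A⁻¹ ∪ 1) c S ∧
        S ^ 4 ⊆ (A * A⁻¹) ^ 2 ∩ (A ^ 2 * A⁻¹ ^ 2) ∩ (A⁻¹ * A) ^ 2 ∩ (A⁻¹ ^ 2 * A ^ 2) := by
  set K : ℝ := 27 * (k : ℝ) ^ 3 with hK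
  have hk1 : (1 : ℝ) ≤ k := by exact_mod_cast hk
  have hK1 : (1 : ℝ) ≤ K := by nlinarith [one_le_pow₀ hk1 (n := 3)]
  obtain ⟨c1, hc1, H1⟩ := sanders (3 * K ^ 2) (3 * K ^ 2) 8 (by nlinarith)
  refine ⟨((c1 / 3) / K ^ (4 + 4)) ^ 4, by positivity, ?_⟩
  intro G _ _ A hA h3
  have hD := growth k hk A hA h3
  rw [← hK] at hD
  set D := A ∪ A⁻¹ ∪ 1 with hDdef
  have hAD : A ⊆ D := by rw [hDdef, Finset.union_assoc]; exact subset_union_left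
  have hA'D : A⁻¹ ⊆ D := by
    rw [hDdef]; exact Finset.subset_union_right.trans Finset.subset_union_left
  have hDA : (D.card : ℝ) ≤ 3 * A.card := by
    have h1 : D.card ≤ A.card + A⁻¹.card + 1 := by
      rw [hDdef]
      refine (Finset.card_union_le _ _).trans ?_
      have := Finset.card_union_le A A⁻¹
      simp only [Finset.card_one]
      omega
    rw [Finset.card_inv] at h1
    have h2 := hA.card_pos
    have h4 : D.card ≤ 3 * A.card := by omega
    exact_mod_cast h4
  let Q : Fin 4 → Finset G × Finset G := ![(A, A⁻¹), (A, A), (A⁻¹, A), (A⁻¹, A⁻¹)]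
  have hQ : ∀ i, ((Q i).1 ⊆ D ∧ (Q i).1.card = A.card) ∧ ((Q i).2 ⊆ D ∧ (Q i).2.card = A.card) := by
    intro i
    fin_cases i <;> simp [Q, hAD, hA'D]
  have hsm : ∀ X Y : Finset G, X ⊆ D → Y ⊆ D → ((X * Y).card : ℝ) ≤ 3 * K ^ 2 * A.card := by
    intro X Y hX hY
    have : X * Y ⊆ D ^ 2 := by rw [pow_two]; exact Finset.mul_subset_mul hX hY
    calc _ ≤ K ^ 2 * D.card := hD.card_sub this
      _ ≤ K ^ 2 * (3 * A.card) := by gcongr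
      _ = _ := by ring
  have hne : ∀ X : Finset G, X.card = A.card → X.Nonempty := by
    intro X hX; rw [← Finset.card_pos, hX]; exact hA.card_pos
  have hex : ∀ i, ∃ X : Finset G, (1 : G) ∈ X ∧ X⁻¹ = X ∧ c1 * A.card ≤ (X.card : ℝ) ∧
      X ^ 8 ⊆ (Q i).1 * (Q i).2 * ((Q i).1 * (Q i).2)⁻¹ := by
    intro i
    obtain ⟨⟨h1, h2⟩, h4, h5⟩ := hQ i
    have h1' : (Q i).1⁻¹ ⊆ D := by rw [← hD.symm]; exact Finset.inv_subset_inv h1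
    have := H1 G (Q i).1 (Q i).2 (hne _ h2) (hne _ h5) (by rw [h5]; exact hsm _ _ h1 h4)
      (by rw [h2]; exact hsm _ _ h1 h1')
    rw [h2] at this
    exact this
  choose X hX1 hXs hXc hX8 using hex
  have hXD : ∀ i, X i ⊆ D ^ 4 := by
    intro i
    have h5 : X i ⊆ X i ^ 8 := by
      conv_lhs => rw [← pow_one (X i)]
      exact pow_sub (hX1 i) (by norm_num)
    refine h5.trans ((hX8 i).trans ?_)
    obtain ⟨⟨h1, -⟩, h4, -⟩ := hQ i
    have h6 : (Q i).1 * (Q i).2 ⊆ D ^ 2 := by rw [pow_two]; exact Finset.mul_subset_mul h1 h4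
    have h7 : ((Q i).1 * (Q i).2)⁻¹ ⊆ D ^ 2 := by
      rw [← inv_pow_symm hD.symm 2]; exact Finset.inv_subset_inv h6
    exact mul_sub_pow h6 h7 rfl
  obtain ⟨T, hT, hTc, hTX⟩ := interF hD Finset.univ X 4 (by norm_num) (c1 / 3) (by positivity) (by
    intro i _
    refine ⟨hXD i, ?_⟩
    calc c1 / 3 * D.card ≤ c1 / 3 * (3 * A.card) := by gcongr
      _ = c1 * A.card := by ring
      _ ≤ _ := hXc i)
  rw [Finset.card_fin] at hTc
  have hTne : T.Nonempty := by
    rw [← Finset.card_pos]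
    have h0 : 0 < (c1 / 3 / K ^ (4 + 4)) ^ 4 * (D.card : ℝ) := by
      have := hD.pos
      positivity
    exact_mod_cast h0.trans_le hTc
  have hT4 : ∀ i, (T⁻¹ * T) ^ 4 ⊆ (Q i).1 * (Q i).2 * ((Q i).1 * (Q i).2)⁻¹ := by
    intro i
    refine Finset.Subset.trans ?_ (hX8 i)
    have : X i ^ 8 = ((X i)⁻¹ * X i) ^ 4 := by rw [hXs i, ← pow_two, ← pow_mul]
    rw [this]
    exact Finset.pow_subset_pow_left (hTX i (Finset.mem_univ _))
  have hZ : (T⁻¹ * T) ^ 4 ⊆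
      (A * A⁻¹) ^ 2 ∩ (A ^ 2 * A⁻¹ ^ 2) ∩ (A⁻¹ * A) ^ 2 ∩ (A⁻¹ ^ 2 * A ^ 2) := by
    have h0 := hT4 0
    have h1 := hT4 1
    have h2 := hT4 2
    have h3 := hT4 3
    simp only [Q, Matrix.cons_val, mul_inv_rev, inv_inv] at h0 h1 h2 h3
    have e0 : (A * A⁻¹) ^ 2 = A * A⁻¹ * (A * A⁻¹) := pow_two _
    have e1 : A ^ 2 * A⁻¹ ^ 2 = A * A * (A⁻¹ * A⁻¹) := by rw [pow_two, pow_two]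
    have e2 : (A⁻¹ * A) ^ 2 = A⁻¹ * A * (A⁻¹ * A) := pow_two _
    have e3 : A⁻¹ ^ 2 * A ^ 2 = A⁻¹ * A⁻¹ * (A * A) := by rw [pow_two, pow_two]
    rw [e0, e1, e2, e3]
    exact Finset.subset_inter (Finset.subset_inter (Finset.subset_inter h0 h1) h2) h3
  refine ⟨T⁻¹ * T, ⟨?_, symm_inv_mul T, ?_, ?_⟩, hZ⟩
  · obtain ⟨t, ht⟩ := hTne
    exact Finset.mem_mul.2 ⟨t⁻¹, Finset.inv_mem_inv ht, t, ht, by simp⟩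
  · refine (hT4 0).trans ?_
    obtain ⟨⟨h1, -⟩, h4, -⟩ := hQ 0
    have h6 : (Q 0).1 * (Q 0).2 ⊆ D ^ 2 := by rw [pow_two]; exact Finset.mul_subset_mul h1 h4
    have h7 : ((Q 0).1 * (Q 0).2)⁻¹ ⊆ D ^ 2 := by
      rw [← inv_pow_symm hD.symm 2]; exact Finset.inv_subset_inv h6
    exact mul_sub_pow h6 h7 rfl
  · refine hTc.trans ?_
    exact_mod_cast Finset.card_le_card_mul_left hTne.inv

section hilbert

variable {E : Type} [NormedAddCommGroup E] [InnerProductSpace ℝ E]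

lemma logconv (T : E →ₗ[ℝ] E) (hs : ∀ u v : E, inner ℝ (T u) v = inner ℝ u (T v)) (v : E) (j : ℕ) :
    ‖T v‖ ^ (2 ^ j) ≤ ‖(T ^ (2 ^ j)) v‖ * ‖v‖ ^ (2 ^ j - 1) := by
  have hs' : ∀ k : ℕ, ∀ u v : E, inner ℝ ((T ^ k) u) v = inner ℝ u ((T ^ k) v) := by
    intro k
    induction k with
    | zero => intro u v; simp
    | succ k ih =>
      intro u v
      rw [pow_succ, Module.End.mul_apply, ih, hs, ← Module.End.mul_apply, ← pow_succ', pow_succ]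
  have key : ∀ k : ℕ, ‖(T ^ k) v‖ ^ 2 ≤ ‖(T ^ (k * 2)) v‖ * ‖v‖ := by
    intro k
    rw [← real_inner_self_eq_norm_sq, hs' k, ← Module.End.mul_apply, ← pow_add, real_inner_comm,
      ← mul_two]
    exact real_inner_le_norm _ _
  induction j with
  | zero => simp
  | succ j ih =>
    have h1 : 1 ≤ 2 ^ j := Nat.one_le_two_pow
    have e : 2 ^ (j + 1) - 1 = (2 ^ j - 1) * 2 + 1 := by rw [pow_succ]; omega
    rw [e, pow_succ 2 j, pow_mul]
    calc (‖T v‖ ^ 2 ^ j) ^ 2 ≤ (‖(T ^ (2 ^ j)) v‖ * ‖v‖ ^ (2 ^ j - 1)) ^ 2 := by gcongr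
      _ = ‖(T ^ (2 ^ j)) v‖ ^ 2 * ‖v‖ ^ ((2 ^ j - 1) * 2) := by rw [mul_pow, pow_mul]
      _ ≤ (‖(T ^ (2 ^ j * 2)) v‖ * ‖v‖) * ‖v‖ ^ ((2 ^ j - 1) * 2) := by gcongr; exact key _
      _ = _ := by rw [pow_succ]; ring

variable {G : Type} [Group G]

lemma pow_contr (T : E →ₗ[ℝ] E) (hT : ∀ v, ‖T v‖ ≤ ‖v‖) (s : ℕ) (v : E) : ‖(T ^ s) v‖ ≤ ‖v‖ := by
  induction s with
  | zero => simp
  | succ s ih => rw [pow_succ', Module.End.mul_apply]; exact (hT _).trans ih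

lemma hilb1 (ρ : G →* (E →ₗ[ℝ] E)) (T : E →ₗ[ℝ] E)
    (hT : ∀ v, ‖T v‖ ≤ ‖v‖) (r : ℕ) (hr : 0 < r) (ε κ : ℝ) (hε : 0 ≤ ε) (hε1 : ε ≤ 1) (hκ : 0 ≤ κ)
    (g : G) (hg : g ^ r = 1)
    (h1 : ∀ i ≤ r, ∀ v, ‖T (ρ (g ^ i) v) - ρ (g ^ i) (T v)‖ ≤ κ * ‖v‖)
    (h2 : ∀ i ≤ r, ∀ v, ‖T (ρ (g ^ i) v - v)‖ ≤ ε * ‖v‖) (f : E) (s : ℕ) :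
    ‖(T ^ s) (ρ g f - f)‖ ≤ (ε ^ s + s ^ 2 * κ) * ‖ρ g f - f‖ := by
  set u := ρ g f - f with hu
  have hr' : (0 : ℝ) < r := by exact_mod_cast hr
  let Eg : E → E := fun v => (1 / (r : ℝ)) • ∑ i ∈ Finset.range r, (v - ρ (g ^ i) v)
  have avg : ∀ (F : ℕ → E) (b : ℝ), (∀ i ∈ Finset.range r, ‖F i‖ ≤ b) →
      ‖(1 / (r : ℝ)) • ∑ i ∈ Finset.range r, F i‖ ≤ b := by
    intro F b hF
    rw [norm_smul, Real.norm_of_nonneg (by positivity)]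
    have := norm_sum_le_of_le _ hF
    rw [Finset.sum_const, Finset.card_range, nsmul_eq_mul] at this
    rw [one_div, inv_mul_le_iff₀ hr']
    exact this
  have hEu : Eg u = u := by
    have : ∑ i ∈ Finset.range r, ρ (g ^ i) u = 0 := by
      have h3 : ∀ i ∈ Finset.range r, ρ (g ^ i) u = ρ (g ^ (i + 1)) f - ρ (g ^ i) f := by
        intro i _
        rw [hu, map_sub, ← Module.End.mul_apply, ← map_mul, ← pow_succ]
      rw [Finset.sum_congr rfl h3, Finset.sum_range_sub (fun i => ρ (g ^ i) f), hg]
      simp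
    simp only [Eg]
    rw [Finset.sum_sub_distrib, this, sub_zero, Finset.sum_const, Finset.card_range,
      ← Nat.cast_smul_eq_nsmul ℝ, smul_smul, one_div, inv_mul_cancel₀ hr'.ne', one_smul]
  have hTE : ∀ x, ‖T (Eg x)‖ ≤ ε * ‖x‖ := by
    intro x
    simp only [Eg, map_smul, map_sum]
    apply avg
    intro i hi
    rw [← norm_neg, ← map_neg, neg_sub]
    exact h2 i (Finset.mem_range.1 hi).le x
  have hcomm : ∀ x, ‖T (Eg x) - Eg (T x)‖ ≤ κ * ‖x‖ := by
    intro x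
    simp only [Eg, map_smul, map_sum]
    rw [← smul_sub, ← Finset.sum_sub_distrib]
    apply avg
    intro i hi
    rw [map_sub, ← norm_neg]
    have : -(T x - T (ρ (g ^ i) x) - (T x - ρ (g ^ i) (T x))) =
      T (ρ (g ^ i) x) - ρ (g ^ i) (T x) := by abel
    rw [this]
    exact h1 i (Finset.mem_range.1 hi).le x
  have hsub : ∀ x y, Eg (x - y) = Eg x - Eg y := by
    intro x y
    simp only [Eg]
    rw [← smul_sub, ← Finset.sum_sub_distrib]
    congr 1
    apply Finset.sum_congr rfl
    intro i _
    rw [map_sub]; abel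
  have he : ∀ s : ℕ, ‖(T ^ s) u - Eg ((T ^ s) u)‖ ≤ s * κ * ‖u‖ := by
    intro s
    induction s with
    | zero => simp [hEu]
    | succ s ih =>
      rw [pow_succ', Module.End.mul_apply]
      set x := (T ^ s) u
      have e : T x - Eg (T x) = T (x - Eg x) + (T (Eg x) - Eg (T x)) := by rw [map_sub]; abel
      rw [e]
      have hx : ‖x‖ ≤ ‖u‖ := pow_contr T hT s u
      calc _ ≤ ‖T (x - Eg x)‖ + ‖T (Eg x) - Eg (T x)‖ := norm_add_le _ _
        _ ≤ s * κ * ‖u‖ + κ * ‖u‖ := by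
          apply add_le_add ((hT _).trans ih) ((hcomm x).trans _)
          gcongr
        _ = _ := by push_cast; ring
  induction s with
  | zero => simp
  | succ s ih =>
    rw [pow_succ' T, Module.End.mul_apply]
    set x := (T ^ s) u with hx
    have e : T x = T (Eg x) + T (x - Eg x) := by rw [map_sub]; abel
    rw [e]
    have h5 : ‖T (x - Eg x)‖ ≤ s * κ * ‖u‖ := (hT _).trans (he s)
    have h6 : ε * (s ^ 2 * κ) ≤ s ^ 2 * κ := mul_le_of_le_one_left (by positivity) hε1
    calc _ ≤ ‖T (Eg x)‖ + ‖T (x - Eg x)‖ := norm_add_le _ _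
      _ ≤ ε * ‖x‖ + s * κ * ‖u‖ := add_le_add (hTE x) h5
      _ ≤ ε * ((ε ^ s + s ^ 2 * κ) * ‖u‖) + s * κ * ‖u‖ := by gcongr
      _ = (ε ^ (s + 1) + ε * (s ^ 2 * κ) + s * κ) * ‖u‖ := by ring
      _ ≤ _ := by
        apply mul_le_mul_of_nonneg_right _ (norm_nonneg _)
        push_cast
        nlinarith [mul_nonneg (Nat.cast_nonneg s : (0:ℝ) ≤ s) hκ, h6, hκ]

lemma hilb2 [DecidableEq G] (ρ : G →* (E →ₗ[ℝ] E)) (hρ : ∀ g v, ‖ρ g v‖ = ‖v‖) (T : E →ₗ[ℝ] E)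
    (hT : ∀ v, ‖T v‖ ≤ ‖v‖) (r : ℕ) (hr : 0 < r) (ε κ : ℝ) (hε : 0 ≤ ε) (hε1 : ε ≤ 1) (hκ : 0 ≤ κ)
    (X : Finset G) (hX : ∀ g ∈ X, g ^ r = 1)
    (h1 : ∀ g ∈ X, ∀ i ≤ r, ∀ v, ‖T (ρ (g ^ i) v) - ρ (g ^ i) (T v)‖ ≤ κ * ‖v‖)
    (h2 : ∀ g ∈ X, ∀ i ≤ r, ∀ v, ‖T (ρ (g ^ i) v - v)‖ ≤ ε * ‖v‖) (f : E) (s : ℕ) (L : ℕ) (h : G)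
    (hh : h ∈ X ^ L) :
    ‖(T ^ s) (ρ h f - f)‖ ≤ L * (2 * (ε ^ s + s ^ 2 * κ) + 2 * s * κ) * ‖f‖ := by
  have hd : ∀ g : G, ‖ρ g f - f‖ ≤ 2 * ‖f‖ := by
    intro g
    calc _ ≤ ‖ρ g f‖ + ‖f‖ := norm_sub_le _ _
      _ = _ := by rw [hρ]; ring
  have hc : ∀ g ∈ X, ∀ s : ℕ, ∀ v, ‖(T ^ s) (ρ g v) - ρ g ((T ^ s) v)‖ ≤ s * κ * ‖v‖ := by
    intro g hg s
    induction s with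
    | zero => intro v; simp
    | succ s ih =>
      intro v
      rw [pow_succ', Module.End.mul_apply, Module.End.mul_apply]
      have e : T ((T ^ s) (ρ g v)) - ρ g (T ((T ^ s) v)) =
        T ((T ^ s) (ρ g v) - ρ g ((T ^ s) v)) +
          (T (ρ g ((T ^ s) v)) - ρ g (T ((T ^ s) v))) := by rw [map_sub]; abel
      rw [e]
      have h3 := h1 g hg 1 hr ((T ^ s) v)
      rw [pow_one] at h3
      have h4 := pow_contr T hT s v
      calc _ ≤ _ := norm_add_le _ _
        _ ≤ s * κ * ‖v‖ + κ * ‖(T ^ s) v‖ := add_le_add ((hT _).trans (ih v)) h3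
        _ ≤ s * κ * ‖v‖ + κ * ‖v‖ := by gcongr
        _ = _ := by push_cast; ring
  induction L generalizing h with
  | zero =>
    rw [pow_zero, Finset.mem_one] at hh
    simp [hh]
  | succ L ih =>
    rw [pow_succ'] at hh
    obtain ⟨g, hg, h', hh', rfl⟩ := Finset.mem_mul.1 hh
    have e : ρ (g * h') f - f = ρ g (ρ h' f - f) + (ρ g f - f) := by
      rw [map_mul, Module.End.mul_apply, map_sub]; abel
    rw [e, map_add]
    set v := ρ h' f - f with hv
    have h3 : ‖(T ^ s) (ρ g v)‖ ≤ s * κ * ‖v‖ + ‖(T ^ s) v‖ := by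
      calc ‖(T ^ s) (ρ g v)‖ = ‖((T ^ s) (ρ g v) - ρ g ((T ^ s) v)) + ρ g ((T ^ s) v)‖ := by
            rw [sub_add_cancel]
        _ ≤ _ := norm_add_le _ _
        _ ≤ _ := by rw [hρ]; gcongr; exact hc g hg s v
    have h4 := ih h' hh'
    have h5 := hilb1 ρ T hT r hr ε κ hε hε1 hκ g (hX g hg) (h1 g hg) (h2 g hg) f s
    calc _ ≤ _ := norm_add_le _ _
      _ ≤ (s * κ * (2 * ‖f‖) + L * (2 * (ε ^ s + s ^ 2 * κ) + 2 * s * κ) * ‖f‖) +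
          (ε ^ s + s ^ 2 * κ) * (2 * ‖f‖) := by
        apply add_le_add
        · refine h3.trans (add_le_add ?_ h4)
          gcongr
          exact hd h'
        · refine h5.trans ?_
          gcongr
          exact hd g
      _ = _ := by push_cast; ring

lemma hilb3 [DecidableEq G] (ρ : G →* (E →ₗ[ℝ] E)) (hρ : ∀ g v, ‖ρ g v‖ = ‖v‖) (T : E →ₗ[ℝ] E)
    (hs : ∀ u v : E, inner ℝ (T u) v = inner ℝ u (T v))
    (hT : ∀ v, ‖T v‖ ≤ ‖v‖) (r : ℕ) (hr : 0 < r) (ε κ β : ℝ) (hε : 0 ≤ ε) (hε1 : ε ≤ 1) (hκ : 0 ≤ κ)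
    (hβ : 0 < β)
    (X : Finset G) (hX : ∀ g ∈ X, g ^ r = 1)
    (h1 : ∀ g ∈ X, ∀ i ≤ r, ∀ v, ‖T (ρ (g ^ i) v) - ρ (g ^ i) (T v)‖ ≤ κ * ‖v‖)
    (h2 : ∀ g ∈ X, ∀ i ≤ r, ∀ v, ‖T (ρ (g ^ i) v - v)‖ ≤ ε * ‖v‖) (f : E) (hf : f ≠ 0) (j : ℕ)
    (L : ℕ)
    (hnum : L * (2 * (ε ^ (2 ^ j) + ((2 ^ j : ℕ) : ℝ) ^ 2 * κ) + 2 * ((2 ^ j : ℕ) : ℝ) * κ) *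
      2 ^ (2 ^ j - 1) < β ^ (2 ^ j)) (h : G)
    (hh : h ∈ X ^ L) :
    ‖T (ρ h f - f)‖ < β * ‖f‖ := by
  have a1 := hilb2 ρ hρ T hT r hr ε κ hε hε1 hκ X hX h1 h2 f (2 ^ j) L h hh
  have a2 := logconv T hs (ρ h f - f) j
  set s := 2 ^ j with hsdef
  have hs1 : 1 ≤ s := Nat.one_le_two_pow
  set v := ρ h f - f with hv
  have hd : ‖v‖ ≤ 2 * ‖f‖ := by
    calc _ ≤ ‖ρ h f‖ + ‖f‖ := norm_sub_le _ _
      _ = _ := by rw [hρ]; ring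
  have hfpos : 0 < ‖f‖ := norm_pos_iff.2 hf
  apply lt_of_pow_lt_pow_left₀ s (by positivity)
  set q : ℝ := L * (2 * (ε ^ s + (s : ℝ) ^ 2 * κ) + 2 * (s : ℝ) * κ) with hq
  have hq0 : 0 ≤ q := by positivity
  have e2 : ‖f‖ ^ s = ‖f‖ * ‖f‖ ^ (s - 1) := by
    rw [← pow_succ']; congr 1; omega
  calc ‖T v‖ ^ s ≤ ‖(T ^ s) v‖ * ‖v‖ ^ (s - 1) := a2
    _ ≤ (q * ‖f‖) * (2 * ‖f‖) ^ (s - 1) := by gcongr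
    _ = q * 2 ^ (s - 1) * ‖f‖ ^ s := by rw [mul_pow, e2]; ring
    _ < β ^ s * ‖f‖ ^ s := by gcongr
    _ = _ := by rw [mul_pow]

end hilbert


section cutoff

set_option linter.unusedSectionVars false

variable {G : Type} [Group G] [DecidableEq G]

/-- cutoff function of a chain of sets -/
noncomputable def cut (X : ℕ → Finset G) (n : ℕ) (x : G) : ℝ :=
  (1 / (n : ℝ)) * ∑ i ∈ Finset.range n, if x ∈ X i then (1 : ℝ) else 0

lemma cut_nonneg (X : ℕ → Finset G) (n : ℕ) (x : G) : 0 ≤ cut X n x := by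
  unfold cut
  refine mul_nonneg (by positivity) (Finset.sum_nonneg ?_)
  intro i _; split_ifs <;> norm_num

lemma cut_le (X : ℕ → Finset G) (n : ℕ) (x : G) : cut X n x ≤ 1 := by
  unfold cut
  have : ∑ i ∈ Finset.range n, (if x ∈ X i then (1 : ℝ) else 0) ≤ ∑ i ∈ Finset.range n, (1 : ℝ) := by
    apply Finset.sum_le_sum
    intro i _; split_ifs <;> norm_num
  rw [Finset.sum_const, Finset.card_range, nsmul_eq_mul, mul_one] at this
  rcases Nat.eq_zero_or_pos n with rfl | hn
  · simp
  · have hn' : (0 : ℝ) < n := by exact_mod_cast hn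
    rw [one_div, inv_mul_le_iff₀ hn', mul_one]
    exact this

lemma cut_one (X : ℕ → Finset G) (n : ℕ) (hn : 0 < n) (hX : ∀ i, X i ⊆ X (i + 1)) (x : G)
    (hx : x ∈ X 0) : cut X n x = 1 := by
  unfold cut
  have hm : ∀ i, x ∈ X i := by
    intro i
    induction i with
    | zero => exact hx
    | succ i ih => exact hX i ih
  have hn' : (0 : ℝ) < n := by exact_mod_cast hn
  simp [hm, hn'.ne']

lemma cut_zero (X : ℕ → Finset G) (n : ℕ) (Y : Finset G) (hY : ∀ i < n, X i ⊆ Y)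
    (x : G) (hx : x ∉ Y) : cut X n x = 0 := by
  unfold cut
  rw [Finset.sum_eq_zero, mul_zero]
  intro i hi
  rw [if_neg]
  exact fun h => hx (hY i (Finset.mem_range.1 hi) h)

lemma cut_lip1 (X : ℕ → Finset G) (n : ℕ) (x y : G) (h : ∀ i, x ∈ X i → y ∈ X (i + 1)) :
    cut X n x - cut X n y ≤ 1 / n := by
  unfold cut
  rw [← mul_sub, ← Finset.sum_sub_distrib]
  have key : ∀ n : ℕ, ∑ i ∈ Finset.range n, ((if x ∈ X i then (1 : ℝ) else 0) -
      (if y ∈ X i then (1 : ℝ) else 0)) ≤ 1 := by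
    intro n
    have h1 : ∑ i ∈ Finset.range n, ((if x ∈ X i then (1 : ℝ) else 0) -
      (if y ∈ X (i + 1) then (1 : ℝ) else 0)) ≤ 0 := by
      apply Finset.sum_nonpos
      intro i _
      have := h i
      split_ifs <;> simp_all
    have h2 : ∑ i ∈ Finset.range n, ((if y ∈ X (i + 1) then (1 : ℝ) else 0) -
      (if y ∈ X i then (1 : ℝ) else 0)) ≤ 1 := by
      rw [Finset.sum_range_sub (fun i => if y ∈ X i then (1 : ℝ) else 0)]
      split_ifs <;> norm_num
    have h3 := add_le_add h1 h2
    rw [← Finset.sum_add_distrib] at h3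
    simpa using h3
  have := key n
  calc _ ≤ (1 / (n : ℝ)) * 1 := by gcongr
    _ = _ := mul_one _

lemma cut_lip (X : ℕ → Finset G) (n : ℕ) (x y : G) (h : ∀ i, x ∈ X i → y ∈ X (i + 1))
    (h' : ∀ i, y ∈ X i → x ∈ X (i + 1)) :
    |cut X n x - cut X n y| ≤ 1 / n := by
  rw [abs_sub_le_iff]
  exact ⟨cut_lip1 X n x y h, cut_lip1 X n y x h'⟩

lemma path (S Q : Finset G) (B : Finset G) (h1 : (1 : G) ∈ S) (hS : S⁻¹ = S) (hQ1 : (1 : G) ∈ Q)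
    (hQ : Q⁻¹ = Q) (hQS : Q ⊆ S ^ 4) (M : ℕ) (hB : Q ^ M * S ⊆ B) (L : ℕ)
    (hL : ∀ t : ℕ, t * S.card ≤ B.card → t ≤ L) :
    Q ^ M ⊆ (S ^ 6 ∩ Q ^ M) ^ L := by
  have hseq : ∀ M : ℕ, ∀ h ∈ Q ^ M, ∃ p : ℕ → G, p 0 = 1 ∧ p M = h ∧
      ∀ i, (p i)⁻¹ * p (i + 1) ∈ Q := by
    intro M
    induction M with
    | zero =>
      intro h hh
      rw [pow_zero, Finset.mem_one] at hh
      exact ⟨fun _ => 1, rfl, hh.symm, fun i => by simpa using hQ1⟩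
    | succ M ih =>
      intro h hh
      rw [pow_succ] at hh
      obtain ⟨h', hh', q, hq, rfl⟩ := Finset.mem_mul.1 hh
      obtain ⟨p, hp0, hpM, hp⟩ := ih h' hh'
      refine ⟨fun i => if i ≤ M then p i else h' * q, by simp [hp0], by simp, ?_⟩
      intro i
      rcases lt_trichotomy i M with hi | hi | hi
      · simpa [hi.le, Nat.succ_le_of_lt hi] using hp i
      · subst hi; simp [hpM, hq]
      · have h1 : ¬ i ≤ M := by omega
        have h2 : ¬ i + 1 ≤ M := by omega
        simp [h1, h2, hQ1]
  intro h hh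
  obtain ⟨p, hp0, hpM, hp⟩ := hseq M h hh
  have hpq : ∀ i d : ℕ, (p i)⁻¹ * p (i + d) ∈ Q ^ d := by
    intro i d
    induction d with
    | zero => simp
    | succ d ih =>
      rw [pow_succ]
      have : (p i)⁻¹ * p (i + (d + 1)) = ((p i)⁻¹ * p (i + d)) * ((p (i + d))⁻¹ * p (i + d + 1)) := by
        rw [← add_assoc]; group
      rw [this]
      exact Finset.mul_mem_mul ih (hp _)
  have hpij : ∀ i j : ℕ, i ≤ j → j ≤ M → (p i)⁻¹ * p j ∈ Q ^ M := by
    intro i j hij hj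
    obtain ⟨d, rfl⟩ := Nat.exists_eq_add_of_le hij
    exact pow_sub hQ1 (by omega) (hpq i d)
  have hE1 : (1 : G) ∈ S ^ 6 ∩ Q ^ M :=
    Finset.mem_inter.2 ⟨Finset.one_mem_pow h1, Finset.one_mem_pow hQ1⟩
  set E := S ^ 6 ∩ Q ^ M with hE
  let T : ℕ → Finset G := fun i => {p i} * S
  have hS2 : ∀ i j, ¬ Disjoint (T i) (T j) → (p i)⁻¹ * p j ∈ S ^ 2 := by
    intro i j hd
    rw [Finset.not_disjoint_iff] at hd
    obtain ⟨x, hx, hx'⟩ := hd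
    simp only [T, Finset.singleton_mul, Finset.mem_smul_finset] at hx hx'
    obtain ⟨s, hs, rfl⟩ := hx
    obtain ⟨s', hs', he⟩ := hx'
    simp only [smul_eq_mul] at he
    have : (p i)⁻¹ * p j = s * s'⁻¹ := by
      rw [inv_mul_eq_iff_eq_mul, ← mul_assoc, ← he]; group
    rw [this, pow_two]
    refine Finset.mul_mem_mul hs ?_
    rw [← hS]; exact Finset.inv_mem_inv hs'
  have main : ∀ d i : ℕ, i ≤ M → M - i ≤ d → ∃ F : Finset ℕ, (∀ j ∈ F, i ≤ j ∧ j ≤ M) ∧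
      ((F : Set ℕ).PairwiseDisjoint T) ∧ (p i)⁻¹ * p M ∈ E ^ F.card := by
    intro d
    induction d with
    | zero =>
      intro i hi hd
      have : i = M := by omega
      subst this
      exact ⟨∅, by simp, by simp, by simp⟩
    | succ d ih =>
      intro i hi hd
      have hne : ((Finset.Icc i M).filter (fun j => ¬ Disjoint (T i) (T j))).Nonempty := by
        refine ⟨i, ?_⟩
        simp only [Finset.mem_filter, Finset.mem_Icc, le_refl, hi, true_and]
        rw [Finset.disjoint_self_iff_empty]
        exact Finset.nonempty_iff_ne_empty.1
          ⟨p i * 1, Finset.mul_mem_mul (Finset.mem_singleton_self _) h1⟩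
      obtain ⟨j, hj, hjmax⟩ := Finset.exists_max_image _ id hne
      simp only [Finset.mem_filter, Finset.mem_Icc, id] at hj hjmax
      have hsj := hS2 i j hj.2
      rcases Nat.lt_or_ge j M with hjM | hjM
      · obtain ⟨F, hF1, hF2, hF3⟩ := ih (j + 1) hjM (by omega)
        have hiF : i ∉ F := fun hc => by have := (hF1 i hc).1; omega
        refine ⟨insert i F, ?_, ?_, ?_⟩
        · intro l hl
          rcases Finset.mem_insert.1 hl with rfl | hl
          · exact ⟨le_rfl, hi⟩
          · have := hF1 l hl; omega
        · rw [Finset.coe_insert]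
          refine hF2.insert ?_
          intro l hl _
          by_contra hc
          have h3 := hF1 l hl
          have := hjmax l ⟨⟨by omega, h3.2⟩, hc⟩
          omega
        · rw [Finset.card_insert_of_notMem hiF, pow_succ']
          have : (p i)⁻¹ * p M = ((p i)⁻¹ * p (j + 1)) * ((p (j + 1))⁻¹ * p M) := by group
          rw [this]
          refine Finset.mul_mem_mul (Finset.mem_inter.2 ⟨?_, hpij _ _ (by omega) hjM⟩) hF3
          have : (p i)⁻¹ * p (j + 1) = ((p i)⁻¹ * p j) * ((p j)⁻¹ * p (j + 1)) := by group
          rw [this, show 6 = 2 + 4 from rfl, pow_add]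
          exact Finset.mul_mem_mul hsj (hQS (hp j))
      · have : j = M := by omega
        subst this
        refine ⟨{i}, by simpa using hi, by simp, ?_⟩
        rw [Finset.card_singleton, pow_one]
        exact Finset.mem_inter.2 ⟨pow_sub h1 (by norm_num) hsj, hpij _ _ hi le_rfl⟩
  obtain ⟨F, hF1, hF2, hF3⟩ := main M 0 (Nat.zero_le _) (by omega)
  rw [hp0, hpM, inv_one, one_mul] at hF3
  refine pow_sub hE1 (hL _ ?_) hF3
  have hc : (F.biUnion T).card = F.card * S.card := by
    rw [Finset.card_biUnion hF2]
    rw [Finset.sum_congr rfl (fun j _ => Finset.card_singleton_mul (p j) S), Finset.sum_const, smul_eq_mul]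
  rw [← hc]
  apply Finset.card_le_card
  intro x hx
  obtain ⟨j, hj, hx⟩ := Finset.mem_biUnion.1 hx
  refine hB (Finset.mul_subset_mul_right ?_ hx)
  rw [Finset.singleton_subset_iff]
  have := hpij 0 j (Nat.zero_le _) (hF1 j hj).2
  rwa [hp0, inv_one, one_mul] at this

end cutoff

section gleason

variable {G : Type} [Group G] [DecidableEq G]

lemma cl_one {D S : Finset G} (h : (1 : G) ∈ D) (hS : (1 : G) ∈ S) : (1 : G) ∈ cl D S :=
  sub_cl h hS

lemma conj_pow_mem {D S : Finset G} {y g : G} (hy : y ∈ D ^ 16) (hg : g ∈ S) (i : ℕ) :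
    y⁻¹ * g ^ i * y ∈ cl D S ^ i := by
  have : y⁻¹ * g ^ i * y = (y⁻¹ * g * y) ^ i := by
    have := conj_pow (i := i) (a := y⁻¹) (b := g)
    rw [inv_inv] at this
    exact this.symm
  rw [this]
  exact Finset.pow_mem_pow (mem_cl hy hg)

lemma inv_mem_symm {S : Finset G} (h : S⁻¹ = S) {x : G} (hx : x ∈ S) : x⁻¹ ∈ S := by
  rw [← h]; exact Finset.inv_mem_inv hx

lemma gleason {D Q S : Finset G} {K c : ℝ} (hD : AG K D) (hS : Nb D c S) (hc : 0 < c)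
    (hQ1 : (1 : G) ∈ Q) (hQ : Q⁻¹ = Q) (n1 r N P : ℕ) (hn1 : 0 < n1) (hr : 0 < r) (hN : 0 < N)
    (hV : (cl D Q) ^ (r * n1) ⊆ S ^ 4) (hQN : Q ^ N ⊆ D ^ 4) (hexp : ∀ g ∈ Q, g ^ r = 1)
    (hnum : P * K ^ 8 < N * n1 * c) : Q ^ P ⊆ D ^ 12 := by
  have hSD : S ⊆ D ^ 4 := by
    have := (pow_sub hS.one_mem (show 1 ≤ 4 by norm_num)).trans hS.sub
    rwa [pow_one] at this
  set V := (cl D Q) ^ r with hVdef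
  have hV1 : (1 : G) ∈ V := Finset.one_mem_pow (cl_one hD.one_mem hQ1)
  have hVs : V⁻¹ = V := inv_pow_symm (cl_symm hQ) r
  rw [pow_mul, ← hVdef] at hV
  set φ := cut (fun i => Q ^ i * S) N with hφ
  set ψ := cut (fun i => V ^ i * S) n1 with hψ
  set Y := Q ^ N * S with hY
  have hYD : Y ⊆ D ^ 8 := mul_sub_pow hQN hSD rfl
  have hφ0 : ∀ x, x ∉ Q ^ (N - 1) * S → φ x = 0 := by
    apply cut_zero
    intro i hi
    exact Finset.mul_subset_mul_right (pow_sub hQ1 (by omega))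
  have hψ0 : ∀ x, x ∉ V ^ n1 * S → ψ x = 0 := by
    apply cut_zero
    intro i hi
    exact Finset.mul_subset_mul_right (pow_sub hV1 (by omega))
  have hφ0' : ∀ g ∈ Q, ∀ x, φ (g⁻¹ * x) ≠ 0 → x ∈ Y := by
    intro g hg x hx
    by_contra hc
    apply hx
    apply hφ0
    intro hm
    apply hc
    obtain ⟨a, ha, b, hb, he⟩ := Finset.mem_mul.1 hm
    have : x = (g * a) * b := by rw [mul_assoc, he]; group
    rw [this]
    refine Finset.mul_mem_mul ?_ hb
    have e : N = (N - 1) + 1 := by omega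
    rw [e, pow_succ']
    exact Finset.mul_mem_mul hg ha
  have hφlip : ∀ g ∈ Q, ∀ x, |φ (g⁻¹ * x) - φ x| ≤ 1 / N := by
    intro g hg x
    apply cut_lip
    · intro i hi
      rw [pow_succ', mul_assoc]
      have : x = g * (g⁻¹ * x) := by group
      rw [this]
      exact Finset.mul_mem_mul hg hi
    · intro i hi
      rw [pow_succ', mul_assoc]
      exact Finset.mul_mem_mul (inv_mem_symm hQ hg) hi
  have hψlip : ∀ g ∈ V, ∀ x, |ψ x - ψ (g * x)| ≤ 1 / n1 := by
    intro g hg x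
    apply cut_lip
    · intro i hi
      rw [pow_succ', mul_assoc]
      exact Finset.mul_mem_mul hg hi
    · intro i hi
      rw [pow_succ', mul_assoc]
      have : x = g⁻¹ * (g * x) := by group
      rw [this]
      exact Finset.mul_mem_mul (inv_mem_symm hVs hg) hi
  let F : G → ℝ := fun x => ∑ᶠ y, φ y * ψ (y⁻¹ * x)
  have hFg : ∀ g ∈ Q, ∀ x, F (g⁻¹ * x) = ∑ y ∈ Y, φ (g⁻¹ * y) * ψ (y⁻¹ * x) := by
    intro g hg x
    have e : F (g⁻¹ * x) = ∑ᶠ y, φ (g⁻¹ * y) * ψ (y⁻¹ * x) := by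
      rw [← finsum_comp_equiv (Equiv.mulLeft g)]
      apply finsum_congr
      intro y
      simp [mul_assoc]
    rw [e]
    apply finsum_eq_sum_of_support_subset
    intro y hy
    rw [Function.mem_support] at hy
    exact hφ0' g hg y (left_ne_zero_of_mul hy)
  have hF1 : ∀ x, F x = ∑ y ∈ Y, φ y * ψ (y⁻¹ * x) := by
    intro x
    have := hFg 1 hQ1 x
    simpa using this
  set b : ℝ := Y.card * (1 / N * (1 / n1)) with hb
  have hr' : (0 : ℝ) < r := by exact_mod_cast hr
  have hN' : (0 : ℝ) < N := by exact_mod_cast hN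
  have hn1' : (0 : ℝ) < n1 := by exact_mod_cast hn1
  have hdF : ∀ g ∈ Q, ∀ x, |F (g⁻¹ * x) - F x| ≤ b := by
    intro g hg x
    let dF : G → ℝ := fun x => F (g⁻¹ * x) - F x
    have hdF1 : ∀ x, dF x = ∑ y ∈ Y, (φ (g⁻¹ * y) - φ y) * ψ (y⁻¹ * x) := by
      intro x
      simp only [dF]
      rw [hFg g hg, hF1, ← Finset.sum_sub_distrib]
      exact Finset.sum_congr rfl (fun y _ => by ring)
    have h1 : ∀ i ∈ Finset.range r, |dF x - dF ((g⁻¹) ^ i * x)| ≤ b := by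
      intro i hi
      rw [hdF1, hdF1, ← Finset.sum_sub_distrib]
      refine (Finset.abs_sum_le_sum_abs _ _).trans ?_
      rw [hb, ← nsmul_eq_mul]
      apply Finset.sum_le_card_nsmul
      intro y hy
      rw [← mul_sub, abs_mul]
      refine mul_le_mul (hφlip g hg y) ?_ (abs_nonneg _) (by positivity)
      have : y⁻¹ * ((g⁻¹) ^ i * x) = (y⁻¹ * (g⁻¹) ^ i * y) * (y⁻¹ * x) := by group
      rw [this]
      apply hψlip
      exact pow_sub (cl_one hD.one_mem hQ1) (Finset.mem_range.1 hi).le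
        (conj_pow_mem (pow_sub hD.one_mem (by norm_num) (hYD hy)) (inv_mem_symm hQ hg) i)
    have h2 : ∑ i ∈ Finset.range r, dF ((g⁻¹) ^ i * x) = 0 := by
      have : ∀ i ∈ Finset.range r, dF ((g⁻¹) ^ i * x) =
          F ((g⁻¹) ^ (i + 1) * x) - F ((g⁻¹) ^ i * x) := by
        intro i _
        simp only [dF]
        rw [← mul_assoc, ← pow_succ']
      rw [Finset.sum_congr rfl this, Finset.sum_range_sub (fun i => F ((g⁻¹) ^ i * x)),
        inv_pow, hexp g hg]
      simp
    have h3 : r * dF x = ∑ i ∈ Finset.range r, (dF x - dF ((g⁻¹) ^ i * x)) := by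
      rw [Finset.sum_sub_distrib, h2, Finset.sum_const, Finset.card_range, nsmul_eq_mul, sub_zero]
    have h4 : |r * dF x| ≤ r * b := by
      rw [h3]
      refine (Finset.abs_sum_le_sum_abs _ _).trans ?_
      have := Finset.sum_le_card_nsmul _ _ _ h1
      rwa [Finset.card_range, nsmul_eq_mul] at this
    rw [abs_mul, abs_of_pos hr'] at h4
    exact le_of_mul_le_mul_left h4 hr'
  have hFP : ∀ P : ℕ, ∀ x ∈ Q ^ P, F 1 - P * b ≤ F x := by
    intro P
    induction P with
    | zero => intro x hx; rw [pow_zero, Finset.mem_one] at hx; simp [hx]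
    | succ P ih =>
      intro x hx
      rw [pow_succ'] at hx
      obtain ⟨g, hg, x', hx', rfl⟩ := Finset.mem_mul.1 hx
      have h1 := hdF g⁻¹ (inv_mem_symm hQ hg) x'
      rw [inv_inv, abs_le] at h1
      have := ih x' hx'
      push_cast
      linarith [h1.1]
  have hSY : S ⊆ Y := fun x hx => by
    rw [← one_mul x]; exact Finset.mul_mem_mul (Finset.one_mem_pow hQ1) hx
  have hF0 : (S.card : ℝ) ≤ F 1 := by
    rw [hF1]
    calc (S.card : ℝ) = ∑ y ∈ S, φ y * ψ (y⁻¹ * 1) := by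
          rw [Finset.sum_congr rfl (g := fun _ => (1 : ℝ))]
          · simp
          · intro y hy
            rw [mul_one, hφ, hψ, cut_one _ N hN _ _ (by simpa using hy),
              cut_one _ n1 hn1 _ _ (by simpa using inv_mem_symm hS.symm hy), one_mul]
            · intro i
              exact Finset.mul_subset_mul_right (pow_sub hV1 (by omega))
            · intro i
              exact Finset.mul_subset_mul_right (pow_sub hQ1 (by omega))
      _ ≤ _ := by
          apply Finset.sum_le_sum_of_subset_of_nonneg hSY
          intro y _ _
          exact mul_nonneg (cut_nonneg _ _ _) (cut_nonneg _ _ _)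
  intro x hx
  have hx1 := hFP P x hx
  have hYc := hD.card_sub hYD
  have hDp := hD.pos
  have hpos : 0 < F x := by
    have h1 : P * b ≤ P * (K ^ 8 * D.card * (1 / N * (1 / n1))) := by
      rw [hb]; gcongr
    have h2 : P * (K ^ 8 * D.card * (1 / N * (1 / n1))) < c * D.card := by
      have : P * (K ^ 8 * D.card * (1 / N * (1 / n1))) = (P * K ^ 8) * D.card / (N * n1) := by
        field_simp
      rw [this, div_lt_iff₀ (by positivity)]
      calc _ < (N * n1 * c) * (D.card : ℝ) := mul_lt_mul_of_pos_right hnum hDp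
        _ = _ := by ring
    have := hS.card
    linarith
  rw [hF1] at hpos
  obtain ⟨y, hy, hy2⟩ := Finset.exists_ne_zero_of_sum_ne_zero hpos.ne'
  have h1 : y⁻¹ * x ∈ V ^ n1 * S := by
    by_contra hc
    exact right_ne_zero_of_mul hy2 (hψ0 _ hc)
  have e : x = y * (y⁻¹ * x) := by group
  rw [e]
  have h2 : Y * (V ^ n1 * S) ⊆ D ^ 12 := by
    rw [hY, mul_assoc]
    refine mul_sub_pow hQN ?_ rfl (j := 8)
    calc S * (V ^ n1 * S) ⊆ S ^ 1 * (S ^ 4 * S ^ 1) := by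
          rw [pow_one]; exact Finset.mul_subset_mul_left (Finset.mul_subset_mul_right hV)
      _ = S ^ 6 := by rw [← pow_add, ← pow_add]
      _ ⊆ S ^ 8 := pow_sub hS.one_mem (by norm_num)
      _ = (S ^ 4) ^ 2 := by rw [← pow_mul]
      _ ⊆ (D ^ 4) ^ 2 := Finset.pow_subset_pow_left hS.sub
      _ = D ^ 8 := by rw [← pow_mul]
  exact h2 (Finset.mul_mem_mul hy h1)

end gleason

section ltwo

/-- finitely supported functions with the l2 inner product -/
def L2 (G : Type) : Type := G →₀ ℝ

variable {G : Type}

noncomputable instance : AddCommGroup (L2 G) := inferInstanceAs (AddCommGroup (G →₀ ℝ))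
noncomputable instance : Module ℝ (L2 G) := inferInstanceAs (Module ℝ (G →₀ ℝ))
instance : FunLike (L2 G) G ℝ := inferInstanceAs (FunLike (G →₀ ℝ) G ℝ)

lemma L2.ext {f g : L2 G} (h : ∀ x, f x = g x) : f = g := Finsupp.ext h
lemma L2.add_apply (f g : L2 G) (x : G) : (f + g) x = f x + g x := rfl
lemma L2.sub_apply (f g : L2 G) (x : G) : (f - g) x = f x - g x := rfl
lemma L2.smul_apply (c : ℝ) (f : L2 G) (x : G) : (c • f) x = c * f x := rfl
lemma L2.zero_apply (x : G) : (0 : L2 G) x = 0 := rfl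
lemma L2.finite (f : L2 G) : (Function.support (fun x => f x)).Finite :=
  Finsupp.hasFiniteSupport (f : G →₀ ℝ)
lemma L2.sum_apply {ι : Type} (s : Finset ι) (F : ι → L2 G) (x : G) :
    (∑ i ∈ s, F i) x = ∑ i ∈ s, F i x :=
  Finsupp.finsetSum_apply s F x

noncomputable def L2.ip (f g : L2 G) : ℝ := ∑ᶠ x, f x * g x

lemma L2.fin_mul (f g : L2 G) : (Function.support (fun x => f x * g x)).Finite :=
  (L2.finite f).subset (fun x hx => by
    rw [Function.mem_support] at *; exact left_ne_zero_of_mul hx)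

lemma L2.ip_eq (f g : L2 G) (s : Finset G) (h : ∀ x, x ∉ s → g x = 0) :
    L2.ip f g = ∑ x ∈ s, f x * g x := by
  apply finsum_eq_sum_of_support_subset
  intro x hx
  rw [Function.mem_support] at hx
  by_contra hc
  exact right_ne_zero_of_mul hx (h x hc)

noncomputable def L2.core (G : Type) : InnerProductSpace.Core ℝ (L2 G) where
  inner f g := L2.ip f g
  conj_inner_symm f g := by
    simp only [L2.ip, conj_trivial]
    exact finsum_congr (fun x => mul_comm _ _)
  re_inner_nonneg f := by
    simp only [L2.ip, RCLike.re_to_real]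
    exact finsum_nonneg (fun x => mul_self_nonneg _)
  add_left f g h := by
    simp only [L2.ip]
    rw [← finsum_add_distrib (L2.fin_mul _ _) (L2.fin_mul _ _)]
    exact finsum_congr (fun x => by rw [L2.add_apply]; ring)
  smul_left f g c := by
    simp only [L2.ip, conj_trivial]
    rw [mul_finsum]
    exact finsum_congr (fun x => by rw [L2.smul_apply]; ring)
  definite f hf := by
    have h1 : L2.ip f f = 0 := hf
    have h2 : ∀ x, x ∉ (L2.finite f).toFinset → f x = 0 := by
      intro x hx
      simpa using hx
    rw [L2.ip_eq f f _ h2, Finset.sum_eq_zero_iff_of_nonneg (fun x _ => mul_self_nonneg _)] at h1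
    apply L2.ext
    intro x
    rw [L2.zero_apply]
    by_contra hc
    exact hc (mul_self_eq_zero.1 (h1 x (by simpa using hc)))

noncomputable instance : NormedAddCommGroup (L2 G) :=
  @InnerProductSpace.Core.toNormedAddCommGroup ℝ (L2 G) _ _ _ (L2.core G)
noncomputable instance : InnerProductSpace ℝ (L2 G) := InnerProductSpace.ofCore (L2.core G).toCore

lemma L2.inner_def (f g : L2 G) : inner ℝ f g = L2.ip f g := rfl

lemma L2.norm_sq (f : L2 G) : ‖f‖ ^ 2 = L2.ip f f := by
  rw [← real_inner_self_eq_norm_sq]; rfl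

lemma L2.norm_le (f g : L2 G) (b : ℝ) (hb : 0 ≤ b) (h : ∀ x, |f x| ≤ b * |g x|) :
    ‖f‖ ≤ b * ‖g‖ := by
  apply le_of_sq_le_sq _ (by positivity)
  rw [mul_pow, L2.norm_sq, L2.norm_sq]
  have h2 : ∀ x, x ∉ (L2.finite g).toFinset → g x = 0 := by
    intro x hx
    simpa using hx
  have h1 : ∀ x, x ∉ (L2.finite g).toFinset → f x = 0 := by
    intro x hx
    have := h x
    rw [h2 x hx, abs_zero, mul_zero] at this
    exact abs_eq_zero.1 (le_antisymm this (abs_nonneg _))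
  rw [L2.ip_eq _ _ _ h1, L2.ip_eq _ _ _ h2, Finset.mul_sum]
  apply Finset.sum_le_sum
  intro x _
  have := h x
  calc f x * f x = |f x| ^ 2 := by rw [sq_abs]; ring
    _ ≤ (b * |g x|) ^ 2 := by gcongr
    _ = _ := by rw [mul_pow, sq_abs]; ring

/-- composition with a bijection -/
noncomputable def L2.tr (e : G ≃ G) : L2 G →ₗ[ℝ] L2 G where
  toFun f := Finsupp.equivMapDomain e (f : G →₀ ℝ)
  map_add' _ _ := L2.ext (fun _ => rfl)
  map_smul' _ _ := L2.ext (fun _ => rfl)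

lemma L2.tr_apply (e : G ≃ G) (f : L2 G) (x : G) : L2.tr e f x = f (e.symm x) := rfl

lemma L2.tr_inner (e : G ≃ G) (f g : L2 G) : inner ℝ (L2.tr e f) g = inner ℝ f (L2.tr e.symm g) := by
  rw [L2.inner_def, L2.inner_def, L2.ip, L2.ip, ← finsum_comp_equiv e]
  apply finsum_congr
  intro x
  simp [L2.tr_apply]

lemma L2.tr_norm (e : G ≃ G) (f : L2 G) : ‖L2.tr e f‖ = ‖f‖ := by
  have h : L2.tr e.symm (L2.tr e f) = f := L2.ext (fun x => by simp [L2.tr_apply])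
  have : ‖L2.tr e f‖ ^ 2 = ‖f‖ ^ 2 := by
    rw [← real_inner_self_eq_norm_sq, L2.tr_inner, h, real_inner_self_eq_norm_sq]
  exact (sq_eq_sq₀ (norm_nonneg _) (norm_nonneg _)).1 this

/-- pointwise multiplication -/
noncomputable def L2.mw (w : G → ℝ) : L2 G →ₗ[ℝ] L2 G where
  toFun f := Finsupp.ofSupportFinite (fun x => w x * f x) ((L2.finite f).subset (fun x hx => by
    rw [Function.mem_support] at *; exact right_ne_zero_of_mul hx))
  map_add' f g := L2.ext (fun x => mul_add _ _ _)
  map_smul' c f := L2.ext (fun x => mul_left_comm _ _ _)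

lemma L2.mw_apply (w : G → ℝ) (f : L2 G) (x : G) : L2.mw w f x = w x * f x := rfl

lemma L2.mw_inner (w : G → ℝ) (f g : L2 G) : inner ℝ (L2.mw w f) g = inner ℝ f (L2.mw w g) := by
  rw [L2.inner_def, L2.inner_def, L2.ip, L2.ip]
  apply finsum_congr
  intro x
  rw [L2.mw_apply, L2.mw_apply]; ring

lemma L2.mw_norm (w : G → ℝ) (hw : ∀ x, |w x| ≤ 1) (f : L2 G) : ‖L2.mw w f‖ ≤ ‖f‖ := by
  rw [← one_mul ‖f‖]
  apply L2.norm_le _ _ _ zero_le_one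
  intro x
  rw [L2.mw_apply, abs_mul]
  exact mul_le_mul_of_nonneg_right (hw x) (abs_nonneg _)

variable [Group G]

noncomputable def L2.rho (G : Type) [Group G] : G →* (L2 G →ₗ[ℝ] L2 G) where
  toFun g := L2.tr (Equiv.mulLeft g)
  map_one' := by
    apply LinearMap.ext; intro f; apply L2.ext; intro x
    exact congrArg f (show (1 : G)⁻¹ * x = x by simp)
  map_mul' g h := by
    apply LinearMap.ext; intro f; apply L2.ext; intro x
    exact congrArg f (show (g * h)⁻¹ * x = h⁻¹ * (g⁻¹ * x) by simp [mul_assoc])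

lemma L2.rho_apply (g : G) (f : L2 G) (x : G) : L2.rho G g f x = f (g⁻¹ * x) := rfl
lemma L2.rho_norm (g : G) (f : L2 G) : ‖L2.rho G g f‖ = ‖f‖ := L2.tr_norm _ _

/-- normalised right convolution -/
noncomputable def L2.cv (Z : Finset G) (ψ : G → ℝ) : L2 G →ₗ[ℝ] L2 G :=
  (1 / (Z.card : ℝ)) • ∑ z ∈ Z, ψ z • L2.tr (Equiv.mulRight z)

lemma L2.cv_apply' (Z : Finset G) (ψ : G → ℝ) (f : L2 G) :
    L2.cv Z ψ f = (1 / (Z.card : ℝ)) • ∑ z ∈ Z, ψ z • L2.tr (Equiv.mulRight z) f := by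
  simp [L2.cv, LinearMap.sum_apply]

lemma L2.cv_apply (Z : Finset G) (ψ : G → ℝ) (f : L2 G) (x : G) :
    L2.cv Z ψ f x = (1 / (Z.card : ℝ)) * ∑ z ∈ Z, ψ z * f (x * z⁻¹) := by
  rw [L2.cv_apply', L2.smul_apply, L2.sum_apply]
  rfl

lemma L2.cv_rho (Z : Finset G) (ψ : G → ℝ) (g : G) (f : L2 G) :
    L2.cv Z ψ (L2.rho G g f) = L2.rho G g (L2.cv Z ψ f) := by
  apply L2.ext; intro x
  simp only [L2.cv_apply, L2.rho_apply, mul_assoc]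

lemma L2.cv_norm (Z : Finset G) (ψ : G → ℝ) (hψ : ∀ x, |ψ x| ≤ 1) (hZ : Z.Nonempty) (f : L2 G) :
    ‖L2.cv Z ψ f‖ ≤ ‖f‖ := by
  have hZ' : (0 : ℝ) < Z.card := by exact_mod_cast hZ.card_pos
  rw [L2.cv_apply', norm_smul, Real.norm_of_nonneg (by positivity), one_div, inv_mul_le_iff₀ hZ']
  have := norm_sum_le_of_le (f := fun z => ψ z • L2.tr (Equiv.mulRight z) f) Z (n := fun _ => ‖f‖) (by
    intro z _
    rw [norm_smul, L2.tr_norm, Real.norm_eq_abs]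
    exact mul_le_of_le_one_left (norm_nonneg _) (hψ z))
  rwa [Finset.sum_const, nsmul_eq_mul] at this

lemma L2.cv_inner [DecidableEq G] (Z : Finset G) (ψ : G → ℝ) (hZ : Z⁻¹ = Z) (hψ : ∀ x, ψ x⁻¹ = ψ x)
    (f g : L2 G) : inner ℝ (L2.cv Z ψ f) g = inner ℝ f (L2.cv Z ψ g) := by
  rw [L2.cv_apply', L2.cv_apply', inner_smul_left, inner_smul_right, sum_inner, inner_sum,
    conj_trivial]
  congr 1
  apply Finset.sum_bij' (fun z _ => z⁻¹) (fun z _ => z⁻¹)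
  · intro z _; exact inv_inv z
  · intro z _; exact inv_inv z
  · intro z _
    rw [inner_smul_left, inner_smul_right, conj_trivial, hψ, L2.tr_inner, Equiv.mulRight_symm]
  · intro z hz; exact inv_mem_symm hZ hz
  · intro z hz; exact inv_mem_symm hZ hz

lemma L2.cv_kernel (Z X : Finset G) (ψ : G → ℝ) (hψ : ∀ x, x ∉ Z → ψ x = 0) (u : L2 G)
    (hu : ∀ x, x ∉ X → u x = 0) (x : G) :
    L2.cv Z ψ u x = (1 / (Z.card : ℝ)) * ∑ y ∈ X, ψ (y⁻¹ * x) * u y := by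
  rw [L2.cv_apply]
  congr 1
  have h1 : ∑ z ∈ Z, ψ z * u (x * z⁻¹) = ∑ᶠ z, ψ z * u (x * z⁻¹) := by
    symm
    apply finsum_eq_sum_of_support_subset
    intro z hz
    rw [Function.mem_support] at hz
    by_contra hc
    exact left_ne_zero_of_mul hz (hψ z hc)
  have h2 : ∑ y ∈ X, ψ (y⁻¹ * x) * u y = ∑ᶠ y, ψ (y⁻¹ * x) * u y := by
    symm
    apply finsum_eq_sum_of_support_subset
    intro z hz
    rw [Function.mem_support] at hz
    by_contra hc
    exact right_ne_zero_of_mul hz (hu z hc)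
  rw [h1, h2, ← finsum_comp_equiv ((Equiv.inv G).trans (Equiv.mulLeft x))
    (f := fun y => ψ (y⁻¹ * x) * u y)]
  apply finsum_congr
  intro z
  simp

end ltwo

section steptwo

variable {G : Type} [Group G] [DecidableEq G]

lemma L2.smooth (Z : Finset G) (hZ : Z.Nonempty) (w ψ : G → ℝ) (hw : ∀ x, |w x| ≤ 1)
    (hw0 : ∀ x, x ∉ Z → w x = 0) (hψ0 : ∀ x, x ∉ Z → ψ x = 0) (η : ℝ) (hη : 0 ≤ η) (h : G)
    (hh : ∀ y ∈ Z, ∀ x, |ψ (y⁻¹ * (h⁻¹ * x)) - ψ (y⁻¹ * x)| ≤ η) (f : L2 G) :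
    ‖L2.mw w (L2.cv Z ψ (L2.rho G h (L2.mw w f) - L2.mw w f))‖ ≤ η * ‖f‖ := by
  have ha : (0 : ℝ) < Z.card := by exact_mod_cast hZ.card_pos
  set u := L2.mw w f with hu
  have hu0 : ∀ x, x ∉ Z → u x = 0 := by
    intro x hx; rw [hu, L2.mw_apply, hw0 x hx, zero_mul]
  set a : ℝ := ((Z.card : ℕ) : ℝ) with hadef
  have hN : ∑ y ∈ Z, |u y| ^ 2 = ‖u‖ ^ 2 := by
    rw [L2.norm_sq, L2.ip_eq _ _ Z hu0]
    exact Finset.sum_congr rfl (fun x _ => by rw [sq_abs]; ring)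
  have hsum : (∑ y ∈ Z, |u y|) ^ 2 ≤ a * ‖u‖ ^ 2 := by
    rw [← hN]; exact sq_sum_le_card_mul_sum_sq
  set v := L2.mw w (L2.cv Z ψ (L2.rho G h u - u)) with hv
  have hv0 : ∀ x, x ∉ Z → v x = 0 := by
    intro x hx; rw [hv, L2.mw_apply, hw0 x hx, zero_mul]
  have hvx : ∀ x, |v x| ≤ (η / a) * ∑ y ∈ Z, |u y| := by
    intro x
    rw [hv, L2.mw_apply, map_sub, L2.sub_apply, L2.cv_rho, L2.rho_apply,
      L2.cv_kernel Z Z ψ hψ0 u hu0, L2.cv_kernel Z Z ψ hψ0 u hu0, ← mul_sub,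
      ← Finset.sum_sub_distrib, abs_mul]
    refine (mul_le_of_le_one_left (abs_nonneg _) (hw x)).trans ?_
    rw [abs_mul, abs_of_pos (by positivity)]
    have : |∑ y ∈ Z, (ψ (y⁻¹ * (h⁻¹ * x)) * u y - ψ (y⁻¹ * x) * u y)| ≤ ∑ y ∈ Z, η * |u y| := by
      refine (Finset.abs_sum_le_sum_abs _ _).trans (Finset.sum_le_sum ?_)
      intro y hy
      rw [← sub_mul, abs_mul]
      exact mul_le_mul_of_nonneg_right (hh y hy x) (abs_nonneg _)
    rw [← Finset.mul_sum] at this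
    calc _ ≤ 1 / a * (η * ∑ y ∈ Z, |u y|) := by gcongr
      _ = _ := by ring
  have huf : ‖u‖ ≤ ‖f‖ := L2.mw_norm w hw f
  apply le_of_sq_le_sq _ (by positivity)
  calc ‖v‖ ^ 2 = ∑ x ∈ Z, |v x| ^ 2 := by
        rw [L2.norm_sq, L2.ip_eq _ _ Z hv0]
        exact Finset.sum_congr rfl (fun x _ => by rw [sq_abs]; ring)
    _ ≤ ∑ x ∈ Z, ((η / a) * ∑ y ∈ Z, |u y|) ^ 2 := by
        apply Finset.sum_le_sum
        intro x _
        exact pow_le_pow_left₀ (abs_nonneg _) (hvx x) 2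
    _ = η ^ 2 / a * (∑ y ∈ Z, |u y|) ^ 2 := by
        rw [Finset.sum_const, nsmul_eq_mul, ← hadef]; field_simp
    _ ≤ η ^ 2 / a * (a * ‖u‖ ^ 2) := by gcongr
    _ = (η * ‖u‖) ^ 2 := by field_simp
    _ ≤ _ := by gcongr

lemma step2 (Z : Finset G) (hZ1 : (1 : G) ∈ Z) (hZs : Z⁻¹ = Z) (w ψ : G → ℝ) (hw : ∀ x, |w x| ≤ 1)
    (hψ : ∀ x, |ψ x| ≤ 1) (hw0 : ∀ x, x ∉ Z → w x = 0) (hψ0 : ∀ x, x ∉ Z → ψ x = 0)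
    (hψs : ∀ x, ψ x⁻¹ = ψ x) (r : ℕ) (hr : 0 < r) (δ η β : ℝ) (hδ : 0 ≤ δ) (hη : 0 ≤ η)
    (hεle : η + δ ≤ 1) (hβ : 0 < β) (B : Finset G) (hB : ∀ g ∈ B, g ^ r = 1)
    (h1 : ∀ g ∈ B, ∀ i ≤ r, ∀ x, |w x - w ((g ^ i)⁻¹ * x)| ≤ δ)
    (h2 : ∀ g ∈ B, ∀ i ≤ r, ∀ y ∈ Z, ∀ x, |ψ (y⁻¹ * ((g ^ i)⁻¹ * x)) - ψ (y⁻¹ * x)| ≤ η)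
    (S : Finset G) (hS : S.Nonempty) (hSZ : S ⊆ Z) (hwS : ∀ x ∈ S, w x = 1)
    (hψS : ∀ x ∈ S, ∀ y ∈ S, ψ (y⁻¹ * x) = 1) (hβS : β * Z.card ≤ S.card) (j L : ℕ)
    (hnum : L * (2 * ((η + δ) ^ (2 ^ j) + ((2 ^ j : ℕ) : ℝ) ^ 2 * (2 * δ)) +
      2 * ((2 ^ j : ℕ) : ℝ) * (2 * δ)) * 2 ^ (2 ^ j - 1) < β ^ (2 ^ j)) (h : G) (hh : h ∈ B ^ L) :
    ∃ x ∈ S, ∃ y ∈ S, ψ ((h * y)⁻¹ * x) ≠ 0 := by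
  by_contra! hcon
  have hZ : Z.Nonempty := ⟨1, hZ1⟩
  have ha : (0 : ℝ) < Z.card := by exact_mod_cast hZ.card_pos
  have hSc : (0 : ℝ) < S.card := by exact_mod_cast hS.card_pos
  let T : L2 G →ₗ[ℝ] L2 G := L2.mw w ∘ₗ L2.cv Z ψ ∘ₗ L2.mw w
  have hTdef : ∀ v, T v = L2.mw w (L2.cv Z ψ (L2.mw w v)) := fun v => rfl
  have hTs : ∀ u v : L2 G, inner ℝ (T u) v = inner ℝ u (T v) := by
    intro u v
    rw [hTdef, hTdef, L2.mw_inner, L2.cv_inner Z ψ hZs hψs, L2.mw_inner]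
  have hTc : ∀ v, ‖T v‖ ≤ ‖v‖ := fun v =>
    (L2.mw_norm w hw _).trans ((L2.cv_norm Z ψ hψ hZ _).trans (L2.mw_norm w hw _))
  have hwρ : ∀ g ∈ B, ∀ i ≤ r, ∀ v, ‖L2.mw w (L2.rho G (g ^ i) v) - L2.rho G (g ^ i) (L2.mw w v)‖
      ≤ δ * ‖v‖ := by
    intro g hg i hi v
    rw [← L2.rho_norm (g ^ i) v]
    apply L2.norm_le _ _ _ hδ
    intro x
    rw [L2.sub_apply, L2.mw_apply, L2.rho_apply, L2.rho_apply, L2.mw_apply, ← sub_mul, abs_mul]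
    exact mul_le_mul_of_nonneg_right (h1 g hg i hi x) (abs_nonneg _)
  have hcomm : ∀ g ∈ B, ∀ i ≤ r, ∀ v, ‖T (L2.rho G (g ^ i) v) - L2.rho G (g ^ i) (T v)‖
      ≤ (2 * δ) * ‖v‖ := by
    intro g hg i hi v
    set ρ := L2.rho G (g ^ i) with hρ
    have e : T (ρ v) - ρ (T v) = L2.mw w (L2.cv Z ψ (L2.mw w (ρ v) - ρ (L2.mw w v))) +
        (L2.mw w (ρ (L2.cv Z ψ (L2.mw w v))) - ρ (L2.mw w (L2.cv Z ψ (L2.mw w v)))) := by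
      rw [hTdef, hTdef, map_sub, map_sub, L2.cv_rho]; abel
    rw [e]
    have b1 := (L2.mw_norm w hw _).trans ((L2.cv_norm Z ψ hψ hZ _).trans (hwρ g hg i hi v))
    have b2 := hwρ g hg i hi (L2.cv Z ψ (L2.mw w v))
    have b3 := (L2.cv_norm Z ψ hψ hZ (L2.mw w v)).trans (L2.mw_norm w hw _)
    calc _ ≤ _ := norm_add_le _ _
      _ ≤ δ * ‖v‖ + δ * ‖L2.cv Z ψ (L2.mw w v)‖ := add_le_add b1 b2
      _ ≤ δ * ‖v‖ + δ * ‖v‖ := by gcongr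
      _ = _ := by ring
  have hsm : ∀ g ∈ B, ∀ i ≤ r, ∀ v, ‖T (L2.rho G (g ^ i) v - v)‖ ≤ (η + δ) * ‖v‖ := by
    intro g hg i hi v
    set ρ := L2.rho G (g ^ i) with hρ
    have e : T (ρ v - v) = L2.mw w (L2.cv Z ψ (ρ (L2.mw w v) - L2.mw w v)) +
        L2.mw w (L2.cv Z ψ (L2.mw w (ρ v) - ρ (L2.mw w v))) := by
      rw [hTdef]; simp only [map_sub]; abel
    rw [e, add_mul]
    have b1 := (L2.mw_norm w hw _).trans ((L2.cv_norm Z ψ hψ hZ _).trans (hwρ g hg i hi v))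
    have b2 := L2.smooth Z hZ w ψ hw hw0 hψ0 η hη (g ^ i) (h2 g hg i hi) v
    exact (norm_add_le _ _).trans (add_le_add b2 b1)
  let f : L2 G := Finsupp.indicator S (fun _ _ => (1 : ℝ))
  have hf1 : ∀ x ∈ S, f x = 1 := fun x hx => Finsupp.indicator_of_mem hx _
  have hf0 : ∀ x, x ∉ S → f x = 0 := fun x hx => Finsupp.indicator_of_notMem hx _
  have hip : ∀ g : L2 G, inner ℝ g f = ∑ x ∈ S, g x := by
    intro g
    rw [L2.inner_def, L2.ip_eq _ _ S hf0]
    exact Finset.sum_congr rfl (fun x hx => by rw [hf1 x hx, mul_one])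
  have hfn : ‖f‖ ^ 2 = S.card := by
    rw [← real_inner_self_eq_norm_sq, hip, Finset.sum_congr rfl hf1]; simp
  have hfpos : 0 < ‖f‖ := by
    by_contra hc
    have : ‖f‖ = 0 := le_antisymm (not_lt.1 hc) (norm_nonneg _)
    rw [this] at hfn
    norm_num at hfn
    linarith
  have hmain := hilb3 (L2.rho G) L2.rho_norm T hTs hTc r hr (η + δ) (2 * δ) β (by positivity) hεle
    (by positivity) hβ B hB hcomm hsm f (norm_pos_iff.1 hfpos) j L hnum h hh
  have hmw0 : ∀ v : L2 G, ∀ x, x ∉ Z → L2.mw w v x = 0 := by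
    intro v x hx; rw [L2.mw_apply, hw0 x hx, zero_mul]
  have hTx : ∀ v : L2 G, ∀ x ∈ S,
      T v x = (1 / (Z.card : ℝ)) * ∑ y ∈ Z, ψ (y⁻¹ * x) * (w y * v y) := by
    intro v x hx
    rw [hTdef, L2.mw_apply, hwS x hx, one_mul, L2.cv_kernel Z Z ψ hψ0 _ (hmw0 v)]
    rfl
  have hTf : ∀ x ∈ S, T f x = S.card / Z.card := by
    intro x hx
    rw [hTx f x hx, ← Finset.sum_subset hSZ, Finset.sum_congr rfl (g := fun _ => (1 : ℝ))]
    · simp; ring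
    · intro y hy
      rw [hψS x hx y hy, hwS y hy, hf1 y hy]; norm_num
    · intro y _ hy
      rw [hf0 y hy]; simp
  have hTρ : ∀ x ∈ S, T (L2.rho G h f) x = 0 := by
    intro x hx
    rw [hTx _ x hx, Finset.sum_eq_zero, mul_zero]
    intro y _
    rw [L2.rho_apply]
    by_cases hy : h⁻¹ * y ∈ S
    · have := hcon x hx _ hy
      rw [mul_inv_cancel_left] at this
      rw [this, zero_mul]
    · rw [hf0 _ hy]; simp
  have hin : inner ℝ (T (L2.rho G h f - f)) f = - ((S.card : ℝ) * (S.card / Z.card)) := by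
    rw [hip, Finset.sum_congr rfl (g := fun _ => - ((S.card : ℝ) / Z.card))]
    · simp
    · intro x hx
      rw [map_sub, L2.sub_apply, hTρ x hx, hTf x hx, zero_sub]
  have hb := abs_real_inner_le_norm (T (L2.rho G h f - f)) f
  rw [hin, abs_neg, abs_of_pos (by positivity)] at hb
  have h3 : β ≤ S.card / Z.card := by rwa [le_div_iff₀ ha]
  have h4 : ‖T (L2.rho G h f - f)‖ * ‖f‖ < β * ‖f‖ * ‖f‖ := mul_lt_mul_of_pos_right hmain hfpos
  have h5 : (S.card : ℝ) * β ≤ S.card * (S.card / Z.card) := by gcongr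
  have h6 : β * ‖f‖ * ‖f‖ = S.card * β := by rw [← hfn]; ring
  linarith

end steptwo

section finalpart

lemma numeric (β : ℝ) (hβ : 0 < β) : ∃ n2 : ℕ, 0 < n2 ∧ ∀ L : ℕ, ∃ j M : ℕ, 0 < M ∧
    (1 / (n2 : ℝ) + 1 / (M : ℝ) ≤ 1) ∧
    L * (2 * ((1 / (n2 : ℝ) + 1 / (M : ℝ)) ^ (2 ^ j) + ((2 ^ j : ℕ) : ℝ) ^ 2 * (2 * (1 / (M : ℝ)))) +
      2 * ((2 ^ j : ℕ) : ℝ) * (2 * (1 / (M : ℝ)))) * 2 ^ (2 ^ j - 1) < β ^ (2 ^ j) := by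
  obtain ⟨n, hn⟩ := exists_nat_gt (4 / β + 2)
  have hb4 : 0 < 4 / β := by positivity
  have hn0 : (0 : ℝ) < n := by linarith
  have hn2 : 1 / (n : ℝ) ≤ 1 / 2 := by
    apply one_div_le_one_div_of_le <;> linarith
  have hnβ : 2 * (1 / (n : ℝ)) ≤ β / 2 := by
    have h1 : 4 / β ≤ n := by linarith
    rw [div_le_iff₀ hβ] at h1
    rw [mul_one_div, div_le_div_iff₀ hn0 (by norm_num)]
    linarith
  refine ⟨n, by exact_mod_cast hn0, ?_⟩
  intro L
  set s := 2 ^ L with hs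
  have hs1 : 1 ≤ s := Nat.one_le_two_pow
  have hLs : L < s := Nat.lt_two_pow_self
  have hL2 : (L : ℝ) < 2 ^ s := by
    exact_mod_cast hLs.trans Nat.lt_two_pow_self
  let F : ℝ → ℝ := fun δ => L * (2 * ((1 / (n : ℝ) + δ) ^ s + ((s : ℕ) : ℝ) ^ 2 * (2 * δ)) +
      2 * ((s : ℕ) : ℝ) * (2 * δ)) * 2 ^ (s - 1)
  have hF : Continuous F := by
    simp only [F]; fun_prop
  have hF0 : F 0 < β ^ s := by
    have e : F 0 = L * (2 * (1 / (n : ℝ))) ^ s := by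
      simp only [F]
      have : (2 : ℝ) ^ s = 2 * 2 ^ (s - 1) := by rw [← pow_succ']; congr 1; omega
      rw [mul_pow, this]; ring
    rw [e]
    calc L * (2 * (1 / (n : ℝ))) ^ s ≤ L * (β / 2) ^ s := by gcongr
      _ < 2 ^ s * (β / 2) ^ s := by gcongr
      _ = β ^ s := by rw [← mul_pow]; congr 1; ring
  have ht : Filter.Tendsto (fun M : ℕ => 1 / (M : ℝ)) Filter.atTop (nhds 0) :=
    tendsto_one_div_atTop_nhds_zero_nat
  have e1 : ∀ᶠ M : ℕ in Filter.atTop, F (1 / (M : ℝ)) < β ^ s :=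
    ((hF.tendsto 0).comp ht).eventually_lt_const hF0
  have e2 : ∀ᶠ M : ℕ in Filter.atTop, 1 / (M : ℝ) < 1 / 2 := ht.eventually_lt_const (by norm_num)
  obtain ⟨M, hM1, hM2, hM3⟩ := (e1.and (e2.and (Filter.eventually_gt_atTop 0))).exists
  exact ⟨L, M, hM3, by linarith, hM1⟩

variable {G : Type} [Group G] [DecidableEq G]

lemma conj_mem_pow {D S : Finset G} {y : G} (hy : y ∈ D ^ 16) (m : ℕ) :
    ∀ g ∈ S ^ m, y⁻¹ * g * y ∈ cl D S ^ m := by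
  induction m with
  | zero =>
    intro g hg
    rw [pow_zero, Finset.mem_one] at hg
    simp [hg]
  | succ m ih =>
    intro g hg
    rw [pow_succ] at hg
    obtain ⟨a, ha, b, hb, rfl⟩ := Finset.mem_mul.1 hg
    have : y⁻¹ * (a * b) * y = (y⁻¹ * a * y) * (y⁻¹ * b * y) := by group
    rw [this, pow_succ]
    exact Finset.mul_mem_mul (ih a ha) (mem_cl hy hb)

lemma self_sub_pow {S : Finset G} (h : (1 : G) ∈ S) {n : ℕ} (hn : 1 ≤ n) : S ⊆ S ^ n := by
  have := pow_sub h hn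
  rwa [pow_one] at this

lemma doubling {D Q S0 S1 S2 : Finset G} {K c0 c1 c2 cQ : ℝ} (hD : AG K D) (hS0 : Nb D c0 S0)
    (hS1 : Nb D c1 S1) (hS2 : Nb D c2 S2) (hQ : Nb D cQ Q) (hc1 : 0 < c1) (hc2 : 0 < c2)
    (r n1 n2 M j L N : ℕ) (hr : 0 < r) (hn1 : 0 < n1) (hn2 : 0 < n2) (hM : 0 < M) (hN : 0 < N)
    (h10 : (cl D S1) ^ 12 ⊆ S0 ^ 4) (h21 : (cl D S2) ^ (6 * r * n2) ⊆ S1 ^ 4)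
    (hQ2 : (cl D Q) ^ (r * n1) ⊆ S2 ^ 4) (hexp : ∀ i, ∀ g ∈ D ^ i, g ^ r = 1)
    (hQN : Q ^ N ⊆ S0 ^ 4)
    (num1 : 2 * r * M * K ^ 8 < n1 * c2) (num2 : K ^ 16 < (L + 1) * c2)
    (num3 : 1 / (n2 : ℝ) + 1 / (M : ℝ) ≤ 1)
    (num4 : L * (2 * ((1 / (n2 : ℝ) + 1 / (M : ℝ)) ^ (2 ^ j) +
      ((2 ^ j : ℕ) : ℝ) ^ 2 * (2 * (1 / (M : ℝ)))) +
      2 * ((2 ^ j : ℕ) : ℝ) * (2 * (1 / (M : ℝ)))) * 2 ^ (2 ^ j - 1) < (c1 / K ^ 16) ^ (2 ^ j)) :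
    Q ^ (2 * N) ⊆ S0 ^ 4 := by
  have hK : (0 : ℝ) < K := by linarith [hD.K1]
  have hQN4 : Q ^ N ⊆ D ^ 4 := hQN.trans hS0.sub
  have hSD : ∀ {c : ℝ} {S : Finset G}, Nb D c S → S ⊆ D ^ 4 := fun h =>
    (self_sub_pow h.one_mem (by norm_num)).trans h.sub
  have hDmono : ∀ {a b : ℕ}, a ≤ b → D ^ a ⊆ D ^ b := fun h => pow_sub hD.one_mem h
  have hQD : Q ⊆ D ^ 4 := hSD hQ
  have hQS2 : Q ⊆ S2 ^ 4 := by
    refine Finset.Subset.trans ?_ hQ2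
    exact (sub_cl hD.one_mem).trans
      (self_sub_pow (cl_one hD.one_mem hQ.one_mem) (Nat.mul_pos hr hn1))
  have hP : Q ^ (2 * N * r * M) ⊆ D ^ 12 := by
    apply gleason hD hS2 hc2 hQ.one_mem hQ.symm n1 r N _ hn1 hr hN hQ2 hQN4
      (fun g hg => hexp 4 g (hQD hg))
    have hN' : (0 : ℝ) < N := by exact_mod_cast hN
    push_cast
    calc (2 * N * r * M * K ^ 8 : ℝ) = N * (2 * r * M * K ^ 8) := by ring
      _ < N * (n1 * c2) := by gcongr
      _ = _ := by ring
  have hrM : 1 ≤ r * M := Nat.mul_pos hr hM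
  have hP2 : Q ^ (2 * N) ⊆ D ^ 12 := by
    refine (pow_sub hQ.one_mem ?_).trans hP
    rw [mul_assoc (2 * N)]
    exact Nat.le_mul_of_pos_right _ hrM
  set Z := D ^ 16 with hZ
  set R := Q ^ (2 * N * r) with hR
  have hR1 : (1 : G) ∈ R := Finset.one_mem_pow hQ.one_mem
  have hRs : R⁻¹ = R := inv_pow_symm hQ.symm _
  set V := (cl D S2) ^ (6 * r) with hV
  have hV1 : (1 : G) ∈ V := Finset.one_mem_pow (cl_one hD.one_mem hS2.one_mem)
  have hVs : V⁻¹ = V := inv_pow_symm (cl_symm hS2.symm) _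
  have hVn : V ^ n2 ⊆ S1 ^ 4 := by rw [hV, ← pow_mul]; exact h21
  have hS1s : ∀ i, (S1 ^ i)⁻¹ = S1 ^ i := inv_pow_symm hS1.symm
  set w := cut (fun i => R ^ i * S1) M with hw
  set ψ := cut (fun i => V ^ i * S1 ^ 2 * V ^ i) n2 with hψ
  have hS1D12 : S1 ^ 12 ⊆ D ^ 12 := by
    rw [show 12 = 4 * 3 from rfl, pow_mul, pow_mul]
    exact Finset.pow_subset_pow_left hS1.sub
  have hVS : V ^ n2 * S1 ^ 2 * V ^ n2 ⊆ S1 ^ 10 := by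
    calc V ^ n2 * S1 ^ 2 * V ^ n2 ⊆ S1 ^ 4 * S1 ^ 2 * S1 ^ 4 :=
          Finset.mul_subset_mul (Finset.mul_subset_mul_right hVn) hVn
      _ = S1 ^ 10 := by rw [← pow_add, ← pow_add]
  have hψ0 : ∀ x, x ∉ S1 ^ 10 → ψ x = 0 := by
    apply cut_zero
    intro i hi
    refine Finset.Subset.trans ?_ hVS
    exact Finset.mul_subset_mul (Finset.mul_subset_mul_right (pow_sub hV1 hi.le))
      (pow_sub hV1 hi.le)
  have hw0 : ∀ x, x ∉ Z → w x = 0 := by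
    apply cut_zero
    intro i hi
    refine mul_sub_pow (i := 12) (j := 4) ?_ (hSD hS1) rfl
    refine (pow_sub hR1 hi.le).trans ?_
    rw [hR, ← pow_mul]; exact hP
  have hψs : ∀ x, ψ x⁻¹ = ψ x := by
    intro x
    rw [hψ]
    unfold cut
    congr 1
    apply Finset.sum_congr rfl
    intro i _
    have : (V ^ i * S1 ^ 2 * V ^ i)⁻¹ = V ^ i * S1 ^ 2 * V ^ i := by
      rw [mul_inv_rev, mul_inv_rev, inv_pow_symm hVs, hS1s, mul_assoc]
    have h' : x⁻¹ ∈ V ^ i * S1 ^ 2 * V ^ i ↔ x ∈ V ^ i * S1 ^ 2 * V ^ i := by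
      rw [← Finset.mem_inv', this]
    simp only [h']
  set B := S2 ^ 6 ∩ Q ^ (2 * N) with hB
  have hpath : Q ^ (2 * N) ⊆ B ^ L := by
    apply path S2 Q Z hS2.one_mem hS2.symm hQ.one_mem hQ.symm hQS2 (2 * N)
      (mul_sub_pow hP2 (hSD hS2) rfl)
    intro t ht
    have h1 : (t : ℝ) * S2.card ≤ K ^ 16 * D.card :=
      le_trans (by exact_mod_cast ht) (hD.card 16)
    have h2 : (t : ℝ) * c2 * D.card ≤ K ^ 16 * D.card := by
      refine le_trans ?_ h1
      rw [mul_assoc]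
      gcongr
      exact hS2.card
    have h3 := le_of_mul_le_mul_right h2 hD.pos
    have h4 : (t : ℝ) * c2 < (L + 1) * c2 := lt_of_le_of_lt h3 num2
    have h5 : (t : ℝ) < L + 1 := lt_of_mul_lt_mul_right h4 hc2.le
    have h6 : t < L + 1 := by exact_mod_cast h5
    omega
  have habs : ∀ (X : ℕ → Finset G) (n : ℕ) x, |cut X n x| ≤ 1 := by
    intro X n x
    rw [abs_of_nonneg (cut_nonneg _ _ _)]; exact cut_le _ _ _
  intro h hh
  obtain ⟨x, hx, y, hy, hxy⟩ := step2 Z (Finset.one_mem_pow hD.one_mem) (inv_pow_symm hD.symm _) w ψ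
    (habs _ _) (habs _ _) hw0
    (fun x hx => hψ0 x (fun hc => hx (hDmono (by norm_num)
      (hS1D12 (pow_sub hS1.one_mem (by norm_num) hc)))))
    hψs r hr (1 / M) (1 / n2) (c1 / K ^ 16) (by positivity) (by positivity) num3 (by positivity)
    B (fun g hg => hexp 12 g (hP2 (Finset.mem_inter.1 hg).2))
    (by
      intro g hg i hi x
      have hgi : g ^ i ∈ R := by
        have h1 := Finset.pow_mem_pow (n := i) (Finset.mem_inter.1 hg).2
        rw [← pow_mul] at h1
        exact pow_sub hQ.one_mem (Nat.mul_le_mul_left _ hi) h1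
      apply cut_lip
      · intro l hl
        rw [pow_succ', mul_assoc]
        exact Finset.mul_mem_mul (inv_mem_symm hRs hgi) hl
      · intro l hl
        rw [pow_succ', mul_assoc]
        have : x = g ^ i * ((g ^ i)⁻¹ * x) := by group
        rw [this]
        exact Finset.mul_mem_mul hgi hl)
    (by
      intro g hg i hi y hy x
      have hgi : g ^ i ∈ S2 ^ (6 * r) := by
        have h1 := Finset.pow_mem_pow (n := i) (Finset.mem_inter.1 hg).1
        rw [← pow_mul] at h1
        exact pow_sub hS2.one_mem (Nat.mul_le_mul_left _ hi) h1
      have hv : y⁻¹ * (g ^ i)⁻¹ * y ∈ V :=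
        conj_mem_pow hy _ _ (inv_mem_symm (inv_pow_symm hS2.symm _) hgi)
      set v := y⁻¹ * (g ^ i)⁻¹ * y with hvdef
      have e : y⁻¹ * ((g ^ i)⁻¹ * x) = v * (y⁻¹ * x) := by rw [hvdef]; group
      rw [e]
      set u := y⁻¹ * x
      have gen : ∀ v ∈ V, ∀ u : G, ∀ l, u ∈ V ^ l * S1 ^ 2 * V ^ l →
          v * u ∈ V ^ (l + 1) * S1 ^ 2 * V ^ (l + 1) := by
        intro v hv u l hl
        obtain ⟨a, ha, b, hb, rfl⟩ := Finset.mem_mul.1 hl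
        obtain ⟨a1, ha1, a2, ha2, rfl⟩ := Finset.mem_mul.1 ha
        have : v * (a1 * a2 * b) = (v * a1) * a2 * b := by group
        rw [this]
        refine Finset.mul_mem_mul (Finset.mul_mem_mul ?_ ha2) (pow_sub hV1 (Nat.le_succ l) hb)
        rw [pow_succ']; exact Finset.mul_mem_mul hv ha1
      apply cut_lip
      · intro l hl
        have := gen _ (inv_mem_symm hVs hv) _ l hl
        rwa [inv_mul_cancel_left] at this
      · intro l hl
        exact gen _ hv _ l hl)
    S1 ⟨1, hS1.one_mem⟩ ((hSD hS1).trans (hDmono (by norm_num)))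
    (by
      intro x hx
      apply cut_one _ M hM
      · intro i; exact Finset.mul_subset_mul_right (pow_sub hR1 (Nat.le_succ i))
      · simpa using hx)
    (by
      intro x hx y hy
      apply cut_one _ n2 hn2
      · intro i
        exact Finset.mul_subset_mul (Finset.mul_subset_mul_right (pow_sub hV1 (Nat.le_succ i)))
          (pow_sub hV1 (Nat.le_succ i))
      · rw [pow_zero, one_mul, mul_one, pow_two]
        exact Finset.mul_mem_mul (inv_mem_symm hS1.symm hy) hx)
    (by
      refine le_trans ?_ hS1.card
      calc c1 / K ^ 16 * (Z.card : ℝ) ≤ c1 / K ^ 16 * (K ^ 16 * D.card) := by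
            gcongr; exact hD.card 16
        _ = _ := by field_simp)
    j L num4 h (hpath hh)
  have h3 : (h * y)⁻¹ * x ∈ S1 ^ 10 := by
    by_contra hc
    exact hxy (hψ0 _ hc)
  have e : h = x * ((h * y)⁻¹ * x)⁻¹ * y⁻¹ := by group
  have h4 : h ∈ S1 ^ 12 := by
    have e2 : S1 ^ 12 = S1 * S1 ^ 10 * S1 := by rw [← pow_succ', ← pow_succ]
    rw [e2, e]
    exact Finset.mul_mem_mul (Finset.mul_mem_mul hx (inv_mem_symm (hS1s 10) h3))
      (inv_mem_symm hS1.symm hy)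
  have h5 : S1 ^ 12 ⊆ (cl D S1) ^ 12 := Finset.pow_subset_pow_left (sub_cl hD.one_mem)
  exact Finset.mem_of_subset (h5.trans h10) h4

end finalpart

end STBE

/-- For all positive integers `k`, `m`, `r` there is `C` such that: if `G` is a group and
`A ⊆ G` is nonempty finite with `|A³| ≤ k|A|` and `⟨A⟩` has exponent `r`, then there is a
subgroup `H` of `⟨A⟩` such that `Āᵐ` is covered by at most `C` left cosets of `H`, where
`Ā = A ∪ A⁻¹ ∪ {1}`, and `H ⊆ (AA⁻¹)² ∩ A²A⁻² ∩ (A⁻¹A)² ∩ A⁻²A²`. -/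
theorem small_tripling_bounded_exponent (k m r : ℕ) (hk : 0 < k) (hm : 0 < m)
    (hr : 0 < r) :
    ∃ C : ℕ, ∀ (G : Type) [Group G] [DecidableEq G],
      ∀ A : Finset G, A.Nonempty →
      (A ^ 3).card ≤ k * A.card →
      (∀ x ∈ Subgroup.closure (A : Set G), x ^ r = 1) →
      ∃ H : Subgroup G, H ≤ Subgroup.closure (A : Set G) ∧
        (∃ F : Finset G, F.card ≤ C ∧
          (((A ∪ A⁻¹ ∪ (1 : Finset G)) ^ m : Finset G) : Set G)
            ⊆ (F : Set G) * (H : Set G)) ∧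
        (H : Set G) ⊆
          ↑(((A * A⁻¹) ^ 2 ∩ (A ^ 2 * A⁻¹ ^ 2) ∩ (A⁻¹ * A) ^ 2 ∩ (A⁻¹ ^ 2 * A ^ 2) :
            Finset G)) := by
  have hk1 : (1 : ℝ) ≤ k := by exact_mod_cast hk
  obtain ⟨K, hKdef⟩ : ∃ K : ℝ, K = 27 * (k : ℝ) ^ 3 := ⟨_, rfl⟩
  have hK : 1 ≤ K := by rw [hKdef]; nlinarith [one_le_pow₀ hk1 (n := 3)]
  have hK0 : 0 < K := by linarith
  obtain ⟨c0, hc0, H0⟩ := STBE.initial k hk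
  obtain ⟨c1, hc1, H1⟩ := STBE.NB K c0 12 hK hc0 (by norm_num)
  obtain ⟨n2, hn2, Hn⟩ := STBE.numeric (c1 / K ^ 16) (by positivity)
  have hrn : 1 ≤ r * n2 := Nat.mul_pos hr hn2
  have h6 : 4 ≤ 6 * r * n2 := by rw [mul_assoc]; omega
  obtain ⟨c2, hc2, H2⟩ := STBE.NB K c1 (6 * r * n2) hK hc1 h6
  obtain ⟨L, hL⟩ := exists_nat_gt (K ^ 16 / c2)
  have num2 : K ^ 16 < (L + 1) * c2 := by
    rw [div_lt_iff₀ hc2] at hL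
    linarith
  obtain ⟨j, M, hM, num3, num4⟩ := Hn L
  obtain ⟨n1, hn1⟩ := exists_nat_gt (2 * r * M * K ^ 8 / c2 + 4)
  have hn1' : 0 ≤ 2 * r * M * K ^ 8 / c2 := by positivity
  have hn14 : 4 ≤ n1 := by
    have : (4 : ℝ) < n1 := by linarith
    exact_mod_cast this.le
  have num1 : 2 * r * M * K ^ 8 < n1 * c2 := by
    rw [← div_lt_iff₀ hc2]; linarith
  obtain ⟨cQ, hcQ, HQ⟩ := STBE.NB K c2 (r * n1) hK hc2
    (hn14.trans (Nat.le_mul_of_pos_left _ hr))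
  refine ⟨⌈K ^ (m + 4) / cQ⌉₊, ?_⟩
  intro G _ _ A hA hA3 hexp
  have hD : STBE.AG K (A ∪ A⁻¹ ∪ 1) := by rw [hKdef]; exact STBE.growth k hk A hA hA3
  obtain ⟨S0, hS0, hS0Z⟩ := H0 G A hA hA3
  obtain ⟨D, hDdef⟩ : ∃ D : Finset G, D = A ∪ A⁻¹ ∪ 1 := ⟨_, rfl⟩
  rw [← hDdef] at hD hS0 ⊢
  obtain ⟨S1, hS1, h10⟩ := H1 G D S0 hD hS0
  obtain ⟨S2, hS2, h21⟩ := H2 G D S1 hD hS1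
  obtain ⟨Q, hQ, hQ2⟩ := HQ G D S2 hD hS2
  have hDA : ∀ x ∈ D, x ∈ Subgroup.closure (A : Set G) := by
    intro x hx
    rw [hDdef] at hx
    simp only [Finset.mem_union, Finset.mem_one, Finset.mem_inv'] at hx
    rcases hx with (h | h) | h
    · exact Subgroup.subset_closure h
    · exact (Subgroup.inv_mem_iff _).1 (Subgroup.subset_closure h)
    · rw [h]; exact Subgroup.one_mem _
  have hDjA : ∀ i, ∀ x ∈ D ^ i, x ∈ Subgroup.closure (A : Set G) := by
    intro i
    induction i with
    | zero => intro x hx; rw [pow_zero, Finset.mem_one] at hx; rw [hx]; exact Subgroup.one_mem _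
    | succ i ih =>
      intro x hx
      rw [pow_succ] at hx
      obtain ⟨a, ha, b, hb, rfl⟩ := Finset.mem_mul.1 hx
      exact Subgroup.mul_mem _ (ih a ha) (hDA b hb)
  have chain : ∀ (S S' : Finset G) (n : ℕ), 4 ≤ n → (1 : G) ∈ S' → (STBE.cl D S') ^ n ⊆ S ^ 4 →
      S' ^ 4 ⊆ S ^ 4 := by
    intro S S' n hn h1 h
    exact ((Finset.pow_subset_pow_left (STBE.sub_cl hD.one_mem)).trans
      (STBE.pow_sub (STBE.sub_cl hD.one_mem h1) hn)).trans h
  have hQS0 : Q ^ 4 ⊆ S0 ^ 4 :=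
    ((chain S2 Q _ (hn14.trans (Nat.le_mul_of_pos_left _ hr)) hQ.one_mem hQ2).trans
      (chain S1 S2 _ h6 hS2.one_mem h21)).trans (chain S0 S1 12 (by norm_num) hS1.one_mem h10)
  have hQN : ∀ N : ℕ, Q ^ (N + 1) ⊆ S0 ^ 4 := by
    intro N
    induction N with
    | zero => exact (STBE.pow_sub hQ.one_mem (by norm_num)).trans hQS0
    | succ N ih =>
      refine (STBE.pow_sub hQ.one_mem (show N + 1 + 1 ≤ 2 * (N + 1) by omega)).trans ?_
      exact STBE.doubling hD hS0 hS1 hS2 hQ hc1 hc2 r n1 n2 M j L (N + 1) hr (by omega) hn2 hM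
        (Nat.succ_pos N) h10 h21 hQ2 (fun i g hg => hexp g (hDjA i g hg)) ih num1 num2 num3 num4
  have hQH : ∀ x ∈ Subgroup.closure (Q : Set G), ∃ n : ℕ, x ∈ Q ^ (n + 1) := by
    intro x hx
    induction hx using Subgroup.closure_induction with
    | mem x hx => exact ⟨0, by simpa using hx⟩
    | one => exact ⟨0, by simpa using hQ.one_mem⟩
    | mul x y _ _ hx hy =>
      obtain ⟨a, ha⟩ := hx
      obtain ⟨b, hb⟩ := hy
      refine ⟨a + 1 + b, ?_⟩
      rw [show a + 1 + b + 1 = (a + 1) + (b + 1) by omega, pow_add]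
      exact Finset.mul_mem_mul ha hb
    | inv x _ hx =>
      obtain ⟨a, ha⟩ := hx
      exact ⟨a, STBE.inv_mem_symm (STBE.inv_pow_symm hQ.symm _) ha⟩
  have hQD : Q ⊆ D ^ 4 := (STBE.self_sub_pow hQ.one_mem (by norm_num)).trans hQ.sub
  refine ⟨Subgroup.closure (Q : Set G), ?_, ?_, ?_⟩
  · rw [Subgroup.closure_le]
    intro x hx
    exact hDjA 4 x (hQD hx)
  · have hcard : ((D ^ m * Q).card : ℝ) ≤ K ^ (m + 4) / cQ * Q.card := by
      calc ((D ^ m * Q).card : ℝ) ≤ K ^ (m + 4) * D.card :=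
            hD.card_sub (STBE.mul_sub_pow (Finset.Subset.refl _) hQD rfl)
        _ = K ^ (m + 4) / cQ * (cQ * D.card) := by field_simp
        _ ≤ _ := by gcongr; exact hQ.card
    obtain ⟨F, _, hFc, hF⟩ := Finset.ruzsa_covering_mul ⟨1, hQ.one_mem⟩ hcard
    refine ⟨F, ?_, ?_⟩
    · exact_mod_cast hFc.trans (Nat.le_ceil _)
    · intro x hx
      obtain ⟨f, hf, q, hq, rfl⟩ := Finset.mem_mul.1 (hF hx)
      obtain ⟨a, ha, b, hb, rfl⟩ := Finset.mem_div.1 hq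
      exact Set.mul_mem_mul hf (Subgroup.div_mem _ (Subgroup.subset_closure ha)
        (Subgroup.subset_closure hb))
  · intro x hx
    obtain ⟨n, hn⟩ := hQH x hx
    exact hS0Z (hQN n hn)
end

section
/- For all positive integers k, m, and r there is a constant C = C(k, m, r) such that the following holds. If G is a group and A ⊆ G is a nonempty finite set with |A³| ≤ k|A|, the subgroup ⟨A⟩ has exponent r, and ⟨A⟩ = Āᵐ where Ā = A ∪ A⁻¹ ∪ {1}, then there is a normal subgroup H of ⟨A⟩ with [⟨A⟩ : H] ≤ C such that H ⊆ (AA⁻¹)². -/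
open Pointwise

lemma sep_aux {V : Type*} [NormedAddCommGroup V] [InnerProductSpace ℝ V]
    (a : Module.End ℝ V) (ha : ∀ u, ‖a u‖ = ‖u‖) (r : ℕ) (hr : 0 < r) (har : a ^ r = 1)
    (δ : ℝ) (hδ : r * δ < 1) (hδ0 : 0 ≤ δ) (h : ∀ u, ‖a u - u‖ ≤ δ * ‖u‖) : a = 1 := by
  ext u
  set x := a u - u with hx
  have h1 : ∑ i ∈ Finset.range r, (a ^ i) x = 0 := by
    have := congrArg (fun f : Module.End ℝ V => f u) (geom_sum_mul a r)
    simpa [har, LinearMap.sum_apply, hx, Finset.sum_sub_distrib] using this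
  have hp : ∀ i : ℕ, ∀ u, ‖(a ^ i) u‖ = ‖u‖ := by
    intro i
    induction i with
    | zero => simp
    | succ i ih => intro u; rw [pow_succ, Module.End.mul_apply, ih, ha]
  have h2 : ∀ i : ℕ, ‖(a ^ i) x - x‖ ≤ i * δ * ‖x‖ := by
    intro i
    induction i with
    | zero => simp
    | succ i ih =>
      have e : (a ^ (i+1)) x - x = (a ^ i) (a x - x) + ((a^i) x - x) := by
        rw [pow_succ, Module.End.mul_apply, map_sub (a ^ i) (a x) x]; abel
      rw [e]
      refine (norm_add_le _ _).trans ?_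
      rw [hp]
      have := h x
      push_cast
      nlinarith
  have h3 : (r : ℝ) • x = ∑ i ∈ Finset.range r, (x - (a ^ i) x) := by
    rw [Finset.sum_sub_distrib, h1]; simp [Nat.cast_smul_eq_nsmul]
  have h4 : r * ‖x‖ ≤ r * (r * δ * ‖x‖) := by
    calc r * ‖x‖ = ‖(r : ℝ) • x‖ := by rw [norm_smul]; simp
      _ ≤ ∑ i ∈ Finset.range r, ‖x - (a ^ i) x‖ := by rw [h3]; exact norm_sum_le _ _
      _ ≤ ∑ i ∈ Finset.range r, (r * δ * ‖x‖) := by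
          apply Finset.sum_le_sum
          intro i hi
          rw [norm_sub_rev]
          refine (h2 i).trans ?_
          have : (i:ℝ) ≤ r := by exact_mod_cast (Finset.mem_range.1 hi).le
          gcongr
      _ = _ := by simp
  have hr' : (0:ℝ) < r := by exact_mod_cast hr
  have h5 := le_of_mul_le_mul_left h4 hr'
  have h6 : ‖x‖ = 0 := by
    by_contra hne
    have : 0 < ‖x‖ := lt_of_le_of_ne (norm_nonneg _) (Ne.symm hne)
    nlinarith
  have := norm_eq_zero.1 h6
  simpa [hx, sub_eq_zero] using this

lemma index_le_aux {G F : Type*} [Group G] [Finite F] (H : Subgroup G) (f : G → F)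
    (hf : ∀ g g', f g = f g' → g⁻¹ * g' ∈ H) : H.index ≤ Nat.card F := by
  apply Nat.card_le_card_of_injective (fun q : G ⧸ H => f q.out)
  intro q q' h
  have := hf _ _ h
  rw [← QuotientGroup.eq] at this
  simpa using this

lemma rep_aux (r : ℕ) (hr : 0 < r) (d : ℕ) : ∃ C : ℕ, ∀ (G : Type) [Group G]
    (V : Type) [NormedAddCommGroup V] [InnerProductSpace ℝ V] [FiniteDimensional ℝ V],
    Module.finrank ℝ V = d → (∀ g : G, g ^ r = 1) → ∀ φ : G →* Module.End ℝ V,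
    (∀ g u, ‖φ g u‖ = ‖u‖) → φ.ker.index ≤ C := by
  let W := EuclideanSpace ℝ (Fin d)
  have hr' : (0:ℝ) < r := by exact_mod_cast hr
  have hδ : (0:ℝ) < 1 / (4 * r) := by positivity
  obtain ⟨t, -, htf, ht⟩ := (isCompact_closedBall (0 : W →L[ℝ] W) 1).finite_cover_balls hδ
  refine ⟨Nat.card t, ?_⟩
  intro G _ V _ _ _ hd hG φ hφ
  let e : V ≃ₗᵢ[ℝ] W := (stdOrthonormalBasis ℝ V).reindex (finCongr hd) |>.repr
  let Φ : G → (W →L[ℝ] W) := fun g => LinearMap.toContinuousLinearMap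
    (e.toLinearEquiv.toLinearMap ∘ₗ (φ g) ∘ₗ e.symm.toLinearEquiv.toLinearMap)
  have hΦ : ∀ g w, Φ g w = e (φ g (e.symm w)) := fun g w => rfl
  have hb : ∀ g, Φ g ∈ Metric.closedBall (0 : W →L[ℝ] W) 1 := by
    intro g
    rw [mem_closedBall_zero_iff]
    apply ContinuousLinearMap.opNorm_le_bound _ zero_le_one
    intro w
    rw [hΦ, e.norm_map, hφ, e.symm.norm_map, one_mul]
  have hc : ∀ g, ∃ c : t, dist (Φ g) c < 1 / (4 * r) := by
    intro g
    have := ht (hb g)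
    simpa using this
  choose f hf using hc
  have : Finite t := htf
  apply index_le_aux _ f
  intro g g' hgg
  rw [MonoidHom.mem_ker]
  have hd' : ‖Φ g' - Φ g‖ ≤ 1 / (2 * r) := by
    rw [← dist_eq_norm]
    have h1 := hf g
    have h2 := hf g'
    rw [← hgg] at h2
    have h3 := dist_triangle_right (Φ g') (Φ g) (f g)
    have : (1:ℝ) / (2 * r) = 1 / (4*r) + 1/(4*r) := by field_simp; norm_num
    linarith
  apply sep_aux _ (hφ _) r hr (by rw [← map_pow, hG, map_one]) (1 / (2*r)) _ (by positivity)
  · intro u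
    have h1 : φ (g⁻¹ * g') u - u = φ g⁻¹ (φ g' u - φ g u) := by
      rw [map_sub, ← Module.End.mul_apply, ← Module.End.mul_apply, ← map_mul, ← map_mul]
      simp
    rw [h1, hφ]
    have h2 : ‖φ g' u - φ g u‖ = ‖(Φ g' - Φ g) (e u)‖ := by
      rw [sub_apply, hΦ, hΦ, ← map_sub, e.norm_map]; simp
    rw [h2, ← e.norm_map u]
    exact (Φ g' - Φ g).le_of_opNorm_le hd' _
  · field_simp; norm_num

lemma spec_aux {E : Type*} [NormedAddCommGroup E] [InnerProductSpace ℝ E] [FiniteDimensional ℝ E]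
    (T : E →ₗ[ℝ] E) (hT : T.IsPositive) (ε : ℝ) :
    ∃ V : Submodule ℝ E, (∀ R : E →ₗ[ℝ] E, (∀ x, R (T x) = T (R x)) → ∀ x ∈ V, R x ∈ V) ∧
      Module.finrank ℝ V * ε ≤ LinearMap.trace ℝ E T ∧
      ∀ x ∈ Vᗮ, ‖T x‖ ^ 2 ≤ ε * inner ℝ (T x) x := by
  have hs : T.IsSymmetric := hT.isSymmetric
  let b := hs.eigenvectorBasis rfl
  let l := hs.eigenvalues rfl
  have hb : ∀ i, T (b i) = l i • b i := fun i => hs.apply_eigenvectorBasis rfl i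
  have hl : ∀ i, 0 ≤ l i := fun i => hT.nonneg_eigenvalues rfl i
  let I := {i // ε ≤ l i}
  let V := Submodule.span ℝ (Set.range fun i : I => b i)
  have hV : ∀ y, (∀ i, l i < ε → inner ℝ (b i) y = 0) → y ∈ V := by
    intro y hy
    rw [← b.sum_repr' y]
    apply Submodule.sum_mem
    intro i _
    by_cases h : ε ≤ l i
    · exact Submodule.smul_mem _ _ (Submodule.subset_span ⟨⟨i, h⟩, rfl⟩)
    · rw [hy i (not_le.1 h)]; simp
  have hc : ∀ x i, inner ℝ (b i) (T x) = l i * inner ℝ (b i) x := by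
    intro x i
    rw [← hs, hb, inner_smul_left]; simp
  refine ⟨V, ?_, ?_, ?_⟩
  · intro R hR x hx
    induction hx using Submodule.span_induction with
    | mem x h =>
      obtain ⟨⟨j, hj⟩, rfl⟩ := h
      apply hV
      intro i hi
      have h1 := hc (R (b j)) i
      rw [← hR, hb, map_smul, inner_smul_right] at h1
      have h2 : (l j - l i) * inner ℝ (b i) (R (b j)) = 0 := by linarith
      rcases mul_eq_zero.1 h2 with h3 | h3
      · linarith
      · exact h3
    | zero => simp
    | add x y _ _ hx hy => rw [map_add]; exact add_mem hx hy
    | smul a x _ hx => rw [map_smul]; exact Submodule.smul_mem _ _ hx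
  · have hli : LinearIndependent ℝ (fun i : I => b i) :=
      b.orthonormal.linearIndependent.comp _ Subtype.val_injective
    rw [finrank_span_eq_card hli, hs.trace_eq_sum_eigenvalues rfl, Fintype.card_subtype,
      ← nsmul_eq_mul]
    calc _ ≤ ∑ i with ε ≤ l i, l i := Finset.card_nsmul_le_sum _ _ _ (by simp)
      _ ≤ ∑ i, l i := Finset.sum_le_sum_of_subset_of_nonneg (Finset.subset_univ _)
          (fun i _ _ => hl i)
      _ = _ := by simp [l]
  · intro x hx
    have h0 : ∀ i, ε ≤ l i → inner ℝ (b i) x = 0 := fun i hi =>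
      (Submodule.mem_orthogonal V x).1 hx _ (Submodule.subset_span ⟨⟨i, hi⟩, rfl⟩)
    rw [← b.sum_inner_mul_inner (T x) x, ← b.sum_sq_norm_inner_right (T x), Finset.mul_sum]
    apply Finset.sum_le_sum
    intro i _
    rw [real_inner_comm (b i) (T x), hc]
    by_cases h : ε ≤ l i
    · rw [h0 i h]; simp
    · have := hl i
      rw [Real.norm_eq_abs, sq_abs]
      have h5 : 0 ≤ l i * (inner ℝ (b i) x)^2 := by positivity
      nlinarith [not_le.1 h]

lemma final_aux {E : Type*} [NormedAddCommGroup E] [InnerProductSpace ℝ E] [FiniteDimensional ℝ E]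
    (T : E →ₗ[ℝ] E) (hT : T.IsPositive) (ε : ℝ) (V : Submodule ℝ E) (hε : 0 ≤ ε)
    (hV : ∀ x ∈ V, T x ∈ V)
    (hV' : ∀ x ∈ Vᗮ, ‖T x‖ ^ 2 ≤ ε * inner ℝ (T x) x)
    (R : E →ₗ[ℝ] E) (hR : ∀ x, ‖R x‖ = ‖x‖) (hRV : ∀ x ∈ V, R x = x) (z : E)
    (hz : 2 * ε * inner ℝ (T z) z < ‖T z‖ ^ 2) : 0 < inner ℝ (R (T z)) (T z) := by
  obtain ⟨p, hp, q, hq, rfl⟩ := V.exists_add_mem_mem_orthogonal z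
  have hs : T.IsSymmetric := hT.isSymmetric
  have hTq : T q ∈ Vᗮ := by
    rw [Submodule.mem_orthogonal]
    intro u hu
    rw [← hs]
    exact (Submodule.mem_orthogonal V q).1 hq _ (hV u hu)
  have c1 : inner ℝ (T p) (T q) = 0 := (Submodule.mem_orthogonal V _).1 hTq _ (hV p hp)
  have c2 : inner ℝ (T p) q = 0 := (Submodule.mem_orthogonal V _).1 hq _ (hV p hp)
  have c3 : inner ℝ (T q) p = 0 := by
    rw [real_inner_comm]; exact (Submodule.mem_orthogonal V _).1 hTq _ hp
  have c4 : inner ℝ (R (T q)) (T p) = 0 := by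
    have h1 := hR (T q + T p)
    have h2 : ‖R (T q + T p)‖ ^ 2 = ‖T q + T p‖ ^ 2 := by rw [h1]
    rw [map_add, hRV _ (hV p hp), norm_add_sq_real, norm_add_sq_real, hR,
      real_inner_comm (T p) (T q), c1] at h2
    linarith
  have c5 : -(‖T q‖ ^ 2) ≤ inner ℝ (R (T q)) (T q) := by
    have := neg_le_of_abs_le (abs_real_inner_le_norm (R (T q)) (T q))
    rw [hR] at this
    nlinarith
  have c6 := hV' q hq
  have c7 : 0 ≤ inner ℝ (T p) p := by simpa using hT.re_inner_nonneg_left p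
  simp only [map_add, norm_add_sq_real, inner_add_left, inner_add_right, hRV _ (hV p hp),
    c1, c2, c3, c4, real_inner_self_eq_norm_sq] at hz ⊢
  nlinarith [mul_nonneg hε c7]

noncomputable def shiftHom (G : Type) [Group G] [Fintype G] :
    G →* Module.End ℝ (EuclideanSpace ℝ G) where
  toFun h :=
    { toFun := fun x => WithLp.toLp 2 (fun g => x (g * h))
      map_add' := fun x y => by ext g; simp
      map_smul' := fun c x => by ext g; simp }
  map_one' := by ext x g; simp
  map_mul' h h' := by ext x g; simp [mul_assoc]

lemma shiftHom_apply {G : Type} [Group G] [Fintype G] (h : G) (x : EuclideanSpace ℝ G) (g : G) :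
    shiftHom G h x g = x (g * h) := rfl

lemma shiftHom_norm {G : Type} [Group G] [Fintype G] (h : G) (x : EuclideanSpace ℝ G) :
    ‖shiftHom G h x‖ = ‖x‖ := by
  rw [EuclideanSpace.norm_eq, EuclideanSpace.norm_eq]
  congr 1
  simp_rw [shiftHom_apply]
  exact Fintype.sum_equiv (Equiv.mulRight h) _ _ (fun g => rfl)

lemma dense_aux (K r : ℕ) (hr : 0 < r) : ∃ C : ℕ, ∀ (G : Type) [Group G] [Fintype G]
    [DecidableEq G], (∀ g : G, g ^ r = 1) → ∀ A : Finset G, A.Nonempty →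
    Fintype.card G ≤ K * A.card →
    ∃ H : Subgroup G, H.Normal ∧ H.index ≤ C ∧ ∀ x ∈ H, x ∈ (A * A⁻¹) ^ 2 := by
  choose C hC using rep_aux r hr
  refine ⟨∑ d ∈ Finset.range (3 * K ^ 2 + 1), C d, ?_⟩
  intro G _ _ _ hG A hA hK
  set n : ℝ := ((Fintype.card G : ℕ) : ℝ) with hn
  set a : ℝ := ((A.card : ℕ) : ℝ) with ha
  have hn0 : 0 < n := by rw [hn]; exact_mod_cast Fintype.card_pos
  have ha0 : 0 < a := by rw [ha]; exact_mod_cast hA.card_pos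
  have hKa : n ≤ K * a := by rw [hn, ha]; exact_mod_cast hK
  let M : Matrix G G ℝ := fun x y => if x * y⁻¹ ∈ A then 1 else 0
  let N : Matrix G G ℝ := M * M.conjTranspose
  have hN : ∀ x y, N x y = ∑ z, M x z * M y z := by
    intro x y; simp [N, Matrix.mul_apply]
  have hMs : ∀ x y h, M (x * h) (y * h) = M x y := by
    intro x y h; simp [M, mul_assoc]
  have hNs : ∀ x y h, N (x * h) (y * h) = N x y := by
    intro x y h
    rw [hN, hN]
    refine (Fintype.sum_equiv (Equiv.mulRight h) _ _ (fun z => ?_)).symm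
    simp [hMs]
  have hrow : ∀ x, ∑ z, M x z = a := by
    intro x
    rw [← Fintype.sum_equiv ((Equiv.inv G).trans (Equiv.mulRight x)) (fun w => if w⁻¹⁻¹ ∈ A then (1:ℝ) else 0) _ (fun z => by simp [M])]
    simp [ha]
  have hcol : ∀ z, ∑ x, M x z = a := by
    intro z
    rw [← Fintype.sum_equiv (Equiv.mulRight z) (fun w => if w ∈ A then (1:ℝ) else 0) _ (fun z => by simp [M])]
    simp [ha]
  have hMM : ∀ x z, M x z * M x z = M x z := by intro x z; simp [M]
  have hdiag : ∀ x, N x x = a := by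
    intro x; rw [hN]; simp_rw [hMM]; exact hrow x
  have hNpos : ∀ x, N x 1 ≠ 0 → x ∈ A * A⁻¹ := by
    intro x hx
    rw [hN] at hx
    obtain ⟨z, -, hz⟩ := Finset.exists_ne_zero_of_sum_ne_zero hx
    have h1 : x * z⁻¹ ∈ A := by
      by_contra h; apply hz; simp [M, h]
    have h2 : 1 * z⁻¹ ∈ A := by
      by_contra h; apply hz; simp only [M, h]; simp
    have : x = (x * z⁻¹) * (1 * z⁻¹)⁻¹ := by group
    rw [this]
    exact Finset.mul_mem_mul h1 (Finset.inv_mem_inv h2)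
  let T := Matrix.toEuclideanLin N
  have hT : T.IsPositive :=
    Matrix.isPositive_toEuclideanLin_iff.2 (Matrix.posSemidef_self_mul_conjTranspose M)
  have hTa : ∀ x g, T x g = ∑ y, N g y * x y := by
    intro x g; rfl
  have htr : LinearMap.trace ℝ _ T = n * a := by
    rw [LinearMap.trace_eq_sum_inner T (EuclideanSpace.basisFun G ℝ)]
    have : ∀ i, inner ℝ ((EuclideanSpace.basisFun G ℝ) i) (T ((EuclideanSpace.basisFun G ℝ) i)) = a := by
      intro i
      rw [← hdiag i]
      simp [EuclideanSpace.inner_single_left, hTa]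
    rw [Finset.sum_congr rfl (fun i _ => this i)]
    simp [hn]
  have hcomm : ∀ h x, shiftHom G h (T x) = T (shiftHom G h x) := by
    intro h x
    ext g
    rw [shiftHom_apply, hTa, hTa]
    refine (Fintype.sum_equiv (Equiv.mulRight h) _ _ (fun z => ?_)).symm
    simp [hNs, shiftHom_apply]
  let ε : ℝ := a ^ 3 / (3 * n)
  have hε : 0 < ε := by positivity
  obtain ⟨V, hV1, hV2, hV3⟩ := spec_aux T hT ε
  have hdim : Module.finrank ℝ V ≤ 3 * K ^ 2 := by
    rw [htr] at hV2
    have h1 : (Module.finrank ℝ V : ℝ) * a ^ 3 ≤ n * a * (3 * n) := by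
      have := mul_le_mul_of_nonneg_right hV2 (by positivity : 0 ≤ 3 * n)
      have e : (Module.finrank ℝ V : ℝ) * ε * (3 * n) = Module.finrank ℝ V * a ^ 3 := by
        simp only [ε]; field_simp
      linarith
    have h2 : n * a * (3 * n) ≤ (3 * K ^ 2 : ℝ) * a ^ 3 := by
      have : n * n ≤ (K * a) * (K * a) := by gcongr
      nlinarith
    have h3 : (Module.finrank ℝ V : ℝ) ≤ 3 * K ^ 2 :=
      le_of_mul_le_mul_right (h1.trans h2) (by positivity)
    exact_mod_cast h3
  have hinv : ∀ h, ∀ x ∈ V, shiftHom G h x ∈ V := fun h => hV1 _ (hcomm h)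
  let φ : G →* Module.End ℝ V :=
    { toFun := fun h => (shiftHom G h).restrict (hinv h)
      map_one' := by ext x; simp
      map_mul' := by intro h h'; ext x; simp }
  have hφ : ∀ g u, ‖φ g u‖ = ‖u‖ := fun g u => shiftHom_norm g u
  refine ⟨φ.ker, inferInstance, ?_, ?_⟩
  · refine (hC _ G V rfl hG φ hφ).trans ?_
    exact Finset.single_le_sum (f := C) (fun _ _ => Nat.zero_le _) (Finset.mem_range.2 (by omega))
  · intro h hh
    have hfix : ∀ x ∈ V, shiftHom G h x = x := by
      intro x hx
      have := congrArg (fun f : Module.End ℝ V => ((f ⟨x, hx⟩ : V) : EuclideanSpace ℝ G))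
        (MonoidHom.mem_ker.1 hh)
      exact this
    let z : EuclideanSpace ℝ G := EuclideanSpace.single 1 1
    have hTz : ∀ g, T z g = N g 1 := by
      intro g; rw [hTa]; simp [z]
    have hz1 : inner ℝ (T z) z = a := by
      simp [z, EuclideanSpace.inner_single_right, ← hdiag 1]
      simpa [z] using hTz 1
    have hsum : ∑ g, N g 1 = a ^ 2 := by
      simp_rw [hN]
      rw [Finset.sum_comm]
      simp_rw [← Finset.sum_mul, hcol, ← Finset.mul_sum, hrow]
      ring
    have hz2 : a ^ 4 / n ≤ ‖T z‖ ^ 2 := by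
      rw [EuclideanSpace.norm_sq_eq]
      simp_rw [hTz, Real.norm_eq_abs, sq_abs]
      have := sq_sum_le_card_mul_sum_sq (s := Finset.univ) (f := fun g => N g 1)
      rw [hsum, Finset.card_univ] at this
      rw [div_le_iff₀ hn0]
      nlinarith
    have hpos := final_aux T hT ε V hε.le (hV1 T (fun _ => rfl)) hV3 (shiftHom G h)
      (shiftHom_norm h) hfix z (by
        rw [hz1]
        refine lt_of_lt_of_le ?_ hz2
        simp only [ε]
        rw [lt_div_iff₀ hn0]
        have : 2 * (a ^ 3 / (3 * n)) * a * n = 2 / 3 * a ^ 4 := by field_simp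
        rw [this]
        have : 0 < a ^ 4 := by positivity
        linarith)
    rw [PiLp.inner_apply] at hpos
    obtain ⟨g, -, hg⟩ := Finset.exists_ne_zero_of_sum_ne_zero hpos.ne'
    rw [shiftHom_apply, hTz, hTz] at hg
    have h1 := hNpos (g * h) (by intro h0; apply hg; simp [h0])
    have h2 := hNpos g (by intro h0; apply hg; simp [h0])
    have h3 : g⁻¹ ∈ A * A⁻¹ := by
      have := Finset.inv_mem_inv h2
      simpa [mul_inv_rev] using this
    have : h = g⁻¹ * (g * h) := by group
    rw [this, pow_two]
    exact Finset.mul_mem_mul h3 h1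

lemma word_aux {G : Type} [Group G] [DecidableEq G] (k m : ℕ) (hk : 0 < k) (A : Finset G)
    (hA : A.Nonempty) (h : (A ^ 3).card ≤ k * A.card) :
    ∀ j n : ℕ, 3 ≤ n → j + n ≤ m + 3 → ∀ ε : Fin n → ℤ, (∀ i, |ε i| = 1) →
    (((List.finRange n).map fun i ↦ A ^ ε i).prod * (A ∪ A⁻¹ ∪ (1 : Finset G)) ^ j).card
      ≤ 3 ^ j * (k ^ (3 * (m + 1)) * A.card) := by
  intro j
  induction j with
  | zero =>
    intro n hn hjn ε hε
    have h1 := Finset.small_alternating_pow_of_small_tripling (K := (k : ℝ)) hn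
      (by exact_mod_cast h) ε hε
    have h2 : k ^ (3 * (n - 2)) ≤ k ^ (3 * (m + 1)) := Nat.pow_le_pow_right hk (by omega)
    have h3 : ((List.finRange n).map fun i ↦ A ^ ε i).prod.card ≤ k ^ (3 * (n - 2)) * A.card := by
      exact_mod_cast h1
    simpa using h3.trans (Nat.mul_le_mul_right _ h2)
  | succ j ih =>
    intro n hn hjn ε hε
    set B := A ∪ A⁻¹ ∪ (1 : Finset G) with hB
    have key : ∀ e : ℤ, |e| = 1 →
        (((List.finRange n).map fun i ↦ A ^ ε i).prod * (A ^ e * B ^ j)).card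
          ≤ 3 ^ j * (k ^ (3 * (m + 1)) * A.card) := by
      intro e he
      have := ih (n + 1) (by omega) (by omega) (Fin.snoc ε e) (by
        intro i
        refine Fin.lastCases ?_ (fun i => ?_) i
        · simpa using he
        · simpa using hε i)
      rw [List.finRange_succ_last] at this
      simpa [Function.comp_def, mul_assoc] using this
    have k1 := key 1 (by simp)
    have k2 := key (-1) (by simp)
    have k3 := ih n hn (by omega) ε hε
    simp only [zpow_one, zpow_neg] at k1 k2
    set P := ((List.finRange n).map fun i ↦ A ^ ε i).prod
    have e : P * B ^ (j + 1) = P * (A * B ^ j) ∪ P * (A⁻¹ * B ^ j) ∪ P * B ^ j := by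
      rw [pow_succ']
      nth_rewrite 1 [hB]
      rw [Finset.union_mul, Finset.union_mul, Finset.mul_union, Finset.mul_union, one_mul]
    rw [e]
    refine (Finset.card_union_le _ _).trans ?_
    have := Finset.card_union_le (P * (A * B ^ j)) (P * (A⁻¹ * B ^ j))
    rw [pow_succ]
    linarith

theorem small_tripling_bounded_exponent_normal (k m r : ℕ) (hk : 0 < k) (hm : 0 < m)
    (hr : 0 < r) :
    ∃ C : ℕ, ∀ (G : Type) [Group G] [DecidableEq G],
      ∀ A : Finset G, A.Nonempty →
      (A ^ 3).card ≤ k * A.card →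
      (∀ x ∈ Subgroup.closure (A : Set G), x ^ r = 1) →
      ((Subgroup.closure (A : Set G) : Set G)
        = (((A ∪ A⁻¹ ∪ (1 : Finset G)) ^ m : Finset G) : Set G)) →
      ∃ H : Subgroup ↥(Subgroup.closure (A : Set G)),
        H.Normal ∧ H.index ≤ C ∧
        (∀ x : ↥(Subgroup.closure (A : Set G)),
          x ∈ H → (x : G) ∈ ((A * A⁻¹) ^ 2 : Finset G)) := by
  obtain ⟨C, hC⟩ := dense_aux (3 ^ m * k ^ (3 * (m + 1))) r hr
  refine ⟨C, ?_⟩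
  intro G _ _ A hA h3 hexp hgen
  have hcard : ((A ∪ A⁻¹ ∪ (1 : Finset G)) ^ m).card ≤ 3 ^ m * k ^ (3 * (m + 1)) * A.card := by
    have h1 := word_aux k m hk A hA h3 m 3 le_rfl le_rfl (fun _ => 1) (by simp)
    rw [mul_assoc]
    refine le_trans ?_ h1
    apply Finset.card_le_card_mul_left
    simpa using hA
  set S := Subgroup.closure (A : Set G) with hS
  have hfin : (S : Set G).Finite := by rw [hgen]; exact Finset.finite_toSet _
  have : Finite S := hfin
  let _ : Fintype S := Fintype.ofFinite S
  let A' : Finset S := A.preimage (↑) Subtype.val_injective.injOn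
  have hA' : A'.image (S.subtype) = A := by
    ext x
    simp only [Finset.mem_image, A', Finset.mem_preimage, Subgroup.subtype_apply]
    constructor
    · rintro ⟨y, hy, rfl⟩; exact hy
    · intro hx; exact ⟨⟨x, Subgroup.subset_closure hx⟩, hx, rfl⟩
  have hA'c : A'.card = A.card := by
    rw [← hA', Finset.card_image_of_injective _ S.subtype_injective]
  have hSc : Fintype.card S = ((A ∪ A⁻¹ ∪ (1 : Finset G)) ^ m).card := by
    rw [← Nat.card_eq_fintype_card, ← Set.ncard_coe_finset, ← hgen]; rfl
  obtain ⟨H, hH1, hH2, hH3⟩ := hC S (fun g => Subtype.ext (by simpa using hexp g g.2)) A'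
    (by rw [← Finset.card_pos, hA'c]; exact hA.card_pos) (by rw [hSc, hA'c]; exact hcard)
  refine ⟨H, hH1, hH2, fun x hx => ?_⟩
  have h5 : S.subtype x ∈ ((A' * A'⁻¹) ^ 2).image S.subtype := Finset.mem_image_of_mem _ (hH3 x hx)
  rw [pow_two, Finset.image_mul, Finset.image_mul, Finset.image_inv, hA'] at h5
  rw [pow_two]
  exact h5
end

section
/- For all positive integers k and m there is a constant C = C(k, m) such that the following holds. If G is a group and A ⊆ G is a nonempty finite set with |AA⁻¹A| ≤ k|A| and ⟨AA⁻¹⟩ = (AA⁻¹)ᵐ, then there are a normal subgroup H of ⟨AA⁻¹⟩ with [⟨AA⁻¹⟩ : H] ≤ C, and a (δ, n)-Bohr neighborhood B in H with δ⁻¹ ≤ C and n ≤ C, such that B ⊆ (AA⁻¹)². Moreover, if ⟨AA⁻¹⟩ is abelian, then one may take H = ⟨AA⁻¹⟩. -/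
open Pointwise

/-- The `n`-dimensional torus `(ℝ/ℤ)ⁿ`. -/
abbrev Torus (n : ℕ) : Type := Fin n → AddCircle (1 : ℝ)

/-- `B` is a `(δ, n)`-Bohr neighborhood in the group `H`: there is a homomorphism
`τ : H → 𝕋ⁿ` with `B = {x ∈ H : d(0, τ(x)) < δ}`. -/
def IsBohrNbhd {H : Type*} [Group H] (δ : ℝ) (n : ℕ) (B : Set H) : Prop :=
  ∃ τ : H →* Multiplicative (Torus n),
    B = {x : H | dist (0 : Torus n) (Multiplicative.toAdd (τ x)) < δ}

theorem brs_growth {G : Type*} [Group G] [DecidableEq G] (A : Finset G) (hA : A.Nonempty) (k : ℕ)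
    (h : (A * A⁻¹ * A).card ≤ k * A.card) (n : ℕ) :
    ((A * A⁻¹) ^ n * A).card ≤ (k ^ 2) ^ n * A.card := by
  have hpos : 0 < A.card := hA.card_pos
  have h1 : (A⁻¹ * A * A⁻¹).card ≤ k * A.card := by
    have : (A * A⁻¹ * A)⁻¹ = A⁻¹ * A * A⁻¹ := by simp [mul_inv_rev, mul_assoc]
    rw [← this, Finset.card_inv]; exact h
  have h4 : (A⁻¹ * A * (A⁻¹ * A)).card ≤ k ^ 2 * A.card := by
    have := Finset.ruzsa_triangle_inequality_mulInv_mulInv_mulInv (A⁻¹ * A) A (A⁻¹ * A)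
    have e : (A⁻¹ * A)⁻¹ = A⁻¹ * A := by simp [mul_inv_rev]
    rw [e] at this
    have h2 : (A⁻¹ * A * (A⁻¹ * A)).card * A.card ≤ (k * A.card) * (k * A.card) :=
      this.trans (Nat.mul_le_mul h1 h1)
    nlinarith
  induction n with
  | zero => simp
  | succ n ih =>
    have := Finset.ruzsa_triangle_inequality_mulInv_mulInv_mulInv ((A * A⁻¹) ^ n) A⁻¹ (A * A⁻¹ * A)⁻¹
    simp only [inv_inv, Finset.card_inv] at this
    have e : (A * A⁻¹ * A)⁻¹ * A = A⁻¹ * A * (A⁻¹ * A) := by simp [mul_inv_rev, mul_assoc]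
    have e2 : (A * A⁻¹) ^ (n+1) * A = (A * A⁻¹) ^ n * (A * A⁻¹ * A) := by
      rw [pow_succ, mul_assoc]
    rw [e] at this
    rw [e2]
    have h3 := this.trans (Nat.mul_le_mul ih h4)
    refine Nat.le_of_mul_le_mul_right (h3.trans (le_of_eq ?_)) hpos
    ring

theorem brs_card {G : Type*} [Group G] [DecidableEq G] (A : Finset G) (hA : A.Nonempty) (k : ℕ)
    (h : (A * A⁻¹ * A).card ≤ k * A.card) (n : ℕ) :
    ((A * A⁻¹) ^ n).card ≤ (k ^ 2) ^ n * A.card :=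
  (Finset.card_le_card_mul_right hA).trans (brs_growth A hA k h n)

section
set_option linter.unusedSectionVars false
variable {Γ : Type*} [Group Γ] [Finite Γ] {V : Type*} [NormedAddCommGroup V]
  [InnerProductSpace ℂ V] [FiniteDimensional ℂ V] (ρ : Γ →* (V →L[ℂ] V))

theorem brs_inner (hρ : ∀ g v, ‖ρ g v‖ = ‖v‖) (g : Γ) (v w : V) :
    inner ℂ (ρ g v) (ρ g w) = inner ℂ v w :=
  LinearIsometry.inner_map_map (⟨(ρ g : V →ₗ[ℂ] V), hρ g⟩ : V →ₗᵢ[ℂ] V) v w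

theorem brs_inv_apply (g : Γ) (v : V) : ρ g⁻¹ (ρ g v) = v := by
  rw [← mul_apply_eq_comp, ← map_mul]; simp

theorem brs_apply_inv (g : Γ) (v : V) : ρ g (ρ g⁻¹ v) = v := by
  rw [← mul_apply_eq_comp, ← map_mul]; simp

theorem brs_comm_inv (x : V →L[ℂ] V) (c : Γ) (h : Commute x (ρ c)) : Commute x (ρ c⁻¹) := by
  have h1 : ρ c * ρ c⁻¹ = 1 := by rw [← map_mul]; simp
  have h2 : ρ c⁻¹ * ρ c = 1 := by rw [← map_mul]; simp
  show x * ρ c⁻¹ = ρ c⁻¹ * x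
  calc x * ρ c⁻¹ = ρ c⁻¹ * ρ c * (x * ρ c⁻¹) := by rw [h2, one_mul]
    _ = ρ c⁻¹ * (ρ c * x) * ρ c⁻¹ := by noncomm_ring
    _ = ρ c⁻¹ * x * (ρ c * ρ c⁻¹) := by rw [← h.eq]; noncomm_ring
    _ = ρ c⁻¹ * x := by rw [h1, mul_one]

theorem brs_eig_orth (hρ : ∀ g v, ‖ρ g v‖ = ‖v‖) (g : Γ) (v w : V) (lam mu : ℂ)
    (hv : ρ g v = lam • v) (hw : ρ g w = mu • w) (hne : lam ≠ mu) : inner ℂ v w = 0 := by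
  by_cases hv0 : v = 0
  · simp [hv0]
  have hl : ‖lam‖ = 1 := by
    have := hρ g v
    rw [hv, norm_smul] at this
    have h0 : ‖v‖ ≠ 0 := by simpa using hv0
    field_simp at this; exact this
  have h := brs_inner ρ hρ g v w
  rw [hv, hw, inner_smul_left, inner_smul_right] at h
  have h1 : (starRingEnd ℂ) lam * lam = 1 := by
    rw [mul_comm, Complex.mul_conj, Complex.normSq_eq_norm_sq, hl]; simp
  have h2 : (mu - lam) * inner ℂ v w = 0 := by
    linear_combination lam * h - mu * inner ℂ v w * h1
  rcases mul_eq_zero.1 h2 with h3 | h3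
  · exact absurd (sub_eq_zero.1 h3).symm hne
  · exact h3

/-- key lemma -/
theorem brs_key (hρ : ∀ g v, ‖ρ g v‖ = ‖v‖) (a b : Γ) (hb : ‖ρ b - 1‖ < 1 / 2)
    (hc : Commute (ρ a) (ρ (b * a * b⁻¹))) : ρ a = ρ (b * a * b⁻¹) := by
  set c := b * a * b⁻¹ with hcdef
  set u := ρ (a * c⁻¹) with hu
  have hcc : Commute (ρ a) (ρ c⁻¹) := brs_comm_inv ρ _ _ hc
  have hau : Commute (ρ a) u := by
    rw [hu, map_mul]; exact (Commute.refl _).mul_right hcc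
  by_contra hne
  have hu1 : u ≠ 1 := by
    intro h
    apply hne
    calc ρ a = u * ρ c := by rw [hu, ← map_mul]; congr 1; group
      _ = ρ c := by rw [h, one_mul]
  -- a nonzero eigenvalue of u - 1
  let U : Module.End ℂ V := (u : V →ₗ[ℂ] V)
  have hss : U.IsSemisimple := by
    have hn : Nat.card Γ ≠ 0 := Nat.card_pos.ne'
    refine Module.End.isSemisimple_of_squarefree_aeval_eq_zero (p := Polynomial.X ^ (Nat.card Γ) - 1)
      ((Polynomial.X_pow_sub_one_separable_iff.2 (by exact_mod_cast hn)).squarefree) ?_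
    have : u ^ (Nat.card Γ) = 1 := by rw [hu, ← map_pow, pow_card_eq_one']; simp
    have h2 : U ^ (Nat.card Γ) = 1 := by
      ext v
      have := congrArg (fun f : V →L[ℂ] V => f v) this
      simpa [U, Module.End.pow_apply] using this
    simp [h2]
  have htop := (hss.iSup_maxGenEigenspace_eq_top_iff).1 (Module.End.iSup_maxGenEigenspace_eq_top U)
  obtain ⟨nu, hnu, hE⟩ : ∃ nu : ℂ, nu ≠ 1 ∧ U.eigenspace nu ≠ ⊥ := by
    by_contra hcon
    push Not at hcon
    apply hu1
    have : U.eigenspace 1 = ⊤ := by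
      rw [eq_top_iff, ← htop]
      refine iSup_le fun μ => ?_
      by_cases h : μ = 1
      · rw [h]
      · rw [hcon μ h]; exact bot_le
    ext v
    have hv : v ∈ U.eigenspace 1 := by rw [this]; trivial
    simpa [Module.End.mem_eigenspace_iff, U] using hv
  have hmaps : ∀ v ∈ U.eigenspace nu, (ρ a : V →ₗ[ℂ] V) v ∈ U.eigenspace nu := by
    intro v hv
    rw [Module.End.mem_eigenspace_iff] at hv ⊢
    have hv' : u v = nu • v := hv
    show u (ρ a v) = nu • ρ a v
    rw [← mul_apply_eq_comp, ← hau.eq, mul_apply_eq_comp, hv', map_smul]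
  have : Nontrivial (U.eigenspace nu) := Submodule.nontrivial_iff_ne_bot.2 hE
  obtain ⟨lam, hlam⟩ := Module.End.exists_eigenvalue ((ρ a : V →ₗ[ℂ] V).restrict hmaps)
  obtain ⟨⟨w, hwE⟩, hw⟩ := hlam.exists_hasEigenvector
  have hw0 : w ≠ 0 := by
    intro h; apply hw.2; ext; exact h
  have haw : ρ a w = lam • w := by
    have := congrArg Subtype.val hw.apply_eq_smul
    simpa using this
  have huw : u w = nu • w := by
    rw [Module.End.mem_eigenspace_iff] at hwE; exact hwE
  have hl0 : lam ≠ 0 := by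
    intro h
    have h1 := hρ a w
    rw [haw, h] at h1
    simp at h1
    exact hw0 (norm_eq_zero.1 h1.symm)
  have hn0 : nu ≠ 0 := by
    intro h
    have h1 := hρ (a * c⁻¹) w
    rw [← hu, huw, h] at h1
    simp at h1
    exact hw0 (norm_eq_zero.1 h1.symm)
  have hcw : ρ c w = (lam * nu⁻¹) • w := by
    have h1 : ρ a w = u (ρ c w) := by
      rw [hu, ← mul_apply_eq_comp, ← map_mul]; congr 2; group
    have h2 : u (ρ c w) = ρ c (u w) := by
      have e : u * ρ c = ρ c * u := by
        have e1 : ρ c * u = ρ c * ρ a * ρ c⁻¹ := by rw [hu, map_mul ρ a, mul_assoc]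
        rw [e1, ← hc.eq, hu, ← map_mul, ← map_mul, ← map_mul]; congr 1; group
      rw [← mul_apply_eq_comp, e, mul_apply_eq_comp]
    rw [h2, huw, map_smul, haw] at h1
    rw [mul_comm, mul_smul, h1, smul_smul, inv_mul_cancel₀ hn0, one_smul]
  set v := ρ b⁻¹ w with hv
  have hbv : ρ b v = w := brs_apply_inv ρ b w
  have hav : ρ a v = (lam * nu⁻¹) • v := by
    have : ρ a v = ρ b⁻¹ (ρ c w) := by
      rw [hv, ← mul_apply_eq_comp, ← mul_apply_eq_comp, ← map_mul, ← map_mul, hcdef]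
      congr 2; group
    rw [this, hcw, map_smul]
  have hne' : lam ≠ lam * nu⁻¹ := by
    intro h
    apply hnu
    field_simp at h
    exact h
  have horth := brs_eig_orth ρ hρ a w v _ _ haw hav hne'
  have hnorm : ‖v‖ = ‖w‖ := hρ _ _
  have hle : ‖w - v‖ ≤ 1 / 2 * ‖v‖ := by
    have h1 := (ρ b - 1).le_opNorm v
    have h2 : (ρ b - 1) v = w - v := by simp [hbv]
    rw [h2] at h1
    exact h1.trans (mul_le_mul_of_nonneg_right hb.le (norm_nonneg _))
  have hsq := norm_sub_sq (𝕜 := ℂ) w v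
  rw [horth] at hsq
  simp only [map_zero, mul_zero, sub_zero] at hsq
  have hwp : 0 < ‖w‖ := norm_pos_iff.2 hw0
  rw [hnorm] at hsq hle
  have : ‖w - v‖ ^ 2 ≤ (1 / 2 * ‖w‖) ^ 2 := by gcongr
  nlinarith

theorem brs_norm_mul (hρ : ∀ g v, ‖ρ g v‖ = ‖v‖) (g : Γ) (T : V →L[ℂ] V) : ‖ρ g * T‖ = ‖T‖ := by
  apply le_antisymm
  · refine ContinuousLinearMap.opNorm_le_bound _ (norm_nonneg _) fun v => ?_
    rw [mul_apply_eq_comp, hρ]; exact T.le_opNorm v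
  · refine ContinuousLinearMap.opNorm_le_bound _ (norm_nonneg _) fun v => ?_
    rw [← hρ g]; exact (ρ g * T).le_opNorm v

theorem brs_norm_le (hρ : ∀ g v, ‖ρ g v‖ = ‖v‖) (g : Γ) : ‖ρ g‖ ≤ 1 :=
  ContinuousLinearMap.opNorm_le_bound _ zero_le_one fun v => by rw [hρ, one_mul]

theorem brs_norm_mul_right (hρ : ∀ g v, ‖ρ g v‖ = ‖v‖) (g : Γ) (T : V →L[ℂ] V) :
    ‖T * ρ g‖ ≤ ‖T‖ := by
  refine (norm_mul_le _ _).trans ?_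
  exact mul_le_of_le_one_right (norm_nonneg _) (brs_norm_le ρ hρ g)

theorem brs_commutator (hρ : ∀ g v, ‖ρ g v‖ = ‖v‖) (a b : Γ) :
    ‖ρ (a * b * a⁻¹ * b⁻¹) - 1‖ ≤ 2 * ‖ρ a - 1‖ * ‖ρ b - 1‖ := by
  have e : ρ (a * b * a⁻¹ * b⁻¹) - 1 =
      ((ρ a - 1) * (ρ b - 1) - (ρ b - 1) * (ρ a - 1)) * ρ (a⁻¹ * b⁻¹) := by
    have e1 : (ρ a - 1) * (ρ b - 1) - (ρ b - 1) * (ρ a - 1) = ρ (a * b) - ρ (b * a) := by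
      rw [map_mul, map_mul]; noncomm_ring
    rw [e1, sub_mul, ← map_mul, ← map_mul, ← map_one ρ]
    congr 2 <;> group
  rw [e]
  refine (brs_norm_mul_right ρ hρ _ _).trans ?_
  refine (norm_sub_le _ _).trans ?_
  have h1 := norm_mul_le (ρ a - 1) (ρ b - 1)
  have h2 := norm_mul_le (ρ b - 1) (ρ a - 1)
  linarith

theorem brs_commute (hρ : ∀ g v, ‖ρ g v‖ = ‖v‖) (a b : Γ) (ha : ‖ρ a - 1‖ < 1 / 2)
    (hb : ‖ρ b - 1‖ < 1 / 2) : Commute (ρ a) (ρ b) := by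
  by_contra hcon
  let S : Set Γ := {b | ‖ρ b - 1‖ < 1 / 2 ∧ ¬ Commute (ρ a) (ρ b)}
  obtain ⟨b, ⟨hb, hn⟩, hmin⟩ := Set.exists_min_image S (fun b => ‖ρ b - 1‖) (Set.toFinite _)
    ⟨b, hb, hcon⟩
  have hbpos : 0 < ‖ρ b - 1‖ := by
    rw [norm_pos_iff, sub_ne_zero]
    intro h; rw [h] at hn; exact hn (Commute.one_right _)
  have hlt : ‖ρ (a * b * a⁻¹ * b⁻¹) - 1‖ < ‖ρ b - 1‖ := by
    refine (brs_commutator ρ hρ a b).trans_lt ?_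
    nlinarith
  have hcomm : Commute (ρ a) (ρ (a * b * a⁻¹ * b⁻¹)) := by
    by_contra h
    exact absurd (hmin _ ⟨hlt.trans hb, h⟩) (not_le.2 hlt)
  have h2 : Commute (ρ a) (ρ (b * a * b⁻¹)) := by
    -- x = a * y⁻¹, with y = b a b⁻¹
    show ρ a * _ = _ * ρ a
    set y := b * a * b⁻¹ with hy
    have ex : a * b * a⁻¹ * b⁻¹ = a * y⁻¹ := by rw [hy]; group
    rw [ex] at hcomm
    have h3 : ρ (a * (a * y⁻¹)) = ρ (a * y⁻¹ * a) := by
      rw [map_mul, map_mul ρ (a * y⁻¹) a]; exact hcomm.eq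
    calc ρ a * ρ y = ρ (y * a⁻¹) * ρ (a * y⁻¹ * a) * ρ y := by
          rw [← map_mul, ← map_mul, ← map_mul]; congr 1; group
      _ = ρ (y * a⁻¹) * ρ (a * (a * y⁻¹)) * ρ y := by rw [h3]
      _ = ρ y * ρ a := by
          rw [← map_mul, ← map_mul, ← map_mul]; congr 1; group
  have h3 := brs_key ρ hρ a b hb h2
  apply hn
  show ρ a * ρ b = ρ b * ρ a
  rw [h3, ← map_mul]
  conv_rhs => rw [← h3]
  rw [← map_mul]; congr 1; group

theorem brs_jordan (hρ : ∀ g v, ‖ρ g v‖ = ‖v‖) :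
    ∃ H : Subgroup Γ, H.Normal ∧ H.index ≤ 5 ^ (2 * (Module.finrank ℂ V) ^ 2) ∧
      ∀ x ∈ H, ∀ y ∈ H, Commute (ρ x) (ρ y) := by
  let S : Set Γ := {g | ‖ρ g - 1‖ < 1 / 2}
  refine ⟨Subgroup.closure S, ?_, ?_, ?_⟩
  · refine ⟨fun n hn g => ?_⟩
    induction hn using Subgroup.closure_induction with
    | mem y hy =>
      apply Subgroup.subset_closure
      show ‖ρ (g * y * g⁻¹) - 1‖ < 1 / 2
      have e : ρ (g * y * g⁻¹) - 1 = ρ g * ((ρ y - 1) * ρ g⁻¹) := by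
        rw [sub_mul, mul_sub, ← map_mul, ← map_mul, one_mul, ← map_mul, ← map_one ρ]
        congr 2 <;> group
      rw [e, brs_norm_mul ρ hρ]
      exact (brs_norm_mul_right ρ hρ _ _).trans_lt hy
    | one => simp [one_mem]
    | mul a b _ _ ha hb => have := mul_mem ha hb; simpa [mul_assoc] using this
    | inv a _ ha => have := inv_mem ha; simpa [mul_assoc] using this
  · classical
    set H := Subgroup.closure S
    have : Fintype (Γ ⧸ H) := Fintype.ofFinite _
    rw [Subgroup.index_eq_card, Nat.card_eq_fintype_card]
    let φ : Γ ⧸ H → (V →L[ℂ] V) := fun q => (2 : ℂ) • ρ q.out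
    have hsep : ∀ p q, p ≠ q → 1 ≤ ‖φ p - φ q‖ := by
      intro p q hpq
      by_contra hlt
      push Not at hlt
      apply hpq
      rw [← p.out_eq', ← q.out_eq']
      refine (QuotientGroup.eq).2 (Subgroup.subset_closure ?_)
      show ‖ρ _ - 1‖ < 1 / 2
      have e : φ p - φ q = (2 : ℂ) • (ρ p.out * (1 - ρ (p.out⁻¹ * q.out))) := by
        rw [mul_sub, ← map_mul]; simp [φ, smul_sub]
      rw [e, norm_smul, brs_norm_mul ρ hρ, norm_sub_rev] at hlt
      simp at hlt
      simp
      linarith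
    have hinj : Function.Injective φ := by
      intro p q h
      by_contra hne
      have := hsep p q hne
      rw [h] at this; norm_num at this
    have := Besicovitch.card_le_of_separated (Finset.univ.image φ) (by
      intro c hc
      obtain ⟨q, -, rfl⟩ := Finset.mem_image.1 hc
      have := brs_norm_le ρ hρ q.out
      simp only [φ, norm_smul]; norm_num; linarith) (by
      intro c hc d hd hne
      obtain ⟨p, -, rfl⟩ := Finset.mem_image.1 hc
      obtain ⟨q, -, rfl⟩ := Finset.mem_image.1 hd
      exact hsep _ _ fun h => hne (by rw [h]))
    rw [Finset.card_image_of_injective _ hinj, Finset.card_univ] at this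
    refine this.trans (le_of_eq ?_)
    congr 1
    have e1 := (LinearMap.toContinuousLinearMap (𝕜 := ℂ) (E := V) (F' := V)).finrank_eq
    rw [← Module.finrank_mul_finrank ℝ ℂ (V →L[ℂ] V), ← e1, Module.finrank_linearMap,
      Complex.finrank_real_complex]
    ring
  · intro x hx y hy
    have h1 : ∀ s ∈ S, ∀ y ∈ Subgroup.closure S, Commute (ρ s) (ρ y) := by
      intro s hs y hy
      induction hy using Subgroup.closure_induction with
      | mem y hy => exact brs_commute ρ hρ s y hs hy
      | one => rw [map_one]; exact Commute.one_right _
      | mul a b _ _ ha hb => rw [map_mul]; exact ha.mul_right hb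
      | inv a _ ha => exact brs_comm_inv ρ _ _ ha
    symm
    induction hx using Subgroup.closure_induction with
    | mem x hx => exact (h1 x hx y hy).symm
    | one => rw [map_one]; exact Commute.one_right _
    | mul a b _ _ ha hb => rw [map_mul]; exact ha.mul_right hb
    | inv a _ ha => exact brs_comm_inv ρ _ _ ha
end

theorem brs_toCircle_norm (t : AddCircle (1 : ℝ)) :
    ‖(AddCircle.toCircle t : ℂ) - 1‖ ≤ 2 * Real.pi * ‖t‖ := by
  obtain ⟨y, rfl⟩ := QuotientAddGroup.mk_surjective t
  have e : ((y - round y : ℝ) : AddCircle (1:ℝ)) = (y : AddCircle (1:ℝ)) := by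
    rw [AddCircle.coe_sub]
    have : ((round y : ℝ) : AddCircle (1:ℝ)) = 0 := by
      rw [AddCircle.coe_eq_zero_iff]; exact ⟨round y, by simp⟩
    rw [this, sub_zero]
  have h2 : ‖(y : AddCircle (1:ℝ))‖ = |y - round y| := by
    rw [AddCircle.norm_eq]; simp
  show ‖(AddCircle.toCircle (y : AddCircle (1:ℝ)) : ℂ) - 1‖ ≤ 2 * Real.pi * ‖(y : AddCircle (1:ℝ))‖
  rw [h2, ← e, AddCircle.toCircle_apply_mk, Circle.coe_exp, mul_comm _ Complex.I]
  refine Real.norm_exp_I_mul_ofReal_sub_one_le.trans (le_of_eq ?_)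
  rw [Real.norm_eq_abs, abs_mul, abs_of_pos (by positivity)]; simp

theorem brs_exists_char : ∃ e : Circle →* Multiplicative (AddCircle (1:ℝ)),
    ∀ z, AddCircle.toCircle (Multiplicative.toAdd (e z)) = z := by
  have h1 : (1:ℝ) ≠ 0 := one_ne_zero
  let E := AddCircle.homeomorphCircle h1
  have hE : ∀ z, AddCircle.toCircle (E.symm z) = z := fun z => by
    rw [← AddCircle.homeomorphCircle_apply h1]; exact E.apply_symm_apply z
  refine ⟨MonoidHom.mk' (fun z => Multiplicative.ofAdd (E.symm z)) ?_, ?_⟩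
  · intro a b
    rw [← ofAdd_add]
    congr 1
    apply AddCircle.injective_toCircle h1
    rw [AddCircle.toCircle_add, hE, hE, hE]
  · intro z; exact hE z

theorem brs_diag {Γ : Type*} [Group Γ] [Finite Γ] {V : Type*} [NormedAddCommGroup V]
    [InnerProductSpace ℂ V] [FiniteDimensional ℂ V] (ρ : Γ →* (V →L[ℂ] V))
    (hρ : ∀ g v, ‖ρ g v‖ = ‖v‖) (hc : ∀ x y, Commute (ρ x) (ρ y)) :
    ∃ τ : Γ →* Multiplicative (Torus (Module.finrank ℂ V + 1)),
      ∀ x, dist (0 : Torus (Module.finrank ℂ V + 1)) (Multiplicative.toAdd (τ x)) < 1 / 16 →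
        ∀ v : V, 1 / 2 * ‖v‖ ^ 2 ≤ (inner ℂ v (ρ x v)).re := by
  classical
  let f : Γ → Module.End ℂ V := fun g => (ρ g : V →ₗ[ℂ] V)
  have hss : ∀ g, (f g).IsSemisimple := by
    intro g
    have hn : Nat.card Γ ≠ 0 := Nat.card_pos.ne'
    refine Module.End.isSemisimple_of_squarefree_aeval_eq_zero (p := Polynomial.X ^ (Nat.card Γ) - 1)
      ((Polynomial.X_pow_sub_one_separable_iff.2 (by exact_mod_cast hn)).squarefree) ?_
    have : (ρ g) ^ (Nat.card Γ) = 1 := by rw [← map_pow, pow_card_eq_one']; simp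
    have h2 : (f g) ^ (Nat.card Γ) = 1 := by
      ext v
      have := congrArg (fun f : V →L[ℂ] V => f v) this
      simpa [f, Module.End.pow_apply] using this
    simp [h2]
  have hcomm : Pairwise fun i j ↦ Commute (f i) (f j) := by
    intro i j _
    ext v
    exact congrArg (fun f : V →L[ℂ] V => f v) (hc i j).eq
  have htop := Module.End.iSup_iInf_maxGenEigenspace_eq_top_of_iSup_maxGenEigenspace_eq_top_of_commute
    f hcomm (fun i => Module.End.iSup_maxGenEigenspace_eq_top (f i))
  let W : (Γ → ℂ) → Submodule ℂ V := fun χ => ⨅ i, (f i).eigenspace (χ i)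
  have htop' : ⨆ χ, W χ = ⊤ := by
    simpa only [W, (hss _).isFinitelySemisimple.maxGenEigenspace_eq_eigenspace] using htop
  have hW : ∀ χ v, v ∈ W χ → ∀ g, ρ g v = χ g • v := by
    intro χ v hv g
    have := (Submodule.mem_iInf _).1 hv g
    exact Module.End.mem_eigenspace_iff.1 this
  have horth : OrthogonalFamily ℂ (fun χ => W χ) (fun χ => (W χ).subtypeₗᵢ) := by
    intro χ ψ hne v w
    obtain ⟨g, hg⟩ := Function.ne_iff.1 hne
    exact brs_eig_orth ρ hρ g v w _ _ (hW χ v v.2 g) (hW ψ w w.2 g) hg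
  have hind : iSupIndep W := horth.independent
  have : Fintype {χ // W χ ≠ ⊥} := hind.fintypeNeBotOfFiniteDimensional
  have hcard := hind.subtype_ne_bot_le_finrank
  -- characters
  have hchar : ∀ χ : {χ // W χ ≠ ⊥}, ∃ c : Γ →* Circle, ∀ g, (c g : ℂ) = χ.1 g := by
    rintro ⟨χ, hχ⟩
    obtain ⟨v, hv, hv0⟩ := Submodule.exists_mem_ne_zero_of_ne_bot hχ
    have hn : ∀ g, ‖χ g‖ = 1 := by
      intro g
      have := hρ g v
      rw [hW χ v hv, norm_smul] at this
      have h0 : ‖v‖ ≠ 0 := by simpa using hv0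
      field_simp at this; exact this
    refine ⟨MonoidHom.mk' (fun g => ⟨χ g, mem_sphere_zero_iff_norm.2 (hn g)⟩) ?_, fun g => rfl⟩
    intro a b
    ext
    show χ (a * b) = χ a * χ b
    have h1 := hW χ v hv (a * b)
    rw [map_mul, mul_apply_eq_comp, hW χ v hv b, map_smul, hW χ v hv a, smul_smul] at h1
    rw [mul_comm (χ a)]
    exact (smul_left_injective ℂ hv0 h1).symm
  choose c hcχ using hchar
  obtain ⟨e, he⟩ := brs_exists_char
  obtain ⟨emb⟩ : Nonempty ({χ // W χ ≠ ⊥} ↪ Fin (Module.finrank ℂ V + 1)) := by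
    apply Function.Embedding.nonempty_of_card_le
    rw [Fintype.card_fin]; omega
  let τ : Γ →* Multiplicative (Torus (Module.finrank ℂ V + 1)) := MonoidHom.mk'
    (fun g => Multiplicative.ofAdd (fun i => if h : ∃ χ, emb χ = i then
      Multiplicative.toAdd (e (c h.choose g)) else 0)) (by
    intro a b
    rw [← ofAdd_add]
    congr 1
    funext i
    by_cases h : ∃ χ, emb χ = i
    · simp only [Pi.add_apply, dif_pos h, map_mul, toAdd_mul]
    · simp only [Pi.add_apply, dif_neg h, add_zero])
  have hτ : ∀ g χ, (Multiplicative.toAdd (τ g)) (emb χ) = Multiplicative.toAdd (e (c χ g)) := by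
    intro g χ
    have h : ∃ ψ, emb ψ = emb χ := ⟨χ, rfl⟩
    have h2 : h.choose = χ := emb.injective h.choose_spec
    show (if h : ∃ ψ, emb ψ = emb χ then Multiplicative.toAdd (e (c h.choose g)) else 0) = _
    rw [dif_pos h, h2]
  refine ⟨τ, fun x hx v => ?_⟩
  have hre : ∀ χ, W χ ≠ ⊥ → 1 / 2 ≤ (χ x).re := by
    intro χ hχ
    have h1 : dist ((0 : Torus (Module.finrank ℂ V + 1)) (emb ⟨χ, hχ⟩))
      ((Multiplicative.toAdd (τ x)) (emb ⟨χ, hχ⟩)) < 1 / 16 := (dist_le_pi_dist _ _ _).trans_lt hx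
    rw [hτ, Pi.zero_apply, dist_zero_left] at h1
    have h2 := brs_toCircle_norm (Multiplicative.toAdd (e (c ⟨χ, hχ⟩ x)))
    rw [he, hcχ] at h2
    have h3 : ‖χ x - 1‖ ≤ 1 / 2 := by
      refine h2.trans ?_
      have := Real.pi_lt_four
      have := Real.pi_pos
      nlinarith [norm_nonneg (Multiplicative.toAdd (e (c ⟨χ, hχ⟩ x)))]
    have h4 := (Complex.abs_re_le_norm _).trans h3
    rw [abs_le] at h4
    simp at h4
    linarith [h4.1]
  have hv : v ∈ ⨆ χ, W χ := by rw [htop']; trivial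
  obtain ⟨φ, hφ, rfl⟩ := (Submodule.mem_iSup_iff_exists_finsupp _ _).1 hv
  have hsum : ∀ l : (χ : Γ → ℂ) → W χ, ∑ χ ∈ φ.support, (W χ).subtypeₗᵢ (l χ) = 
    ∑ χ ∈ φ.support, (l χ : V) := fun l => rfl
  let l : (χ : Γ → ℂ) → W χ := fun χ => ⟨φ χ, hφ χ⟩
  let l' : (χ : Γ → ℂ) → W χ := fun χ => χ x • l χ
  have hN := horth.norm_sum l φ.support
  have hI := horth.inner_sum l l' φ.support
  have e1 : (φ.sum fun _ xi => xi) = ∑ χ ∈ φ.support, (W χ).subtypeₗᵢ (l χ) := rfl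
  have e2 : ρ x (∑ χ ∈ φ.support, (W χ).subtypeₗᵢ (l χ)) = ∑ χ ∈ φ.support, (W χ).subtypeₗᵢ (l' χ) := by
    rw [map_sum]
    refine Finset.sum_congr rfl fun χ _ => ?_
    exact hW χ _ (l χ).2 x
  rw [e1, e2, hI, hN, Complex.re_sum, Finset.mul_sum]
  refine Finset.sum_le_sum fun χ hχ => ?_
  have hne : W χ ≠ ⊥ := by
    intro h
    have := hφ χ
    rw [h, Submodule.mem_bot] at this
    exact (Finsupp.mem_support_iff.1 hχ) this
  have h5 : inner ℂ (l χ) (l' χ) = χ x * ((‖l χ‖ ^ 2 : ℝ) : ℂ) := by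
    simp only [l', inner_smul_right, inner_self_eq_norm_sq_to_K]
    simp
  rw [h5, Complex.re_mul_ofReal]
  exact mul_le_mul_of_nonneg_right (hre χ hne) (by positivity)

open scoped ComplexOrder in
theorem brs_fourier {Γ : Type*} [Group Γ] [Fintype Γ] [DecidableEq Γ] (A : Finset Γ)
    (hA : A.Nonempty) (K : ℕ) (hK : Fintype.card Γ ≤ K * A.card) :
    ∃ (V : Submodule ℂ (EuclideanSpace ℂ Γ)) (ρ : Γ →* (V →L[ℂ] V)) (v : V),
      Module.finrank ℂ V ≤ 4 * K ^ 2 ∧ (∀ g u, ‖ρ g u‖ = ‖u‖) ∧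
      ∀ x, 1 / 2 * ‖v‖ ^ 2 ≤ (inner ℂ v (ρ x v)).re →
        ∃ y z, y ∈ A * A⁻¹ ∧ z ∈ A * A⁻¹ ∧ x * z = y := by
  have ha : (0:ℝ) < A.card := by exact_mod_cast hA.card_pos
  have hKpos : (0:ℝ) < K := by
    have h0 : 0 < Fintype.card Γ := Fintype.card_pos
    have : 0 < K := by
      rcases Nat.eq_zero_or_pos K with h | h
      · subst h; omega
      · exact h
    exact_mod_cast this
  -- the convolution function
  let F : Γ → ℝ := fun g => ∑ z, (if g⁻¹ * z ∈ A then 1 else 0) * (if z ∈ A then 1 else 0)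
  have hF0 : ∀ g, 0 ≤ F g := fun g => Finset.sum_nonneg fun z _ => by positivity
  have hFsupp : ∀ g, F g ≠ 0 → g ∈ A * A⁻¹ := by
    intro g hg
    obtain ⟨z, -, hz⟩ := Finset.exists_ne_zero_of_sum_ne_zero hg
    by_cases h1 : g⁻¹ * z ∈ A
    · by_cases h2 : z ∈ A
      · exact Finset.mem_mul.2 ⟨z, h2, (g⁻¹ * z)⁻¹, Finset.inv_mem_inv h1, by group⟩
      · simp [h2] at hz
    · simp [h1] at hz
  have hF1 : F 1 = A.card := by simp [F]
  have hFsum : ∑ g, F g = (A.card : ℝ) ^ 2 := by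
    simp only [F]
    rw [Finset.sum_comm]
    have : ∀ z : Γ, ∑ g : Γ, ((if g⁻¹ * z ∈ A then (1:ℝ) else 0) * (if z ∈ A then 1 else 0))
        = A.card * (if z ∈ A then 1 else 0) := by
      intro z
      rw [← Finset.sum_mul]
      congr 1
      rw [← Equiv.sum_comp ((Equiv.inv Γ).trans (Equiv.mulLeft z)) ]
      simp
    simp only [this]
    rw [← Finset.mul_sum]
    simp [sq]
  -- matrices
  let Bm : Matrix Γ Γ ℂ := fun x y => if x⁻¹ * y ∈ A then 1 else 0
  let M : Matrix Γ Γ ℂ := Bm * Bm.conjTranspose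
  have hM : ∀ x y, M x y = (F (y⁻¹ * x) : ℂ) := by
    intro x y
    have h1 : M x y = ∑ z, Bm x z * star (Bm y z) := Matrix.mul_apply
    rw [h1, ← Equiv.sum_comp (Equiv.mulLeft y) (fun z => Bm x z * star (Bm y z))]
    simp only [F]
    push_cast
    refine Finset.sum_congr rfl fun z _ => ?_
    simp [Bm, mul_assoc]
    split_ifs <;> simp
  have hpsd : M.PosSemidef := Matrix.posSemidef_self_mul_conjTranspose Bm
  have hH := hpsd.isHermitian
  let e := hH.eigenvectorBasis
  let μ := hH.eigenvalues
  have hμ0 : ∀ i, 0 ≤ μ i := hpsd.eigenvalues_nonneg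
  let T : EuclideanSpace ℂ Γ →ₗ[ℂ] EuclideanSpace ℂ Γ := Matrix.toEuclideanLin M
  have hTe : ∀ i, T (e i) = (μ i : ℂ) • e i := by
    intro i
    have := hH.mulVec_eigenvectorBasis i
    ext j
    have := congrFun this j
    simpa [T] using this
  have hTsymm : ∀ u w, inner ℂ (T u) w = inner ℂ u (T w) :=
    (Matrix.isSymmetric_toEuclideanLin_iff.2 hH)
  have htr : ∑ i, μ i = Fintype.card Γ * A.card := by
    have h1 := hH.trace_eq_sum_eigenvalues
    have h2 : M.trace = ((Fintype.card Γ * A.card : ℝ) : ℂ) := by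
      simp [Matrix.trace, hM, hF1]
    rw [h2] at h1
    have h3 : ((Fintype.card Γ * A.card : ℝ) : ℂ) = ((∑ i, μ i : ℝ) : ℂ) := by
      rw [h1]; push_cast; rfl
    exact (Complex.ofReal_injective h3).symm
  -- the translations
  let L : Γ → (EuclideanSpace ℂ Γ ≃ₗᵢ[ℂ] EuclideanSpace ℂ Γ) := fun g =>
    LinearIsometryEquiv.piLpCongrLeft 2 ℂ ℂ (Equiv.mulLeft g)
  have hL : ∀ g u x, L g u x = u (g⁻¹ * x) := by
    intro g u x
    simp [L, LinearIsometryEquiv.piLpCongrLeft_apply, Equiv.piCongrLeft']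
  have hLmul : ∀ g h u, L (g * h) u = L g (L h u) := by
    intro g h u
    ext x
    simp [hL, mul_assoc]
  have hLT : ∀ g u, T (L g u) = L g (T u) := by
    intro g u
    ext x
    rw [hL]
    simp only [T, Matrix.toLpLin_apply, Matrix.mulVec, dotProduct, hM, hL]
    rw [← Equiv.sum_comp (Equiv.mulLeft g)]
    refine Finset.sum_congr rfl fun z _ => ?_
    simp [mul_assoc]
  let t : ℝ := (A.card : ℝ) ^ 2 / (4 * K)
  have ht : 0 < t := by positivity
  let I : Finset Γ := Finset.univ.filter fun i => t ≤ μ i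
  let V : Submodule ℂ (EuclideanSpace ℂ Γ) := Submodule.span ℂ ((I.image e : Finset _) : Set (EuclideanSpace ℂ Γ))
  have hmemV : ∀ i, t ≤ μ i → e i ∈ V := by
    intro i hi
    apply Submodule.subset_span
    simp only [Finset.coe_image]
    exact ⟨i, by simp [I, hi], rfl⟩
  have hdim : Module.finrank ℂ V ≤ 4 * K ^ 2 := by
    have h1 : Module.finrank ℂ V ≤ I.card :=
      (finrank_span_finset_le_card _).trans Finset.card_image_le
    have h2 : (I.card : ℝ) * t ≤ Fintype.card Γ * A.card := by
      rw [← htr, ← nsmul_eq_mul]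
      calc I.card • t ≤ ∑ i ∈ I, μ i :=
            Finset.card_nsmul_le_sum _ _ _ fun i hi => (Finset.mem_filter.1 hi).2
        _ ≤ _ := Finset.sum_le_sum_of_subset_of_nonneg (Finset.subset_univ _) fun i _ _ => hμ0 i
    have h3 : (Fintype.card Γ : ℝ) ≤ K * A.card := by exact_mod_cast hK
    have h4 : (I.card : ℝ) ≤ 4 * K ^ 2 := by
      have h5 : (I.card : ℝ) * t ≤ (4 * K ^ 2) * t := by
        refine h2.trans ((mul_le_mul_of_nonneg_right h3 ha.le).trans (le_of_eq ?_))
        simp only [t]; field_simp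
      exact le_of_mul_le_mul_right h5 ht
    exact h1.trans (by exact_mod_cast h4)
  have horth : ∀ i, μ i < t → e i ∈ Vᗮ := by
    intro i hi
    rw [Submodule.mem_orthogonal]
    intro u hu
    induction hu using Submodule.span_induction with
    | mem u hu =>
      simp only [Finset.coe_image] at hu
      obtain ⟨j, hj, rfl⟩ := hu
      have hj' : t ≤ μ j := by simpa [I] using hj
      apply e.orthonormal.2
      rintro rfl
      linarith
    | zero => simp
    | add a b _ _ ha hb => rw [inner_add_left, ha, hb, add_zero]
    | smul c a _ ha => rw [inner_smul_left, ha, mul_zero]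
  have hV : ∀ u, (∀ i, μ i < t → inner ℂ (e i) u = 0) → u ∈ V := by
    intro u hu
    rw [← e.sum_repr' u]
    refine Submodule.sum_mem _ fun i _ => ?_
    by_cases h : t ≤ μ i
    · exact V.smul_mem _ (hmemV i h)
    · rw [hu i (not_le.1 h), zero_smul]; exact V.zero_mem
  have hinv : ∀ g, ∀ u ∈ V, L g u ∈ V := by
    intro g u hu
    induction hu using Submodule.span_induction with
    | mem u hu =>
      simp only [Finset.coe_image] at hu
      obtain ⟨j, hj, rfl⟩ := hu
      have hj' : t ≤ μ j := by simpa [I] using hj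
      apply hV
      intro i hi
      have h1 := hTsymm (e i) (L g (e j))
      rw [hLT, hTe, hTe, map_smul, inner_smul_left, inner_smul_right, Complex.conj_ofReal] at h1
      have h2 : ((μ i : ℂ) - μ j) * inner ℂ (e i) (L g (e j)) = 0 := by
        linear_combination h1
      rcases mul_eq_zero.1 h2 with h3 | h3
      · have : μ i = μ j := by exact_mod_cast sub_eq_zero.1 h3
        linarith
      · exact h3
    | zero => simp
    | add a b _ _ ha hb => rw [map_add]; exact V.add_mem ha hb
    | smul c a _ ha => rw [map_smul]; exact V.smul_mem _ ha
  let ρ : Γ →* (V →L[ℂ] V) :=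
    { toFun := fun g => LinearMap.toContinuousLinearMap
        ((L g).toLinearEquiv.toLinearMap.restrict (hinv g))
      map_one' := by
        ext u x
        simp [hL]
      map_mul' := by
        intro g h
        ext u x
        simp [hLmul] }
  have hρ : ∀ g u, ((ρ g u : V) : EuclideanSpace ℂ Γ) = L g u := fun g u => rfl
  -- the function f
  let f : EuclideanSpace ℂ Γ := WithLp.toLp 2 fun x => (F x : ℂ)
  let d : EuclideanSpace ℂ Γ := EuclideanSpace.single 1 1
  have hfx : ∀ x, f x = (F x : ℂ) := fun x => rfl
  have hTd : T d = f := by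
    ext x
    simp only [T, d, Matrix.toLpLin_apply, Matrix.mulVec, dotProduct, hM, hfx]
    simp
  have hfd : inner ℂ d f = (A.card : ℂ) := by
    show inner ℂ (EuclideanSpace.single 1 1) f = _
    rw [EuclideanSpace.inner_single_left, hfx, hF1]; simp
  have hfnorm : ‖f‖ ^ 2 = ∑ x, F x ^ 2 := by
    rw [EuclideanSpace.norm_sq_eq]
    simp [hfx]
  have hflow : 4 * (t * A.card) ≤ ‖f‖ ^ 2 := by
    have h1 := sq_sum_le_card_mul_sum_sq (s := Finset.univ) (f := F)
    rw [hFsum, ← hfnorm, Finset.card_univ] at h1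
    have h3 : (Fintype.card Γ : ℝ) ≤ K * A.card := by exact_mod_cast hK
    have h4 : ((A.card : ℝ) ^ 2) ^ 2 ≤ K * A.card * ‖f‖ ^ 2 :=
      h1.trans (mul_le_mul_of_nonneg_right h3 (by positivity))
    have h5 : 4 * (t * A.card) * (K * A.card) ≤ ‖f‖ ^ 2 * (K * A.card) := by
      refine le_trans (le_of_eq ?_) (h4.trans (le_of_eq (by ring)))
      simp only [t]; field_simp
    exact le_of_mul_le_mul_right h5 (by positivity)
  let v : V := V.orthogonalProjectionOnto f
  let w : EuclideanSpace ℂ Γ := f - v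
  have hw : w ∈ Vᗮ := V.sub_starProjection_mem_orthogonal f
  have hcoef : ∀ i, inner ℂ (e i) f = (μ i : ℂ) * inner ℂ (e i) d := by
    intro i
    rw [← hTd, ← hTsymm, hTe, inner_smul_left, Complex.conj_ofReal]
  have hwnorm : ‖w‖ ^ 2 ≤ t * A.card := by
    have h1 : ∑ i, ‖inner ℂ (e i) w‖ ^ 2 = ‖w‖ ^ 2 := e.sum_sq_norm_inner_right w
    have h2 : ∑ i, μ i * ‖inner ℂ (e i) d‖ ^ 2 = A.card := by
      have h3 := e.sum_inner_mul_inner d f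
      rw [hfd] at h3
      have h4 : ((∑ i, μ i * ‖inner ℂ (e i) d‖ ^ 2 : ℝ) : ℂ) = ((A.card : ℝ) : ℂ) := by
        push_cast
        rw [← h3]
        refine Finset.sum_congr rfl fun i _ => ?_
        rw [hcoef, ← inner_conj_symm d (e i), mul_left_comm, mul_comm ((starRingEnd ℂ) _), Complex.mul_conj, Complex.normSq_eq_norm_sq]
        push_cast; rfl
      exact_mod_cast h4
    rw [← h1, ← h2, Finset.mul_sum]
    refine Finset.sum_le_sum fun i _ => ?_
    by_cases h : t ≤ μ i
    · have : inner ℂ (e i) w = 0 := (Submodule.mem_orthogonal _ _).1 hw _ (hmemV i h)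
      rw [this]
      rw [norm_zero, zero_pow two_ne_zero]
      exact mul_nonneg ht.le (mul_nonneg (hμ0 i) (sq_nonneg _))
    · push Not at h
      have h5 : inner ℂ (e i) w = (μ i : ℂ) * inner ℂ (e i) d := by
        have : inner ℂ (e i) (v : EuclideanSpace ℂ Γ) = 0 :=
          (Submodule.mem_orthogonal' _ _).1 (horth i h) _ v.2
        rw [inner_sub_right, this, sub_zero, hcoef]
      rw [h5, norm_mul, mul_pow, Complex.norm_real, Real.norm_of_nonneg (hμ0 i), ← mul_assoc]
      refine mul_le_mul_of_nonneg_right ?_ (by positivity)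
      nlinarith [hμ0 i]
  refine ⟨V, ρ, v, hdim, fun g u => ?_, fun x hx => ?_⟩
  · show ‖((ρ g u : V) : EuclideanSpace ℂ Γ)‖ = ‖(u : EuclideanSpace ℂ Γ)‖
    rw [hρ, (L g).norm_map]
  have hfvw : f = v + w := by simp [w]
  have hvw : inner ℂ (v : EuclideanSpace ℂ Γ) w = 0 := (Submodule.mem_orthogonal _ _).1 hw _ v.2
  have hpyth : ‖f‖ ^ 2 = ‖v‖ ^ 2 + ‖w‖ ^ 2 := by
    have := norm_add_sq_eq_norm_sq_add_norm_sq_of_inner_eq_zero (𝕜 := ℂ) (v : EuclideanSpace ℂ Γ) w hvw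
    rw [hfvw, sq, sq, sq, this]; rfl
  have hc1 : inner ℂ w (L x v) = 0 :=
    (Submodule.mem_orthogonal' _ _).1 hw _ (hinv x _ v.2)
  have hc2 : inner ℂ (v : EuclideanSpace ℂ Γ) (L x w) = 0 := by
    have h1 : (v : EuclideanSpace ℂ Γ) = L x (L x⁻¹ v) := by
      rw [← hLmul]; ext y; rw [hL, mul_inv_cancel, inv_one, one_mul]
    rw [h1, (L x).inner_map_map]
    exact (Submodule.mem_orthogonal _ _).1 hw _ (hinv _ _ v.2)
  have hexp : inner ℂ f (L x f) = inner ℂ v (ρ x v) + inner ℂ w (L x w) := by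
    rw [hfvw, map_add, inner_add_left, inner_add_right, inner_add_right, hc1, hc2, Submodule.coe_inner, hρ]
    ring
  have hwb : |(inner ℂ w (L x w)).re| ≤ ‖w‖ ^ 2 := by
    refine (Complex.abs_re_le_norm _).trans ((norm_inner_le_norm _ _).trans (le_of_eq ?_))
    rw [(L x).norm_map, sq]
  have hpos : 0 < (inner ℂ f (L x f)).re := by
    rw [hexp, Complex.add_re]
    have := (abs_le.1 hwb).1
    have : 0 < t * A.card := mul_pos ht ha
    linarith
  have hne : inner ℂ f (L x f) ≠ 0 := fun h => by rw [h] at hpos; simp at hpos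
  rw [PiLp.inner_apply] at hne
  obtain ⟨y, -, hy⟩ := Finset.exists_ne_zero_of_sum_ne_zero hne
  refine ⟨y, x⁻¹ * y, hFsupp _ ?_, hFsupp _ ?_, by group⟩
  · intro h; apply hy; simp [hfx, h]
  · intro h; apply hy; rw [hL]; simp [hfx, h]

theorem brs_combine {Γ : Type*} [Group Γ] [Finite Γ] {E : Type*} [NormedAddCommGroup E]
    [InnerProductSpace ℂ E] [FiniteDimensional ℂ E] (V : Submodule ℂ E)
    (ρ : Γ →* (V →L[ℂ] V)) (v : V) (K : ℕ) (P : Γ → Prop)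
    (hdim : Module.finrank ℂ V ≤ 4 * K ^ 2) (hρ : ∀ g u, ‖ρ g u‖ = ‖u‖)
    (hx : ∀ x, 1 / 2 * ‖v‖ ^ 2 ≤ (inner ℂ v (ρ x v)).re → P x) :
    ∃ H : Subgroup Γ, H.Normal ∧ H.index ≤ 5 ^ (2 * (4 * K ^ 2) ^ 2) ∧
      ((∀ x y : Γ, x * y = y * x) → H = ⊤) ∧ ∃ d : ℕ, d ≤ 4 * K ^ 2 ∧
      ∃ τ : H →* Multiplicative (Torus (d + 1)),
      ∀ x : H, dist (0 : Torus (d + 1)) (Multiplicative.toAdd (τ x)) < 1 / 16 → P x := by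
  have hH : ∃ H : Subgroup Γ, H.Normal ∧ H.index ≤ 5 ^ (2 * (4 * K ^ 2) ^ 2) ∧
      (∀ x ∈ H, ∀ y ∈ H, Commute (ρ x) (ρ y)) ∧
      ((∀ x y : Γ, x * y = y * x) → H = ⊤) := by
    by_cases hab : ∀ x y : Γ, x * y = y * x
    · refine ⟨⊤, inferInstance, ?_, ?_, fun _ => rfl⟩
      · rw [Subgroup.index_top]; exact Nat.one_le_pow _ _ (by norm_num)
      · intro x _ y _
        change ρ x * ρ y = ρ y * ρ x
        rw [← map_mul, ← map_mul, hab]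
    · obtain ⟨H, h1, h2, h3⟩ := brs_jordan ρ hρ
      refine ⟨H, h1, h2.trans ?_, h3, fun h => absurd h hab⟩
      apply Nat.pow_le_pow_right (by norm_num)
      exact Nat.mul_le_mul_left 2 (Nat.pow_le_pow_left hdim 2)
  obtain ⟨H, hn, hi, hcomm, htop⟩ := hH
  obtain ⟨τ, hτ⟩ := brs_diag (ρ.comp H.subtype) (fun g u => hρ g u)
    (fun x y => hcomm x x.2 y y.2)
  exact ⟨H, hn, hi, htop, _, hdim, τ, fun x h => hx x (hτ x h v)⟩

theorem brs_fourier2 {Γ : Type*} [Group Γ] [Fintype Γ] [DecidableEq Γ] (A : Finset Γ)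
    (hA : A.Nonempty) (K : ℕ) (hK : Fintype.card Γ ≤ K * A.card) :
    ∃ H : Subgroup Γ, H.Normal ∧ H.index ≤ 5 ^ (2 * (4 * K ^ 2) ^ 2) ∧
      ((∀ x y : Γ, x * y = y * x) → H = ⊤) ∧ ∃ d : ℕ, d ≤ 4 * K ^ 2 ∧
      ∃ τ : H →* Multiplicative (Torus (d + 1)),
      ∀ x : H, dist (0 : Torus (d + 1)) (Multiplicative.toAdd (τ x)) < 1 / 16 →
      ∃ y z, y ∈ A * A⁻¹ ∧ z ∈ A * A⁻¹ ∧ (x : Γ) * z = y := by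
  obtain ⟨V, ρ, v, hdim, hρ, hx⟩ := brs_fourier A hA K hK
  exact brs_combine V ρ v K _ hdim hρ hx

/-- **Bogolyubov–Ruzsa for small alternation.** For all positive integers `k`, `m` there
is `C` such that: if `G` is a group and `A ⊆ G` is nonempty finite with `|AA⁻¹A| ≤ k|A|`
and `⟨AA⁻¹⟩ = (AA⁻¹)ᵐ`, then there are a normal subgroup `H` of `⟨AA⁻¹⟩` of index at
most `C` and a `(δ, n)`-Bohr neighborhood `B` in `H` with `δ⁻¹, n ≤ C` such that
`B ⊆ (AA⁻¹)²`. Moreover, if `⟨AA⁻¹⟩` is abelian one may take `H = ⟨AA⁻¹⟩`. -/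
theorem bogolyubov_ruzsa_small_alternation (k m : ℕ) (hk : 0 < k) (hm : 0 < m) :
    ∃ C : ℕ, ∀ (G : Type) [Group G] [DecidableEq G],
      ∀ A : Finset G, A.Nonempty →
      (A * A⁻¹ * A).card ≤ k * A.card →
      ((Subgroup.closure ((A * A⁻¹ : Finset G) : Set G) : Set G)
        = (((A * A⁻¹) ^ m : Finset G) : Set G)) →
      ∃ (H : Subgroup ↥(Subgroup.closure ((A * A⁻¹ : Finset G) : Set G)))
        (δ : ℝ) (n : ℕ) (B : Set ↥H),
        H.Normal ∧ H.index ≤ C ∧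
        0 < δ ∧ δ⁻¹ ≤ (C : ℝ) ∧ 0 < n ∧ n ≤ C ∧
        IsBohrNbhd δ n B ∧
        (∀ x : ↥H, x ∈ B → ((x : ↥(Subgroup.closure ((A * A⁻¹ : Finset G) : Set G))) : G)
          ∈ ((A * A⁻¹) ^ 2 : Finset G)) ∧
        ((∀ x y : ↥(Subgroup.closure ((A * A⁻¹ : Finset G) : Set G)), x * y = y * x) →
          H = ⊤) := by
  classical
  set K : ℕ := (k ^ 2) ^ m with hK
  refine ⟨5 ^ (2 * (4 * K ^ 2) ^ 2) + 4 * K ^ 2 + 17, ?_⟩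
  intro G _ _ A hA hcard hcl
  set S : Subgroup G := Subgroup.closure ((A * A⁻¹ : Finset G) : Set G) with hS
  have hfin : Finite S := by
    have : ((S : Set G)).Finite := by rw [hcl]; exact Finset.finite_toSet _
    exact this.to_subtype
  let _ : Fintype S := Fintype.ofFinite S
  have hcardS : Fintype.card S ≤ K * A.card := by
    have h1 : Fintype.card S = ((A * A⁻¹) ^ m).card := by
      rw [← Nat.card_eq_fintype_card, ← Set.ncard_coe_finset, ← hcl]
      rfl
    rw [h1]
    exact brs_card A hA k hcard m
  obtain ⟨a₀, ha₀⟩ := hA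
  have hmem : ∀ a ∈ A, a * a₀⁻¹ ∈ S := fun a ha =>
    Subgroup.subset_closure (Finset.mem_coe.2 (Finset.mul_mem_mul ha (Finset.inv_mem_inv ha₀)))
  let A1 : Finset S := Finset.univ.filter (fun g : S => (g : G) * a₀ ∈ A)
  have hA1 : A1.Nonempty := ⟨1, by simp [A1, ha₀]⟩
  have hc1 : A.card ≤ A1.card := by
    have hsub : A ⊆ A1.image (fun g : S => (g : G) * a₀) := by
      intro a ha
      refine Finset.mem_image.2 ⟨⟨a * a₀⁻¹, hmem a ha⟩, ?_, ?_⟩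
      · simp [A1, ha]
      · simp
    exact (Finset.card_le_card hsub).trans Finset.card_image_le
  have hAA : ∀ y ∈ A1 * A1⁻¹, (y : G) ∈ A * A⁻¹ ∧ (y : G)⁻¹ ∈ A * A⁻¹ := by
    intro y hy
    obtain ⟨p, hp, q, hq, rfl⟩ := Finset.mem_mul.1 hy
    obtain ⟨r, hr, rfl⟩ := Finset.mem_inv.1 hq
    have hp1 : (p : G) * a₀ ∈ A := (Finset.mem_filter.1 hp).2
    have hr1 : (r : G) * a₀ ∈ A := (Finset.mem_filter.1 hr).2
    constructor
    · have := Finset.mul_mem_mul hp1 (Finset.inv_mem_inv hr1)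
      simpa [mul_assoc] using this
    · have := Finset.mul_mem_mul hr1 (Finset.inv_mem_inv hp1)
      simpa [mul_assoc] using this
  obtain ⟨H, hn, hi, htop, d, hdim, τ, hτ⟩ := brs_fourier2 A1 hA1 K
    (hcardS.trans (Nat.mul_le_mul_left K hc1))
  refine ⟨H, 1 / 16, d + 1,
    {x | dist (0 : Torus _) (Multiplicative.toAdd (τ x)) < 1 / 16}, hn, by omega, by norm_num,
    ?_, by omega, by omega, ⟨τ, rfl⟩, ?_, htop⟩
  · push_cast
    have h2 : (16 : ℝ) ≤ ((5 ^ (2 * (4 * K ^ 2) ^ 2) + 4 * K ^ 2 + 17 : ℕ) : ℝ) := by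
      exact_mod_cast (by omega : 16 ≤ 5 ^ (2 * (4 * K ^ 2) ^ 2) + 4 * K ^ 2 + 17)
    push_cast at h2
    norm_num at h2 ⊢
    linarith
  · intro x hxB
    obtain ⟨y, z, hy, hz, hxyz⟩ := hτ x hxB
    have : ((x : S) : G) = (y : G) * (z : G)⁻¹ := by
      rw [← hxyz]; simp
    rw [this, pow_two]
    exact Finset.mul_mem_mul (hAA y hy).1 (hAA z hz).2
end
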